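/- (Induction proposition, first kernel.) Let m ≥ 2, Δ > 1, 0 < α < 1/m, and let 0 ≤ l < m be an integer. There is a constant C, depending only on Δ, α, m and l, such that the following holds under the induction hypotheses. For every index i with l < i ≤ m, every measurable c : (0,∞) → ℂ with |c| ≤ 1 almost everywhere and every u ∈ ℝ^{2m}, set K(t,x) := c(t)(1+|u|^{4m})^{−1} ∫_{ℝ^m} (∂^0_i ∂^1_i g)_{tD}(x + Jp + tDu) dp. Then |Λ(𝒯,J,K)((F_j)_{j∈𝒞})| ≤ C (∏_{h=1}^m max(d_h^{2α}, d_h^{−2})) |Q_𝒯| ∏_{j∈𝒞} M_α(F_j)(A_j𝒯). -/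

import Mathlib

open MeasureTheory Matrix
open scoped ENNReal NNReal BigOperators

noncomputable section

namespace SBL

/-- The set of corners of the `m`-dimensional cube: functions `{1,…,m} → {0,1}`. -/
abbrev Corner (m : ℕ) := Fin m → Fin 2

/-- Index type for `ℝ^{2m}`: coordinates `x^0_i` (left) and `x^1_i` (right). -/
abbrev Idx (m : ℕ) := Fin m ⊕ Fin m

/-- The coordinate of `ℝ^{2m}` selected by the corner `j` at position `i`. -/
def sel {m : ℕ} (j : Corner m) (i : Fin m) : Idx m :=
  if j i = 0 then Sum.inl i else Sum.inr i

/-- The projection `Π_j : ℝ^{2m} → ℝ^m`, `Π_j x = (x_1^{j(1)},…,x_m^{j(m)})`. -/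
def proj {m : ℕ} (j : Corner m) (x : Idx m → ℝ) : Fin m → ℝ := fun i => x (sel j i)

/-- The projection `Π_j` as an `m × 2m` matrix. -/
def projM {m : ℕ} (j : Corner m) : Matrix (Fin m) (Idx m) ℝ :=
  Matrix.of fun i k => if k = sel j i then 1 else 0

/-- `A_j := Π_j J`, the `m × m` matrix obtained by applying `Π_j` to (the columns of) a
`2m × m` matrix `J`, i.e. selecting rows of `J` according to the corner `j`. -/
def Amat {m : ℕ} (J : Matrix (Idx m) (Fin m) ℝ) (j : Corner m) : Matrix (Fin m) (Fin m) ℝ :=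
  Matrix.of fun i k => J (sel j i) k

/-- Euclidean norm on a finite pi type. -/
def en {ι : Type*} [Fintype ι] (x : ι → ℝ) : ℝ := Real.sqrt (∑ i, (x i) ^ 2)

/-- Operator norm of a matrix with respect to the Euclidean norms. -/
def opNorm {ι κ : Type*} [Fintype ι] [Fintype κ] [DecidableEq κ] (A : Matrix ι κ ℝ) : ℝ :=
  ‖LinearMap.toContinuousLinearMap (Matrix.toEuclideanLin A)‖

/-- `Δ`-regularity of a square matrix: `max(‖A‖, |det A|⁻¹) ≤ Δ` (in particular `det A ≠ 0`). -/
def IsReg {m : ℕ} (Δ : ℝ) (A : Matrix (Fin m) (Fin m) ℝ) : Prop :=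
  opNorm A ≤ Δ ∧ A.det ≠ 0 ∧ |A.det|⁻¹ ≤ Δ

/-- A Calderón–Zygmund kernel of order `n` in `ℝ^m`, given by its multiplier `K̂` on
`ℝ^m ∖ {0}`: it is `n` times continuously differentiable there and satisfies the symbol
estimates `‖D^k K̂(η)‖ ≤ |η|^{-k}` for all `k ≤ n`. -/
def IsCZ {m : ℕ} (n : ℕ) (Khat : (Fin m → ℝ) → ℂ) : Prop :=
  ContDiffOn ℝ n Khat {0}ᶜ ∧
  ∀ k : ℕ, k ≤ n → ∀ η : Fin m → ℝ, η ≠ 0 →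
    ‖iteratedFDerivWithin ℝ k Khat {0}ᶜ η‖ ≤ (en η) ^ (-(k : ℝ))

/-- Fourier transform of a (nice) function on `ℝ^{2m}`. -/
def fourierT {m : ℕ} (φ : (Idx m → ℝ) → ℝ) (ξ : Idx m → ℝ) : ℂ :=
  ∫ x : Idx m → ℝ, Complex.exp (-2 * Real.pi * Complex.I * (∑ k, x k * ξ k)) * (φ x : ℂ)

/-- The principal value `p.v. ∫_{ℝ^{2m}} (∏_j F_j(Π_j x)) K(Πx) dx`, defined as
`∫_{ℝ^m} φ̂(−Π^T η) K̂(η) dη` with `φ = ∏_j F_j ∘ Π_j`. -/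
def pv {m : ℕ} (P : Matrix (Fin m) (Idx m) ℝ) (Khat : (Fin m → ℝ) → ℂ)
    (F : Corner m → (Fin m → ℝ) → ℝ) : ℂ :=
  ∫ η : Fin m → ℝ, fourierT (fun x => ∏ j, F j (proj j x)) (-(P.transpose.mulVec η)) * Khat η

/-- Upper `m×m` block `J^0` of a `2m×m` matrix. -/
def Jb0 {m : ℕ} (J : Matrix (Idx m) (Fin m) ℝ) : Matrix (Fin m) (Fin m) ℝ :=
  J.submatrix Sum.inl id

/-- Lower `m×m` block `J^1` of a `2m×m` matrix. -/
def Jb1 {m : ℕ} (J : Matrix (Idx m) (Fin m) ℝ) : Matrix (Fin m) (Fin m) ℝ :=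
  J.submatrix Sum.inr id

/-- `Π^J := (I, −J^0 (J^1)⁻¹)`. -/
def PiJ {m : ℕ} (J : Matrix (Idx m) (Fin m) ℝ) : Matrix (Fin m) (Idx m) ℝ :=
  Matrix.fromCols 1 (-(Jb0 J * (Jb1 J)⁻¹))

/-- The dyadic cube with parameters `Q = (k, n)`: `∏_i [2^k n_i, 2^k (n_i+1))`. -/
def dC {m : ℕ} (Q : ℤ × (Fin m → ℤ)) : Set (Fin m → ℝ) :=
  {x | ∀ i, (2:ℝ)^Q.1 * (Q.2 i : ℝ) ≤ x i ∧ x i < (2:ℝ)^Q.1 * ((Q.2 i : ℝ) + 1)}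

/-- `Q*`: the cube with the same center as `Q` and three times the side length. -/
def dCstar {m : ℕ} (Q : ℤ × (Fin m → ℤ)) : Set (Fin m → ℝ) :=
  {x | ∀ i, (2:ℝ)^Q.1 * ((Q.2 i : ℝ) - 1) ≤ x i ∧ x i < (2:ℝ)^Q.1 * ((Q.2 i : ℝ) + 2)}

/-- A (1/2-)sparse collection of dyadic cubes. -/
def IsSparse {m : ℕ} (S : Set (ℤ × (Fin m → ℤ))) : Prop :=
  ∀ Q ∈ S,
    (∑' Q' : {q : ℤ × (Fin m → ℤ) // q ∈ S ∧ dC q ⊆ dC Q}, volume (dC Q'.val)) ≤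
      2 * volume (dC Q)

/-- The average `[F]_S := (|S|⁻¹ ∫_S |F|^{2^{m-1}})^{2^{1-m}}`. -/
def avg {m : ℕ} (S : Set (Fin m → ℝ)) (F : (Fin m → ℝ) → ℝ) : ℝ :=
  (((volume S).toReal)⁻¹ * ∫ x in S, |F x| ^ (2^(m-1) : ℕ)) ^ ((2:ℝ) ^ ((1:ℤ) - (m:ℤ)))

/-- The closed axis-parallel box `∏_i [a_i, b_i]`. -/
def box {m : ℕ} (a b : Fin m → ℝ) : Set (Fin m → ℝ) := {x | ∀ i, a i ≤ x i ∧ x i ≤ b i}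

/-- Reciprocal eccentricity `ε_R = (min_i |I_i|)/(max_i |I_i|)` of the box `∏_i [a_i,b_i]`. -/
def ecc {m : ℕ} (a b : Fin m → ℝ) : ℝ := (⨅ i, (b i - a i)) / (⨆ i, (b i - a i))

/-- Modified strong maximal function evaluated on a set `S`:
`sup { (ε_R^α)^{2^{1-m}} [F]_R : R ∈ ℛ, S ⊆ R }` (as an extended real). -/
def Mal {m : ℕ} (α : ℝ) (F : (Fin m → ℝ) → ℝ) (S : Set (Fin m → ℝ)) : ℝ≥0∞ :=
  ⨆ (a : Fin m → ℝ) (b : Fin m → ℝ) (_ : ∀ i, a i < b i) (_ : S ⊆ box a b),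
    ENNReal.ofReal ((ecc a b ^ α) ^ ((2:ℝ) ^ ((1:ℤ) - (m:ℤ))) * avg (box a b) F)

/-- `M_α(F)(A𝒯) := sup_{Q ∈ 𝒯} M_α(F)(AQ)`. -/
def MalTree {m : ℕ} (α : ℝ) (F : (Fin m → ℝ) → ℝ) (A : Matrix (Fin m) (Fin m) ℝ)
    (T : Set (ℤ × (Fin m → ℤ))) : ℝ≥0∞ :=
  ⨆ Q ∈ T, Mal α F (A.mulVec '' dC Q)

/-- A convex tree of dyadic cubes with top cube `Qt`. -/
def ConvexTree {m : ℕ} (T : Set (ℤ × (Fin m → ℤ))) (Qt : ℤ × (Fin m → ℤ)) : Prop :=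
  Qt ∈ T ∧ (∀ Q ∈ T, dC Q ⊆ dC Qt) ∧
  ∀ Q ∈ T, ∀ Q' : ℤ × (Fin m → ℤ), dC Q ⊆ dC Q' → dC Q' ⊆ dC Qt → Q' ∈ T

/-- The Gaussian `g(x) = e^{−π|x|²}` on `ℝ^{2m}`. -/
def gss {m : ℕ} (x : Idx m → ℝ) : ℝ := Real.exp (-Real.pi * ∑ k, (x k) ^ 2)

/-- The mixed partial derivative `∂^0_i ∂^1_i g`. -/
def ddg {m : ℕ} (i : Fin m) (x : Idx m → ℝ) : ℝ :=
  fderiv ℝ (fun y : Idx m → ℝ => fderiv ℝ gss y (Pi.single (Sum.inl i) (1:ℝ))) x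
    (Pi.single (Sum.inr i) (1:ℝ))

/-- Isotropic `L¹` dilation on `ℝ^{2m}`: `φ_t(x) = t^{-2m} φ(t⁻¹ x)`. -/
def dil {m : ℕ} (t : ℝ) (φ : (Idx m → ℝ) → ℝ) (x : Idx m → ℝ) : ℝ :=
  (t ^ (2*m))⁻¹ * φ (t⁻¹ • x)

/-- Matrix dilation: `φ_D(x) = (det D)⁻¹ φ(D⁻¹ x)`. -/
def dilM {m : ℕ} (D : Matrix (Idx m) (Idx m) ℝ) (φ : (Idx m → ℝ) → ℝ) (x : Idx m → ℝ) : ℝ :=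
  (D.det)⁻¹ * φ (D⁻¹.mulVec x)

/-- The region `Ω_𝒯 = ∪_{Q∈𝒯} Q × (ℓ(Q)/2, ℓ(Q))` in the upper half space. -/
def Omega {m : ℕ} (T : Set (ℤ × (Fin m → ℤ))) : Set ((Fin m → ℝ) × ℝ) :=
  ⋃ Q ∈ T, (dC Q) ×ˢ Set.Ioo ((2:ℝ)^Q.1 / 2) ((2:ℝ)^Q.1)

/-- The localized form `Λ_𝒯((F_j)_j)`. -/
def LambdaT {m : ℕ} (J : Matrix (Idx m) (Fin m) ℝ) (T : Set (ℤ × (Fin m → ℤ)))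
    (c : ℝ → ℂ) (u : Idx m → ℝ) (i : Fin m) (F : Corner m → (Fin m → ℝ) → ℝ) : ℂ :=
  ∫ z in Omega T, c z.2 * Complex.ofReal ((1 + en u ^ (4*m))⁻¹ * (z.2)⁻¹ *
    ∫ x : Idx m → ℝ, (∏ j, F j (proj j x)) * dil z.2 (ddg i) (x - J.mulVec z.1 + z.2 • u))

/-- `T_k := ∪ {Q ∈ 𝒯 : ℓ(Q) = 2^k}`. -/
def Tkset {m : ℕ} (T : Set (ℤ × (Fin m → ℤ))) (k : ℤ) : Set (Fin m → ℝ) :=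
  ⋃ Q ∈ {q ∈ T | q.1 = k}, dC Q

/-- The form `Λ̃_𝒯((F_j)_j)` with localization in the `x` variables. -/
def LambdaTilde {m : ℕ} (J : Matrix (Idx m) (Fin m) ℝ) (T : Set (ℤ × (Fin m → ℤ)))
    (c : ℝ → ℂ) (u : Idx m → ℝ) (i : Fin m) (F : Corner m → (Fin m → ℝ) → ℝ) : ℂ :=
  ∑' k : ℤ, ∫ t in Set.Ioc ((2:ℝ)^(k-1)) ((2:ℝ)^k),
    c t * Complex.ofReal ((1 + en u ^ (4*m))⁻¹ * t⁻¹ *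
      ∫ p : Fin m → ℝ, ∫ x : Idx m → ℝ,
        (∏ j, Set.indicator ((Amat J j).mulVec '' Tkset T k) (F j) (proj j x)) *
          dil t (ddg i) (x - J.mulVec p + t • u))

/-- The form `Λ(𝒯,J,K)((F_j)_j)` from the induction proposition. -/
def LambdaK {m : ℕ} (J : Matrix (Idx m) (Fin m) ℝ) (T : Set (ℤ × (Fin m → ℤ)))
    (K : ℝ → (Idx m → ℝ) → ℂ) (F : Corner m → (Fin m → ℝ) → ℝ) : ℂ :=
  ∑' k : ℤ, ∫ x : Idx m → ℝ,
    Complex.ofReal (∏ j, Set.indicator ((Amat J j).mulVec '' Tkset T k) (F j) (proj j x)) *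
      ∫ t in Set.Ioc ((2:ℝ)^(k-1)) ((2:ℝ)^k), K t x * (t : ℂ)⁻¹

/-- The reflected corner `i∗j`, differing from `j` exactly at position `i`. -/
def istar {m : ℕ} (i : Fin m) (j : Corner m) : Corner m :=
  fun k => if k = i then 1 - j i else j k

/-- The diagonal matrix `Θ̃` with entry 0 at positions `i ≤ l` and 1 at positions `i > l`
(1-based), i.e. 0 for `i < l` and 1 otherwise in 0-based indexing. -/
def Th {m : ℕ} (l : ℕ) : Matrix (Fin m) (Fin m) ℝ :=
  Matrix.diagonal fun i => if (i : ℕ) < l then 0 else 1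

/-- The block diagonal matrix `Θ = diag(Θ̃, Θ̃)`. -/
def ThB {m : ℕ} (l : ℕ) : Matrix (Idx m) (Idx m) ℝ :=
  Matrix.diagonal (Sum.elim (fun i : Fin m => if (i:ℕ) < l then (0:ℝ) else 1)
    (fun i : Fin m => if (i:ℕ) < l then (0:ℝ) else 1))

end SBL

namespace SBL

/-- The derivatives of the one-dimensional Gaussian `e^{-π x²}`. -/
def gd (k : ℕ) : ℝ → ℝ := iteratedDeriv k (fun x : ℝ => Real.exp (-Real.pi * x ^ 2))

lemma gd_zero (x : ℝ) : gd 0 x = Real.exp (-Real.pi * x ^ 2) := by simp [gd]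

lemma hasDerivAt_gd (k : ℕ) (x : ℝ) : HasDerivAt (gd k) (gd (k + 1) x) x := by
  have hc : ContDiff ℝ (⊤ : ℕ∞) (fun x : ℝ => Real.exp (-Real.pi * x ^ 2)) := by fun_prop
  have hd : Differentiable ℝ (gd k) := hc.differentiable_iteratedDeriv k
    (by exact_mod_cast ENat.natCast_lt_top k)
  have := (hd x).hasDerivAt
  rw [gd, ← iteratedDeriv_succ] at this
  exact this

lemma continuous_gd (k : ℕ) : Continuous (gd k) :=
  continuous_iff_continuousAt.2 fun x => (hasDerivAt_gd k x).continuousAt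

lemma gd_one (x : ℝ) : gd 1 x = -2 * Real.pi * x * gd 0 x := by
  have h : HasDerivAt (gd 0) (-2 * Real.pi * x * gd 0 x) x := by
    have h0 : gd 0 = fun x => Real.exp (-Real.pi * x ^ 2) := funext gd_zero
    rw [h0]
    have := (((hasDerivAt_id x).pow 2).const_mul (-Real.pi)).exp
    refine this.congr_deriv ?_
    simp
    ring
  exact (hasDerivAt_gd 0 x).unique h

/-- The Hermite recursion, which is the heat equation in self-similar form. -/
lemma gd_add_two (k : ℕ) (x : ℝ) :
    gd (k + 2) x = -2 * Real.pi * ((k + 1) * gd k x + x * gd (k + 1) x) := by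
  induction k generalizing x with
  | zero =>
    have h : HasDerivAt (gd 1) (-2 * Real.pi * (gd 0 x + x * gd 1 x)) x := by
      have h0 : gd 1 = fun x => -2 * Real.pi * (x * gd 0 x) := by
        funext y; rw [gd_one]; ring
      have := ((hasDerivAt_id x).mul (hasDerivAt_gd 0 x)).const_mul (-2 * Real.pi)
      rw [h0]
      refine HasDerivAt.congr_deriv (f := fun x => -2 * Real.pi * (x * gd 0 x)) this ?_
      simp only [h0, id, one_mul, zero_add]
    have := (hasDerivAt_gd 1 x).unique h
    simpa using this
  | succ k ih =>
    have h0 : gd (k + 2) = fun x => -2 * Real.pi * ((k + 1) * gd k x + x * gd (k + 1) x) :=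
      funext ih
    have h1 := (((hasDerivAt_gd k x).const_mul ((k : ℝ) + 1)).add
      ((hasDerivAt_id x).mul (hasDerivAt_gd (k + 1) x))).const_mul (-2 * Real.pi)
    have h2 : HasDerivAt (gd (k + 2)) (-2 * Real.pi *
        ((k + 1) * gd (k + 1) x + (1 * gd (k + 1) x + x * gd (k + 2) x))) x := by
      refine HasDerivAt.congr_of_eventuallyEq ?_ (Filter.Eventually.of_forall ih)
      exact h1
    have := (hasDerivAt_gd (k + 2) x).unique h2
    rw [show k + 1 + 2 = k + 2 + 1 from rfl, this]
    push_cast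
    ring

lemma gd_decay (k n : ℕ) : ∃ C : ℝ, 0 ≤ C ∧ ∀ z : ℝ, |gd k z| * (1 + |z|) ^ n ≤ C := by
  have base : ∀ n : ℕ, ∃ C : ℝ, 0 ≤ C ∧ ∀ z : ℝ, |gd 0 z| * (1 + |z|) ^ n ≤ C := by
    intro n
    refine ⟨n.factorial * Real.exp 2, by positivity, fun z => ?_⟩
    have h1 : (1 + |z|) ^ n ≤ n.factorial * Real.exp (1 + |z|) := by
      have := Real.pow_div_factorial_le_exp (1 + |z|) (by positivity) n
      rw [div_le_iff₀ (by positivity)] at this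
      linarith
    rw [gd_zero, abs_of_pos (Real.exp_pos _)]
    calc Real.exp (-Real.pi * z ^ 2) * (1 + |z|) ^ n
        ≤ Real.exp (-Real.pi * z ^ 2) * (n.factorial * Real.exp (1 + |z|)) := by gcongr
      _ = n.factorial * Real.exp (-Real.pi * z ^ 2 + (1 + |z|)) := by rw [Real.exp_add _ (1 + |z|)]; ring
      _ ≤ n.factorial * Real.exp 2 := by
        gcongr
        have := Real.pi_gt_three
        rw [← sq_abs z]
        nlinarith [sq_nonneg (|z| - 1), abs_nonneg z, sq_nonneg |z|]
  have one : ∀ n : ℕ, ∃ C : ℝ, 0 ≤ C ∧ ∀ z : ℝ, |gd 1 z| * (1 + |z|) ^ n ≤ C := by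
    intro n
    obtain ⟨C, hC, h⟩ := base (n + 1)
    refine ⟨2 * Real.pi * C, by positivity, fun z => ?_⟩
    have h1 := h z
    have : |gd 1 z| = 2 * Real.pi * (|z| * |gd 0 z|) := by
      rw [gd_one, abs_mul, abs_mul, abs_mul, abs_neg, abs_of_pos Real.pi_pos]; simp; ring
    rw [this]
    have h2 : |z| * |gd 0 z| * (1 + |z|) ^ n ≤ |gd 0 z| * (1 + |z|) ^ (n + 1) := by
      rw [pow_succ]
      have : 0 ≤ |gd 0 z| * (1 + |z|) ^ n := by positivity
      nlinarith
    nlinarith [Real.pi_pos]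
  have key : ∀ k : ℕ, (∀ n : ℕ, ∃ C : ℝ, 0 ≤ C ∧ ∀ z : ℝ, |gd k z| * (1 + |z|) ^ n ≤ C) ∧
      (∀ n : ℕ, ∃ C : ℝ, 0 ≤ C ∧ ∀ z : ℝ, |gd (k + 1) z| * (1 + |z|) ^ n ≤ C) := by
    intro k
    induction k with
    | zero => exact ⟨base, one⟩
    | succ k ih =>
      refine ⟨ih.2, fun n => ?_⟩
      obtain ⟨C, hC, h⟩ := ih.1 n
      obtain ⟨C', hC', h'⟩ := ih.2 (n + 1)
      refine ⟨2 * Real.pi * ((k + 1) * C + C'), by positivity, fun z => ?_⟩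
      have e : |gd (k + 2) z| ≤ 2 * Real.pi * ((k + 1) * |gd k z| + |z| * |gd (k + 1) z|) := by
        rw [gd_add_two, abs_mul, abs_mul, abs_neg, abs_of_pos Real.pi_pos]
        have := abs_add_le (((k : ℝ) + 1) * gd k z) (z * gd (k + 1) z)
        rw [abs_mul, abs_mul, abs_of_pos (by positivity : (0 : ℝ) < k + 1)] at this
        simp only [abs_two]
        gcongr
      have h2 : |z| * |gd (k + 1) z| * (1 + |z|) ^ n ≤ C' := by
        refine le_trans ?_ (h' z)
        rw [pow_succ]
        have : 0 ≤ |gd (k + 1) z| * (1 + |z|) ^ n := by positivity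
        nlinarith
      have h3 : ((k : ℝ) + 1) * (|gd k z| * (1 + |z|) ^ n) ≤ (k + 1) * C := by
        gcongr; exact h z
      calc |gd (k + 2) z| * (1 + |z|) ^ n
          ≤ 2 * Real.pi * ((k + 1) * |gd k z| + |z| * |gd (k + 1) z|) * (1 + |z|) ^ n := by
            gcongr
        _ = 2 * Real.pi * ((k + 1) * (|gd k z| * (1 + |z|) ^ n) +
              |z| * |gd (k + 1) z| * (1 + |z|) ^ n) := by ring
        _ ≤ _ := by gcongr
  exact (key k).1 n

lemma integrable_of_decay {f : ℝ → ℝ} (hf : AEStronglyMeasurable f volume) {C : ℝ}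
    (h : ∀ z, |f z| * (1 + |z|) ^ 2 ≤ C) : Integrable f := by
  have hi : Integrable (fun z : ℝ => C * (1 + z ^ 2)⁻¹) := integrable_inv_one_add_sq.const_mul C
  refine hi.mono' hf (Filter.Eventually.of_forall fun z => ?_)
  have h1 : (1 + z ^ 2) ≤ (1 + |z|) ^ 2 := by
    rw [← sq_abs z]; nlinarith [abs_nonneg z]
  rw [Real.norm_eq_abs, ← div_eq_mul_inv, le_div_iff₀ (by positivity)]
  refine le_trans ?_ (h z)
  gcongr

lemma integrable_gd_mul_pow (k n : ℕ) : Integrable (fun z => |gd k z| * (1 + |z|) ^ n) := by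
  obtain ⟨C, -, h⟩ := gd_decay k (n + 2)
  refine integrable_of_decay (C := C) ?_ fun z => ?_
  · have := continuous_gd k
    exact (by fun_prop : Continuous fun z => |gd k z| * (1 + |z|) ^ n).aestronglyMeasurable
  · rw [abs_of_nonneg (by positivity), mul_assoc, ← pow_add]; exact h z

lemma gd_bounded (k : ℕ) : ∃ C : ℝ, 0 ≤ C ∧ ∀ z, |gd k z| ≤ C := by
  simpa using gd_decay k 0

lemma integrable_gd (k : ℕ) : Integrable (gd k) := by
  have := integrable_gd_mul_pow k 0
  simp only [pow_zero, mul_one] at this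
  exact (integrable_norm_iff (continuous_gd k).aestronglyMeasurable).1 this

lemma integral_gd_mul_gd (z : ℝ) :
    ∫ v, gd 0 (√2 * (z - v)) * gd 1 (√2 * v) = (2 * √2)⁻¹ * gd 1 z := by
  have e : ∀ v, gd 0 (√2 * (z - v)) * gd 1 (√2 * v) =
      -2 * Real.pi * √2 * Real.exp (-Real.pi * z ^ 2) *
        (((v - z / 2) + z / 2) * Real.exp (-(4 * Real.pi) * (v - z / 2) ^ 2)) := by
    intro v
    rw [gd_one, gd_zero, gd_zero]
    have : Real.exp (-Real.pi * (√2 * (z - v)) ^ 2) * Real.exp (-Real.pi * (√2 * v) ^ 2) =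
        Real.exp (-Real.pi * z ^ 2) * Real.exp (-(4 * Real.pi) * (v - z / 2) ^ 2) := by
      rw [← Real.exp_add, ← Real.exp_add]
      congr 1
      rw [mul_pow, mul_pow, Real.sq_sqrt (by norm_num)]
      ring
    linear_combination (-2 * Real.pi * (√2 * v)) * this
  simp_rw [e]
  rw [integral_const_mul, integral_sub_right_eq_self
    (fun v => (v + z / 2) * Real.exp (-(4 * Real.pi) * v ^ 2))]
  have h4 : (0 : ℝ) < 4 * Real.pi := by positivity
  have i1 : Integrable (fun v : ℝ => v * Real.exp (-(4 * Real.pi) * v ^ 2)) :=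
    integrable_mul_exp_neg_mul_sq h4
  have i2 : Integrable (fun v : ℝ => z / 2 * Real.exp (-(4 * Real.pi) * v ^ 2)) :=
    (integrable_exp_neg_mul_sq h4).const_mul _
  have o : ∫ v : ℝ, v * Real.exp (-(4 * Real.pi) * v ^ 2) = 0 := by
    have := integral_neg_eq_self (fun v : ℝ => v * Real.exp (-(4 * Real.pi) * v ^ 2)) volume
    simp only [neg_mul, even_two.neg_pow, integral_neg] at this
    simp only [neg_mul]
    linarith
  have g : ∫ v : ℝ, Real.exp (-(4 * Real.pi) * v ^ 2) = 1 / 2 := by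
    rw [integral_gaussian, show Real.pi / (4 * Real.pi) = (1 / 2) ^ 2 by
      field_simp; norm_num, Real.sqrt_sq (by norm_num)]
  simp_rw [add_mul]
  rw [integral_add i1 i2, o, integral_const_mul, g, gd_one, gd_zero]
  have hs : √2 * √2 = 2 := Real.mul_self_sqrt (by norm_num)
  have hs' : √2 ≠ 0 := by positivity
  field_simp
  linear_combination (-z) * hs

lemma gd_conv_aux (k : ℕ) (z : ℝ) :
    gd (k + 1) z = 2 * √2 * √2 ^ k * ∫ v, gd k (√2 * (z - v)) * gd 1 (√2 * v) := by
  induction k generalizing z with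
  | zero =>
    rw [integral_gd_mul_gd]
    have hs' : √2 ≠ 0 := by positivity
    field_simp
  | succ k ih =>
    obtain ⟨C, hC, hb⟩ := gd_bounded (k + 1)
    have c0 := continuous_gd k
    have c1 := continuous_gd (k + 1)
    have c2 := continuous_gd 1
    have i1 : Integrable (fun v => gd 1 (√2 * v)) :=
      (integrable_gd 1).comp_mul_left' (by positivity)
    have hD := hasDerivAt_integral_of_dominated_loc_of_deriv_le (μ := volume) (x₀ := z)
      (s := Set.univ) (F := fun z v => gd k (√2 * (z - v)) * gd 1 (√2 * v))
      (F' := fun z v => √2 * gd (k + 1) (√2 * (z - v)) * gd 1 (√2 * v))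
      (bound := fun v => √2 * C * |gd 1 (√2 * v)|) Filter.univ_mem
      (Filter.Eventually.of_forall fun x =>
        (by fun_prop : Continuous fun v => gd k (√2 * (x - v)) *
          gd 1 (√2 * v)).aestronglyMeasurable)
      (by
        obtain ⟨C0, hC0, hb0⟩ := gd_bounded k
        exact i1.bdd_mul (c := C0) (by fun_prop)
          (Filter.Eventually.of_forall fun v => by simpa using hb0 _))
      (by fun_prop)
      (Filter.Eventually.of_forall fun v x _ => by
        rw [Real.norm_eq_abs, abs_mul, abs_mul, abs_of_nonneg (Real.sqrt_nonneg 2)]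
        gcongr
        exact hb _)
      (i1.abs.const_mul _)
      (Filter.Eventually.of_forall fun v x _ => by
        have h1 : HasDerivAt (fun x => √2 * (x - v)) √2 x := by
          simpa using ((hasDerivAt_id x).sub_const v).const_mul √2
        have := ((hasDerivAt_gd k (√2 * (x - v))).comp x h1).mul_const (gd 1 (√2 * v))
        refine this.congr_deriv ?_
        ring)
    have h2 : HasDerivAt (gd (k + 1))
        (2 * √2 * √2 ^ k * ∫ v, √2 * gd (k + 1) (√2 * (z - v)) * gd 1 (√2 * v)) z := by
      exact (hD.2.const_mul (2 * √2 * √2 ^ k)).congr_of_eventuallyEq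
        (Filter.Eventually.of_forall ih)
    rw [(hasDerivAt_gd (k + 1) z).unique h2]
    simp_rw [mul_assoc √2 (gd (k + 1) _)]
    rw [integral_const_mul]
    ring

/-- Every higher derivative of the Gaussian is a superposition of translates of the first
derivative of a narrower Gaussian. -/
lemma gd_conv (k : ℕ) (z : ℝ) :
    gd (k + 1) z = 2 * √2 * √2 ^ k * ∫ v, gd k (√2 * v) * gd 1 (√2 * (z - v)) := by
  rw [gd_conv_aux, ← integral_sub_left_eq_self _ _ z]
  simp

lemma continuous_mulVec {ι κ : Type*} [Fintype ι] [Fintype κ] (A : Matrix ι κ ℝ) :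
    Continuous fun p : κ → ℝ => A *ᵥ p := by fun_prop

lemma lintegral_comp_mulVec {m : ℕ} {A : Matrix (Fin m) (Fin m) ℝ} (hA : A.det ≠ 0)
    {f : (Fin m → ℝ) → ℝ≥0∞} (hf : Measurable f) :
    ∫⁻ p, f (A *ᵥ p) = ENNReal.ofReal |A.det|⁻¹ * ∫⁻ y, f y := by
  have h := Real.map_matrix_volume_pi_eq_smul_volume_pi hA
  have h2 := lintegral_map (μ := volume) hf (continuous_mulVec A).measurable
  have h3 : (⇑(toLin' A)) = fun p => A *ᵥ p := by ext p : 1; simp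
  rw [h3] at h
  rw [h, lintegral_smul_measure, abs_inv] at h2
  simpa using h2.symm

lemma lintegral_comp_mulVec_add {m : ℕ} {A : Matrix (Fin m) (Fin m) ℝ} (hA : A.det ≠ 0)
    {f : (Fin m → ℝ) → ℝ≥0∞} (hf : Measurable f) (c : Fin m → ℝ) :
    ∫⁻ p, f (c + A *ᵥ p) = ENNReal.ofReal |A.det|⁻¹ * ∫⁻ y, f y := by
  rw [lintegral_comp_mulVec hA (f := fun y => f (c + y)) (by fun_prop),
    lintegral_add_left_eq_self]

/-- The dilated, translated one-dimensional profile. -/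
def ph (σ : ℝ) (b : ℕ) (u y : ℝ) : ℝ := σ⁻¹ * gd b (y / σ + u)

/-- The tensor product kernel on `ℝ^{2m}` translated along the range of `J`. -/
def ker {m : ℕ} (J : Matrix (Idx m) (Fin m) ℝ) (σ : Idx m → ℝ) (β : Idx m → ℕ)
    (u : Idx m → ℝ) (p : Fin m → ℝ) (x : Idx m → ℝ) : ℝ :=
  ∏ a, ph (σ a) (β a) (u a) (x a + (J *ᵥ p) a)

/-- The single scale form with weight `W`. -/
def V {m : ℕ} (J : Matrix (Idx m) (Fin m) ℝ) (W : (Idx m → ℝ) → ℝ) (σ : Idx m → ℝ)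
    (β : Idx m → ℕ) (u : Idx m → ℝ) : ℝ :=
  ∫ z : (Fin m → ℝ) × (Idx m → ℝ), W z.2 * ker J σ β u z.1 z.2

lemma measurable_ph_param (b : ℕ) : Measurable fun q : ℝ × ℝ × ℝ => ph q.1 b q.2.1 q.2.2 := by
  have := (continuous_gd b).measurable
  unfold ph
  fun_prop

lemma continuous_ph (σ : ℝ) (b : ℕ) (u : ℝ) : Continuous (ph σ b u) := by
  have := continuous_gd b
  unfold ph
  fun_prop

lemma integrable_ph {σ : ℝ} (hσ : σ ≠ 0) (b : ℕ) (u : ℝ) : Integrable (ph σ b u) := by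
  unfold ph
  refine Integrable.const_mul ?_ _
  exact ((integrable_gd b).comp_add_right u).comp_div hσ

lemma ph_bounded (σ : ℝ) (b : ℕ) (u : ℝ) : ∃ C, 0 ≤ C ∧ ∀ y, |ph σ b u y| ≤ C := by
  obtain ⟨C, hC, h⟩ := gd_bounded b
  refine ⟨|σ⁻¹| * C, by positivity, fun y => ?_⟩
  rw [ph, abs_mul]
  gcongr
  exact h _

lemma proj_add_mulVec {m : ℕ} (J : Matrix (Idx m) (Fin m) ℝ) (j : Corner m) (x : Idx m → ℝ)
    (p : Fin m → ℝ) (i : Fin m) :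
    x (sel j i) + (J *ᵥ p) (sel j i) = (proj j x + Amat J j *ᵥ p) i := by
  simp [proj, Amat, Matrix.mulVec, dotProduct]

/-- Splitting a product over all coordinates into a corner and the opposite corner. -/
lemma prod_idx_eq {m : ℕ} {M : Type*} [CommMonoid M] (j : Corner m) (f : Idx m → M) :
    ∏ a, f a = (∏ i, f (sel j i)) * ∏ i, f (sel (fun h => 1 - j h) i) := by
  rw [Fintype.prod_sum_type, ← Finset.prod_mul_distrib, ← Finset.prod_mul_distrib]
  refine Finset.prod_congr rfl fun i _ => ?_
  unfold sel
  obtain h | h : j i = 0 ∨ j i = 1 := by omega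
  · simp [h]
  · simp [h, mul_comm]

/-- An integrable weight against a tensor product of profiles: quantitative bound. -/
lemma lintegral_weight_mul_prod_le {m : ℕ} {J : Matrix (Idx m) (Fin m) ℝ} {j : Corner m}
    (hJ : (Amat J j).det ≠ 0) {W : (Idx m → ℝ) → ℝ} (hW : AEStronglyMeasurable W)
    (φ : Idx m → ℝ → ℝ) (hc : ∀ a, Measurable (φ a)) (hi : ∀ a, Integrable (φ a))
    (C : Idx m → ℝ) (hC : ∀ a y, |φ a y| ≤ C a) :
    ∫⁻ z : (Fin m → ℝ) × (Idx m → ℝ), ‖W z.2 * ∏ a, φ a (z.2 a + (J *ᵥ z.1) a)‖ₑ ≤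
      ENNReal.ofReal (∏ i, C (sel (fun h => 1 - j h) i)) * ((∫⁻ x, ‖W x‖ₑ) *
        (ENNReal.ofReal |(Amat J j).det|⁻¹ * ∏ i, ∫⁻ y, ‖φ (sel j i) y‖ₑ)) := by
  set ψ : (Fin m → ℝ) → ℝ := fun y => ∏ i, φ (sel j i) (y i) with hψ
  have hψm : Measurable ψ :=
    Finset.measurable_fun_prod _ fun i _ => (hc _).comp (measurable_pi_apply i)
  have hψi : Integrable ψ := Integrable.fintype_prod (f := fun i => φ (sel j i)) fun i => hi _
  have hpt : ∀ z : (Fin m → ℝ) × (Idx m → ℝ), ‖W z.2 * ∏ a, φ a (z.2 a + (J *ᵥ z.1) a)‖ₑ ≤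
      ENNReal.ofReal (∏ i, C (sel (fun h => 1 - j h) i)) *
        (‖W z.2‖ₑ * ‖ψ (proj j z.2 + Amat J j *ᵥ z.1)‖ₑ) := by
    intro z
    rw [enorm_mul, prod_idx_eq j, enorm_mul]
    have h1 : ‖∏ i, φ (sel (fun h => 1 - j h) i) (z.2 (sel (fun h => 1 - j h) i) +
        (J *ᵥ z.1) (sel (fun h => 1 - j h) i))‖ₑ ≤
        ENNReal.ofReal (∏ i, C (sel (fun h => 1 - j h) i)) := by
      rw [Real.enorm_eq_ofReal_abs, Finset.abs_prod]
      exact ENNReal.ofReal_le_ofReal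
        (Finset.prod_le_prod (fun _ _ => abs_nonneg _) fun _ _ => hC _ _)
    have h2 : (∏ i, φ (sel j i) (z.2 (sel j i) + (J *ᵥ z.1) (sel j i))) =
        ψ (proj j z.2 + Amat J j *ᵥ z.1) := by
      simp only [hψ, proj_add_mulVec]
    rw [h2]
    calc _ ≤ ‖W z.2‖ₑ * (‖ψ (proj j z.2 + Amat J j *ᵥ z.1)‖ₑ *
          ENNReal.ofReal (∏ i, C (sel (fun h => 1 - j h) i))) := by gcongr
      _ = _ := by ring
  refine (lintegral_mono hpt).trans ?_
  rw [lintegral_const_mul' _ _ ENNReal.ofReal_ne_top]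
  gcongr
  have hpr : Measurable fun x : Idx m → ℝ => proj j x :=
    measurable_pi_lambda _ fun i => measurable_pi_apply _
  have hA : Measurable fun p : Fin m → ℝ => Amat J j *ᵥ p := (continuous_mulVec _).measurable
  have hm2 : AEMeasurable (fun z : (Fin m → ℝ) × (Idx m → ℝ) =>
      ‖W z.2‖ₑ * ‖ψ (proj j z.2 + Amat J j *ᵥ z.1)‖ₑ) (volume.prod volume) := by
    refine AEMeasurable.mul (hW.comp_snd).enorm ?_
    exact (hψm.comp ((hpr.comp measurable_snd).add (hA.comp measurable_fst))).enorm.aemeasurable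
  rw [Measure.volume_eq_prod, lintegral_prod_symm _ hm2]
  have : ∀ x : Idx m → ℝ, ∫⁻ p, ‖W x‖ₑ * ‖ψ (proj j x + Amat J j *ᵥ p)‖ₑ =
      ‖W x‖ₑ * (ENNReal.ofReal |(Amat J j).det|⁻¹ * ∫⁻ y, ‖ψ y‖ₑ) := by
    intro x
    rw [lintegral_const_mul' _ _ enorm_ne_top,
      lintegral_comp_mulVec_add hJ (f := fun y => ‖ψ y‖ₑ) hψm.enorm]
  simp only [this]
  rw [lintegral_mul_const' _ _ (ENNReal.mul_ne_top ENNReal.ofReal_ne_top hψi.2.ne)]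
  gcongr
  refine le_of_eq ?_
  rw [← ofReal_integral_norm_eq_lintegral_enorm hψi]
  simp_rw [hψ, norm_prod, ← ofReal_integral_norm_eq_lintegral_enorm (hi _)]
  rw [integral_fintype_prod_volume_eq_prod (f := fun i y => ‖φ (sel j i) y‖),
    ENNReal.ofReal_prod_of_nonneg fun i _ => integral_nonneg fun _ => norm_nonneg _]

/-- Integrability of an integrable weight against a tensor product of profiles. -/
lemma integrable_weight_mul_prod {m : ℕ} {J : Matrix (Idx m) (Fin m) ℝ} {j : Corner m}
    (hJ : (Amat J j).det ≠ 0) {W : (Idx m → ℝ) → ℝ} (hW : Integrable W)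
    (φ : Idx m → ℝ → ℝ) (hc : ∀ a, Measurable (φ a)) (hi : ∀ a, Integrable (φ a))
    (hb : ∀ a, ∃ C, 0 ≤ C ∧ ∀ y, |φ a y| ≤ C) :
    Integrable fun z : (Fin m → ℝ) × (Idx m → ℝ) =>
      W z.2 * ∏ a, φ a (z.2 a + (J *ᵥ z.1) a) := by
  choose C hC0 hC using hb
  have hmul : Measurable fun p : Fin m → ℝ => J *ᵥ p := (continuous_mulVec J).measurable
  have hm : ∀ s : Finset (Idx m), Measurable fun z : (Fin m → ℝ) × (Idx m → ℝ) =>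
      ∏ a ∈ s, φ a (z.2 a + (J *ᵥ z.1) a) := by
    intro s
    refine Finset.measurable_fun_prod _ fun a _ => (hc a).comp ?_
    exact ((measurable_pi_apply a).comp measurable_snd).add
      ((measurable_pi_apply a).comp (hmul.comp measurable_fst))
  refine ⟨(hW.1.comp_snd).mul (hm _).aestronglyMeasurable, ?_⟩
  rw [hasFiniteIntegral_iff_enorm]
  refine (lintegral_weight_mul_prod_le hJ hW.1 φ hc hi C hC).trans_lt ?_
  refine ENNReal.mul_lt_top ENNReal.ofReal_lt_top (ENNReal.mul_lt_top hW.2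
    (ENNReal.mul_lt_top ENNReal.ofReal_lt_top ?_))
  exact ENNReal.prod_lt_top fun i _ => (hi _).2

lemma integrable_V {m : ℕ} {J : Matrix (Idx m) (Fin m) ℝ} {j : Corner m}
    (hJ : (Amat J j).det ≠ 0) {W : (Idx m → ℝ) → ℝ} (hW : Integrable W)
    {σ : Idx m → ℝ} (hσ : ∀ a, σ a ≠ 0) (β : Idx m → ℕ) (u : Idx m → ℝ) :
    Integrable fun z : (Fin m → ℝ) × (Idx m → ℝ) => W z.2 * ker J σ β u z.1 z.2 :=
  integrable_weight_mul_prod hJ hW (fun a => ph (σ a) (β a) (u a))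
    (fun _ => (continuous_ph _ _ _).measurable) (fun a => integrable_ph (hσ a) _ _)
    (fun _ => ph_bounded _ _ _)

lemma measurable_ker {m : ℕ} (J : Matrix (Idx m) (Fin m) ℝ) (β : Idx m → ℕ)
    (u : Idx m → ℝ) : Measurable fun q : (Idx m → ℝ) × (Fin m → ℝ) × (Idx m → ℝ) =>
      ker J q.1 β u q.2.1 q.2.2 := by
  have hmul : Measurable fun p : Fin m → ℝ => J *ᵥ p := (continuous_mulVec J).measurable
  refine Finset.measurable_fun_prod _ fun a _ => ?_
  have h1 : Measurable fun q : (Idx m → ℝ) × (Fin m → ℝ) × (Idx m → ℝ) =>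
      q.2.2 a + (J *ᵥ q.2.1) a :=
    ((measurable_pi_apply a).comp (measurable_snd.comp measurable_snd)).add
      ((measurable_pi_apply a).comp (hmul.comp (measurable_fst.comp measurable_snd)))
  have h2 : Measurable fun q : (Idx m → ℝ) × (Fin m → ℝ) × (Idx m → ℝ) => q.1 a :=
    (measurable_pi_apply a).comp measurable_fst
  exact (measurable_ph_param (β a)).comp (h2.prodMk (measurable_const.prodMk h1))

lemma measurable_V {m : ℕ} (J : Matrix (Idx m) (Fin m) ℝ) {W : (Idx m → ℝ) → ℝ}
    (hW : Measurable W) (β : Idx m → ℕ) (u : Idx m → ℝ) :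
    Measurable fun σ => V J W σ β u := by
  have h : Measurable fun q : (Idx m → ℝ) × (Fin m → ℝ) × (Idx m → ℝ) =>
      W q.2.2 * ker J q.1 β u q.2.1 q.2.2 :=
    (hW.comp (measurable_snd.comp measurable_snd)).mul (measurable_ker J β u)
  exact (h.stronglyMeasurable.integral_prod_right (ν := volume)).measurable

lemma lintegral_enorm_ph {σ : ℝ} (hσ : 0 < σ) (b : ℕ) (u : ℝ) :
    ∫⁻ y, ‖ph σ b u y‖ₑ = ∫⁻ y, ‖gd b y‖ₑ := by
  have h1 := ofReal_integral_norm_eq_lintegral_enorm (integrable_ph hσ.ne' b u)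
  rw [← h1, ← ofReal_integral_norm_eq_lintegral_enorm (integrable_gd b)]
  congr 1
  simp only [ph, norm_mul, integral_const_mul]
  have := Measure.integral_comp_div (fun y => ‖gd b (y + u)‖) σ
  rw [this, integral_add_right_eq_self (fun y => ‖gd b y‖), smul_eq_mul]
  simp only [norm_inv, Real.norm_eq_abs, abs_of_pos hσ]
  field_simp

/-- The single scale form is controlled by the scales of the coordinates opposite to a corner. -/
lemma exists_enorm_V_le {m : ℕ} (J : Matrix (Idx m) (Fin m) ℝ) {j : Corner m}
    (hJ : (Amat J j).det ≠ 0) {W : (Idx m → ℝ) → ℝ} (hW : Integrable W) (β : Idx m → ℕ)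
    (u : Idx m → ℝ) :
    ∃ C : ℝ, 0 ≤ C ∧ ∀ σ : Idx m → ℝ, (∀ a, 0 < σ a) →
      |V J W σ β u| ≤ C * ∏ i, (σ (sel (fun h => 1 - j h) i))⁻¹ := by
  choose C hC0 hC using fun a : Idx m => gd_bounded (β a)
  set L : ℝ≥0∞ := (∫⁻ x, ‖W x‖ₑ) *
        (ENNReal.ofReal |(Amat J j).det|⁻¹ * ∏ i, ∫⁻ y, ‖gd (β (sel j i)) y‖ₑ) with hL
  have hLt : L ≠ ⊤ := by
    refine (ENNReal.mul_lt_top hW.2 (ENNReal.mul_lt_top ENNReal.ofReal_lt_top ?_)).ne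
    exact ENNReal.prod_lt_top fun i _ => (integrable_gd _).2
  refine ⟨(∏ i, C (sel (fun h => 1 - j h) i)) * L.toReal,
    mul_nonneg (Finset.prod_nonneg fun _ _ => hC0 _) ENNReal.toReal_nonneg, fun σ hσ => ?_⟩
  have h := lintegral_weight_mul_prod_le hJ hW.1 (fun a => ph (σ a) (β a) (u a))
    (fun _ => (continuous_ph _ _ _).measurable) (fun a => integrable_ph (hσ a).ne' _ _)
    (fun a => (σ a)⁻¹ * C a) (fun a y => by
      rw [ph, abs_mul, abs_of_pos (inv_pos.2 (hσ a))]
      have := hσ a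
      gcongr
      exact hC a _)
  simp only [lintegral_enorm_ph (hσ _)] at h
  rw [← hL] at h
  have h2 := (enorm_integral_le_lintegral_enorm _).trans h
  have h3 : ‖V J W σ β u‖ₑ ≤ _ := h2
  rw [Real.enorm_eq_ofReal_abs, ← ENNReal.ofReal_toReal hLt, ← ENNReal.ofReal_mul
    (Finset.prod_nonneg fun i _ => mul_nonneg (inv_pos.2 (hσ _)).le (hC0 _))] at h3
  have hnn : 0 ≤ (∏ i, (σ (sel (fun h => 1 - j h) i))⁻¹ * C (sel (fun h => 1 - j h) i)) *
      L.toReal := mul_nonneg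
    (Finset.prod_nonneg fun i _ => mul_nonneg (inv_pos.2 (hσ _)).le (hC0 _)) ENNReal.toReal_nonneg
  have h4 := (ENNReal.ofReal_le_ofReal_iff hnn).1 h3
  rw [Finset.prod_mul_distrib] at h4
  linarith

lemma prod_erase_mul_ph {m : ℕ} (σ : Idx m → ℝ) (β : Idx m → ℕ) (u y : Idx m → ℝ) (a : Idx m)
    (n : ℕ) :
    (∏ b ∈ Finset.univ.erase a, ph (σ b) (β b) (u b) (y b)) * ph (σ a) (β a + n) (u a) (y a) =
      ∏ b, ph (σ b) ((β + Pi.single a n : Idx m → ℕ) b) (u b) (y b) := by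
  rw [← Finset.prod_erase_mul _ _ (Finset.mem_univ a)]
  congr 1
  · refine Finset.prod_congr rfl fun b hb => ?_
    simp [Pi.single_eq_of_ne (Finset.ne_of_mem_erase hb)]
  · simp

lemma hasDerivAt_ph (σ : ℝ) (b : ℕ) (u y : ℝ) :
    HasDerivAt (ph σ b u) (σ⁻¹ * ph σ (b + 1) u y) y := by
  have h1 : HasDerivAt (fun y => y / σ + u) (σ⁻¹) y := by
    simpa [div_eq_mul_inv] using ((hasDerivAt_id y).div_const σ).add_const u
  have := ((hasDerivAt_gd b (y / σ + u)).comp y h1).const_mul σ⁻¹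
  refine this.congr_deriv ?_
  rw [ph]; ring

/-- Integration by parts in the translation parameter. -/
lemma V_ibp {m : ℕ} {J : Matrix (Idx m) (Fin m) ℝ} {j : Corner m}
    (hJ : (Amat J j).det ≠ 0) {W : (Idx m → ℝ) → ℝ} (hW : Integrable W)
    {σ : Idx m → ℝ} (hσ : ∀ a, σ a ≠ 0) (β : Idx m → ℕ) (u : Idx m → ℝ) (k : Fin m) :
    ∑ a, J a k * (σ a)⁻¹ * V J W σ (β + Pi.single a 1) u = 0 := by
  set g' : (Fin m → ℝ) × (Idx m → ℝ) → ℝ := fun z =>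
    ∑ a, J a k * (σ a)⁻¹ * (W z.2 * ker J σ (β + Pi.single a 1) u z.1 z.2) with hg'
  have hi : ∀ a, Integrable fun z : (Fin m → ℝ) × (Idx m → ℝ) => J a k * (σ a)⁻¹ *
      (W z.2 * ker J σ (β + Pi.single a 1) u z.1 z.2) :=
    fun a => (integrable_V hJ hW hσ _ u).const_mul _
  have hgi : Integrable g' := integrable_finsetSum _ fun a _ => hi a
  have hd : ∀ z : (Fin m → ℝ) × (Idx m → ℝ),
      HasLineDerivAt ℝ (fun z : (Fin m → ℝ) × (Idx m → ℝ) => W z.2 * ker J σ β u z.1 z.2)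
        (g' z) z (Pi.single k 1, 0) := by
    intro z
    unfold HasLineDerivAt
    have h1 : ∀ a, HasDerivAt (fun t : ℝ => z.2 a + (J *ᵥ (z.1 + t • Pi.single k 1)) a)
        (J a k) 0 := by
      intro a
      have : ∀ t : ℝ, z.2 a + (J *ᵥ (z.1 + t • Pi.single k 1)) a =
          (z.2 a + (J *ᵥ z.1) a) + t * J a k := by
        intro t
        simp [Matrix.mulVec_add, Matrix.mulVec_smul]
        ring
      simp_rw [this]
      simpa using ((hasDerivAt_id (0 : ℝ)).mul_const (J a k)).const_add (z.2 a + (J *ᵥ z.1) a)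
    have h2 : ∀ a ∈ (Finset.univ : Finset (Idx m)),
        HasDerivAt (fun t : ℝ => ph (σ a) (β a) (u a)
          (z.2 a + (J *ᵥ (z.1 + t • Pi.single k 1)) a))
          ((σ a)⁻¹ * ph (σ a) (β a + 1) (u a) (z.2 a + (J *ᵥ z.1) a) * J a k) 0 := by
      intro a _
      have h3 := h1 a
      have h4 := hasDerivAt_ph (σ a) (β a) (u a) (z.2 a + (J *ᵥ z.1) a)
      have e : z.2 a + (J *ᵥ (z.1 + (0 : ℝ) • Pi.single k 1)) a = z.2 a + (J *ᵥ z.1) a := by simp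
      rw [← e] at h4
      have := h4.comp (0 : ℝ) h3
      rw [e] at this
      exact this
    have h5 := (HasDerivAt.fun_finsetProd h2).const_mul (W z.2)
    simp only [Prod.fst_add, Prod.snd_add, Prod.smul_fst, Prod.smul_snd, smul_zero, add_zero]
    unfold ker
    refine h5.congr_deriv ?_
    simp only [hg', ker]
    rw [Finset.mul_sum]
    refine Finset.sum_congr rfl fun a _ => ?_
    rw [← prod_erase_mul_ph]
    simp
    ring
  have hH : ((volume : Measure (Fin m → ℝ)).prod
      (volume : Measure (Idx m → ℝ))).IsAddHaarMeasure := Measure.prod.instIsAddHaarMeasure _ _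
  have hVi := integrable_V hJ hW hσ β u
  rw [Measure.volume_eq_prod] at hgi hVi
  have key := integral_bilinear_hasLineDerivAt_right_eq_neg_left_of_integrable
    (μ := (volume : Measure (Fin m → ℝ)).prod (volume : Measure (Idx m → ℝ)))
    (f := fun _ => (1 : ℝ)) (f' := fun _ => 0)
    (g := fun z : (Fin m → ℝ) × (Idx m → ℝ) => W z.2 * ker J σ β u z.1 z.2) (g' := g')
    (v := (Pi.single k 1, 0)) (B := ContinuousLinearMap.mul ℝ ℝ)
    (by simp) (by simpa using hgi) (by simpa using hVi)
    (fun x _ => by simpa [HasLineDerivAt] using hasDerivAt_const (0 : ℝ) (1 : ℝ))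
    (fun x _ => hd x)
  simp only [ContinuousLinearMap.mul_apply', one_mul, zero_mul, integral_zero, neg_zero] at key
  rw [← Measure.volume_eq_prod, hg', integral_finsetSum _ fun a _ => hi a] at key
  simp only [integral_const_mul] at key
  exact key

/-- Rescaling of the coordinates in `τ`. -/
def sc {m : ℕ} (τ : Finset (Idx m)) (s : ℝ) (σ : Idx m → ℝ) : Idx m → ℝ :=
  fun a => if a ∈ τ then s * σ a else σ a

lemma ph_uniform_decay (b : ℕ) {c₁ c₂ : ℝ} (h1 : 0 < c₁) (h2 : 0 ≤ c₂) :
    ∃ C : ℝ, 0 ≤ C ∧ ∀ σ, c₁ ≤ σ → σ ≤ c₂ → ∀ y, |ph σ b 0 y| ≤ C * ((1 + |y|) ^ 2)⁻¹ := by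
  obtain ⟨C, hC, h⟩ := gd_decay b 2
  refine ⟨c₁⁻¹ * C * (1 + c₂) ^ 2, by positivity, fun σ hσ1 hσ2 y => ?_⟩
  have hσ : 0 < σ := h1.trans_le hσ1
  rw [← div_eq_mul_inv, le_div_iff₀ (by positivity), ph, abs_mul, abs_of_pos (inv_pos.2 hσ),
    add_zero]
  have hy : 1 + |y| ≤ (1 + c₂) * (1 + |y / σ|) := by
    have : |y| = σ * |y / σ| := by rw [abs_div, abs_of_pos hσ]; field_simp
    rw [this]
    nlinarith [abs_nonneg (y / σ), mul_le_mul_of_nonneg_right hσ2 (abs_nonneg (y / σ))]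
  calc σ⁻¹ * |gd b (y / σ)| * (1 + |y|) ^ 2
      ≤ c₁⁻¹ * |gd b (y / σ)| * ((1 + c₂) * (1 + |y / σ|)) ^ 2 := by gcongr
    _ = c₁⁻¹ * (|gd b (y / σ)| * (1 + |y / σ|) ^ 2) * (1 + c₂) ^ 2 := by ring
    _ ≤ c₁⁻¹ * C * (1 + c₂) ^ 2 := by gcongr; exact h _

lemma ker_uniform_decay {m : ℕ} (J : Matrix (Idx m) (Fin m) ℝ) (β : Idx m → ℕ) {c₁ c₂ : ℝ}
    (h1 : 0 < c₁) (h2 : 0 ≤ c₂) :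
    ∃ C : ℝ, 0 ≤ C ∧ ∀ σ : Idx m → ℝ, (∀ a, c₁ ≤ σ a) → (∀ a, σ a ≤ c₂) → ∀ p x,
      |ker J σ β 0 p x| ≤ C * ∏ a, ((1 + |x a + (J *ᵥ p) a|) ^ 2)⁻¹ := by
  choose C hC0 hC using fun a => ph_uniform_decay (β a) h1 h2
  refine ⟨∏ a, C a, Finset.prod_nonneg fun a _ => hC0 a, fun σ hσ1 hσ2 p x => ?_⟩
  rw [ker, Finset.abs_prod, ← Finset.prod_mul_distrib]
  exact Finset.prod_le_prod (fun _ _ => abs_nonneg _) fun a _ => hC a _ (hσ1 a) (hσ2 a) _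

lemma integrable_weight_decay {m : ℕ} {J : Matrix (Idx m) (Fin m) ℝ} {j : Corner m}
    (hJ : (Amat J j).det ≠ 0) {W : (Idx m → ℝ) → ℝ} (hW : Integrable W) :
    Integrable fun z : (Fin m → ℝ) × (Idx m → ℝ) =>
      W z.2 * ∏ a, ((1 + |z.2 a + (J *ᵥ z.1) a|) ^ 2)⁻¹ := by
  have hm : Measurable fun y : ℝ => ((1 + |y|) ^ 2)⁻¹ := by fun_prop
  refine integrable_weight_mul_prod hJ hW (fun _ y => ((1 + |y|) ^ 2)⁻¹) (fun _ => hm)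
    (fun _ => integrable_of_decay (C := 1) hm.aestronglyMeasurable fun z => ?_)
    (fun _ => ⟨1, zero_le_one, fun y => ?_⟩)
  · rw [abs_of_nonneg (by positivity), inv_mul_cancel₀ (by positivity)]
  · rw [abs_of_nonneg (by positivity)]
    refine inv_le_one_of_one_le₀ ?_
    nlinarith [abs_nonneg y]

lemma hasDerivAt_ph_scale {σ s : ℝ} (hσ : 0 < σ) (hs : 0 < s) (b : ℕ) (y : ℝ) :
    HasDerivAt (fun s => ph (s * σ) b 0 y)
      (s⁻¹ * ((2 * Real.pi)⁻¹ * ph (s * σ) (b + 2) 0 y + b * ph (s * σ) b 0 y)) s := by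
  have hne : s * σ ≠ 0 := by positivity
  have h0 : HasDerivAt (fun s => s * σ) σ s := by simpa using (hasDerivAt_id s).mul_const σ
  have h1 : HasDerivAt (fun s => (s * σ)⁻¹) (-σ / (s * σ) ^ 2) s := h0.inv hne
  have h2 : HasDerivAt (fun s => y / (s * σ) + 0) (y * (-σ / (s * σ) ^ 2)) s := by
    simpa [div_eq_mul_inv] using h1.const_mul y
  have h3 := h1.mul ((hasDerivAt_gd b (y / (s * σ) + 0)).comp s h2)
  unfold ph
  refine h3.congr_deriv ?_
  rw [gd_add_two]
  simp only [Function.comp, add_zero]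
  have := Real.pi_pos
  field_simp
  ring

lemma sc_pos {m : ℕ} {τ : Finset (Idx m)} {s : ℝ} (hs : 0 < s) {σ : Idx m → ℝ}
    (hσ : ∀ a, 0 < σ a) (a : Idx m) : 0 < sc τ s σ a := by
  unfold sc
  have := hσ a
  split_ifs <;> positivity

lemma hasDerivAt_ker_scale {m : ℕ} (J : Matrix (Idx m) (Fin m) ℝ) (τ : Finset (Idx m))
    {σ : Idx m → ℝ} (hσ : ∀ a, 0 < σ a) (β : Idx m → ℕ) (p : Fin m → ℝ) (x : Idx m → ℝ)
    {s : ℝ} (hs : 0 < s) :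
    HasDerivAt (fun s => ker J (sc τ s σ) β 0 p x)
      (∑ a ∈ τ, s⁻¹ * ((2 * Real.pi)⁻¹ * ker J (sc τ s σ) (β + Pi.single a 2) 0 p x +
        β a * ker J (sc τ s σ) β 0 p x)) s := by
  have h2 : ∀ a ∈ (Finset.univ : Finset (Idx m)),
      HasDerivAt (fun s : ℝ => ph (sc τ s σ a) (β a) 0 (x a + (J *ᵥ p) a))
        (if a ∈ τ then s⁻¹ * ((2 * Real.pi)⁻¹ * ph (sc τ s σ a) (β a + 2) 0
            (x a + (J *ᵥ p) a) + β a * ph (sc τ s σ a) (β a) 0 (x a + (J *ᵥ p) a)) else 0) s := by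
    intro a _
    by_cases ha : a ∈ τ
    · simp only [sc, ha, if_true]
      exact hasDerivAt_ph_scale (hσ a) hs _ _
    · simp only [sc, ha, if_false]
      exact hasDerivAt_const _ _
  have h5 := HasDerivAt.fun_finsetProd h2
  unfold ker
  refine h5.congr_deriv ?_
  simp only [smul_eq_mul, mul_ite, mul_zero]
  rw [← Finset.sum_filter, Finset.filter_mem_eq_inter, Finset.univ_inter]
  refine Finset.sum_congr rfl fun a _ => ?_
  have e2 := prod_erase_mul_ph (sc τ s σ) β 0 (fun a => x a + (J *ᵥ p) a) a 2
  have e0 := Finset.prod_erase_mul Finset.univ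
    (fun b => ph (sc τ s σ b) (β b) 0 (x b + (J *ᵥ p) b)) (Finset.mem_univ a)
  simp only [Pi.zero_apply] at e2 e0 ⊢
  rw [← e2, ← e0]
  ring

/-- The heat flow identity for the single scale forms. -/
lemma hasDerivAt_V_scale {m : ℕ} {J : Matrix (Idx m) (Fin m) ℝ} {j : Corner m}
    (hJ : (Amat J j).det ≠ 0) {W : (Idx m → ℝ) → ℝ} (hW : Integrable W) (τ : Finset (Idx m))
    {σ : Idx m → ℝ} (hσ : ∀ a, 0 < σ a) (β : Idx m → ℕ) {s₀ : ℝ} (hs₀ : 0 < s₀) :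
    HasDerivAt (fun s => V J W (sc τ s σ) β 0)
      (∑ a ∈ τ, s₀⁻¹ * ((2 * Real.pi)⁻¹ * V J W (sc τ s₀ σ) (β + Pi.single a 2) 0 +
        β a * V J W (sc τ s₀ σ) β 0)) s₀ := by
  obtain ⟨c₁, hc₁, hcσ1⟩ : ∃ c > 0, ∀ a, c ≤ σ a := by
    by_cases hne : Nonempty (Idx m)
    · obtain ⟨a₀, ha₀⟩ := Finite.exists_min σ
      exact ⟨σ a₀, hσ _, ha₀⟩
    · exact ⟨1, one_pos, fun a => (hne ⟨a⟩).elim⟩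
  obtain ⟨c₂, hc₂, hcσ2⟩ : ∃ c > 0, ∀ a, σ a ≤ c :=
    ⟨1 + ∑ a, σ a, by linarith [Finset.sum_nonneg fun a (_ : a ∈ Finset.univ) => (hσ a).le],
      fun a => by
        linarith [Finset.single_le_sum (fun a _ => (hσ a).le) (Finset.mem_univ a)]⟩
  set d₁ := min c₁ (s₀ / 2 * c₁) with hd₁
  set d₂ := max c₂ (2 * s₀ * c₂) with hd₂
  have hd₁0 : 0 < d₁ := by positivity
  have hd₂0 : 0 ≤ d₂ := by positivity
  have hrange : ∀ s ∈ Set.Ioo (s₀ / 2) (2 * s₀), (∀ a, d₁ ≤ sc τ s σ a) ∧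
      ∀ a, sc τ s σ a ≤ d₂ := by
    intro s hs
    constructor <;> intro a <;> unfold sc <;> split_ifs
    · refine (min_le_right _ _).trans ?_
      have := hcσ1 a
      have := hs.1.le
      gcongr
      linarith
    · exact (min_le_left _ _).trans (hcσ1 a)
    · refine le_trans ?_ (le_max_right _ _)
      have := hcσ2 a
      have := hs.2.le
      have := hσ a
      gcongr
    · exact (hcσ2 a).trans (le_max_left _ _)
  choose C hC0 hC using fun a : Idx m => ker_uniform_decay J (β + Pi.single a 2) hd₁0 hd₂0
  obtain ⟨C', hC'0, hC'⟩ := ker_uniform_decay J β hd₁0 hd₂0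
  set B : ℝ := ∑ a ∈ τ, (s₀ / 2)⁻¹ * ((2 * Real.pi)⁻¹ * C a + β a * C') with hB
  have hdec := integrable_weight_decay hJ hW
  have hiV : ∀ s ∈ Set.Ioo (s₀ / 2) (2 * s₀), ∀ γ, Integrable
      fun z : (Fin m → ℝ) × (Idx m → ℝ) => W z.2 * ker J (sc τ s σ) γ 0 z.1 z.2 := by
    intro s hs γ
    exact integrable_V hJ hW (fun a => (sc_pos ((half_pos hs₀).trans hs.1) hσ a).ne') γ 0
  have hmem : s₀ ∈ Set.Ioo (s₀ / 2) (2 * s₀) := ⟨by linarith, by linarith⟩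
  have hFi : ∀ a : Idx m, Integrable fun z : (Fin m → ℝ) × (Idx m → ℝ) =>
      s₀⁻¹ * ((2 * Real.pi)⁻¹ * (W z.2 * ker J (sc τ s₀ σ) (β + Pi.single a 2) 0 z.1 z.2) +
        β a * (W z.2 * ker J (sc τ s₀ σ) β 0 z.1 z.2)) := fun a =>
    (((hiV _ hmem _).const_mul _).add ((hiV _ hmem _).const_mul _)).const_mul _
  have hmeas : AEStronglyMeasurable (fun z : (Fin m → ℝ) × (Idx m → ℝ) =>
      ∑ a ∈ τ, s₀⁻¹ * ((2 * Real.pi)⁻¹ * (W z.2 *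
        ker J (sc τ s₀ σ) (β + Pi.single a 2) 0 z.1 z.2) +
          β a * (W z.2 * ker J (sc τ s₀ σ) β 0 z.1 z.2))) volume :=
    Finset.aestronglyMeasurable_fun_sum τ fun a _ => (hFi a).1
  have hD := hasDerivAt_integral_of_dominated_loc_of_deriv_le (μ := volume) (x₀ := s₀)
    (s := Set.Ioo (s₀ / 2) (2 * s₀))
    (F := fun s (z : (Fin m → ℝ) × (Idx m → ℝ)) => W z.2 * ker J (sc τ s σ) β 0 z.1 z.2)
    (F' := fun s z => ∑ a ∈ τ, s⁻¹ * ((2 * Real.pi)⁻¹ * (W z.2 *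
      ker J (sc τ s σ) (β + Pi.single a 2) 0 z.1 z.2) +
        β a * (W z.2 * ker J (sc τ s σ) β 0 z.1 z.2)))
    (bound := fun z => B * |W z.2 * ∏ a, ((1 + |z.2 a + (J *ᵥ z.1) a|) ^ 2)⁻¹|)
    (isOpen_Ioo.mem_nhds hmem)
    (Filter.eventually_of_mem (isOpen_Ioo.mem_nhds hmem) fun s hs => (hiV s hs β).1)
    (hiV _ hmem β)
    (by exact hmeas)
    (Filter.Eventually.of_forall fun z s hs => by
      have hspos : 0 < s := (half_pos hs₀).trans hs.1
      have hinv : s⁻¹ ≤ (s₀ / 2)⁻¹ := inv_anti₀ (half_pos hs₀) hs.1.le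
      set P := ∏ a, ((1 + |z.2 a + (J *ᵥ z.1) a|) ^ 2)⁻¹ with hP
      have hP0 : 0 ≤ P := Finset.prod_nonneg fun _ _ => by positivity
      rw [Real.norm_eq_abs, hB, Finset.sum_mul]
      refine (Finset.abs_sum_le_sum_abs _ _).trans (Finset.sum_le_sum fun a _ => ?_)
      have k1 := hC a _ (hrange s hs).1 (hrange s hs).2 z.1 z.2
      have k2 := hC' _ (hrange s hs).1 (hrange s hs).2 z.1 z.2
      rw [← hP] at k1 k2
      rw [abs_mul, abs_of_pos (inv_pos.2 hspos), mul_assoc]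
      have hpi := Real.pi_pos
      have h3 : |(2 * Real.pi)⁻¹ * (W z.2 * ker J (sc τ s σ) (β + Pi.single a 2) 0 z.1 z.2) +
          β a * (W z.2 * ker J (sc τ s σ) β 0 z.1 z.2)| ≤
          ((2 * Real.pi)⁻¹ * C a + β a * C') * |W z.2 * P| := by
        refine (abs_add_le _ _).trans ?_
        rw [abs_mul, abs_mul, abs_mul, abs_mul (W z.2), abs_mul (W z.2), abs_of_nonneg hP0,
          abs_of_pos (by positivity : 0 < (2 * Real.pi)⁻¹), Nat.abs_cast]
        calc _ ≤ (2 * Real.pi)⁻¹ * (|W z.2| * (C a * P)) + β a * (|W z.2| * (C' * P)) := by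
              gcongr
          _ = _ := by ring
      have h4 : 0 ≤ ((2 * Real.pi)⁻¹ * C a + β a * C') * |W z.2 * P| := by
        have := hC0 a
        positivity
      exact mul_le_mul hinv h3 (abs_nonneg _) (by positivity))
    (hdec.abs.const_mul B)
    (Filter.Eventually.of_forall fun z s hs => by
      have := (hasDerivAt_ker_scale J τ hσ β z.1 z.2
        ((half_pos hs₀).trans hs.1)).const_mul (W z.2)
      refine this.congr_deriv ?_
      rw [Finset.mul_sum]
      exact Finset.sum_congr rfl fun a _ => by ring)
  unfold V
  refine hD.2.congr_deriv ?_
  rw [integral_finsetSum _ fun a _ => hFi a]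
  refine Finset.sum_congr rfl fun a _ => ?_
  rw [integral_const_mul, integral_add ((hiV _ hmem _).const_mul _) ((hiV _ hmem _).const_mul _),
    integral_const_mul, integral_const_mul]

lemma sel_one {m : ℕ} (i : Fin m) : sel (fun _ => 1) i = Sum.inr i := by simp [sel]

lemma sel_zero {m : ℕ} (i : Fin m) : sel (fun _ => 0) i = Sum.inl i := by simp [sel]

lemma sc_one {m : ℕ} (τ : Finset (Idx m)) (σ : Idx m → ℝ) : sc τ 1 σ = σ := by
  ext a; simp [sc]

lemma continuousOn_V_scale {m : ℕ} {J : Matrix (Idx m) (Fin m) ℝ} {j : Corner m}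
    (hJ : (Amat J j).det ≠ 0) {W : (Idx m → ℝ) → ℝ} (hW : Integrable W) (τ : Finset (Idx m))
    {σ : Idx m → ℝ} (hσ : ∀ a, 0 < σ a) (β : Idx m → ℕ) :
    ContinuousOn (fun s => V J W (sc τ s σ) β 0) (Set.Ioi 0) :=
  fun _ hs => (hasDerivAt_V_scale hJ hW τ hσ β hs).continuousAt.continuousWithinAt

/-- A single scale form as a superposition of forms with two more derivatives. -/
lemma V_scale_sub {m : ℕ} {J : Matrix (Idx m) (Fin m) ℝ} {j : Corner m}
    (hJ : (Amat J j).det ≠ 0) {W : (Idx m → ℝ) → ℝ} (hW : Integrable W) (τ : Finset (Idx m))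
    {σ : Idx m → ℝ} (hσ : ∀ a, 0 < σ a) (β : Idx m → ℕ) {s₁ s₂ : ℝ} (h1 : 0 < s₁)
    (h12 : s₁ ≤ s₂) :
    (s₂ ^ (∑ a ∈ τ, β a))⁻¹ * V J W (sc τ s₂ σ) β 0 -
      (s₁ ^ (∑ a ∈ τ, β a))⁻¹ * V J W (sc τ s₁ σ) β 0 =
      ∫ s in s₁..s₂, (s ^ (∑ a ∈ τ, β a))⁻¹ * s⁻¹ * (2 * Real.pi)⁻¹ *
        ∑ a ∈ τ, V J W (sc τ s σ) (β + Pi.single a 2) 0 := by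
  set B := ∑ a ∈ τ, β a with hB
  have hpos : ∀ s ∈ Set.uIcc s₁ s₂, 0 < s := by
    intro s hs
    rw [Set.uIcc_of_le h12] at hs
    exact h1.trans_le hs.1
  refine (intervalIntegral.integral_eq_sub_of_hasDerivAt
    (f := fun s => (s ^ B)⁻¹ * V J W (sc τ s σ) β 0) (fun s hs => ?_) ?_).symm
  · have hs0 := hpos s hs
    have h2 : HasDerivAt (fun s : ℝ => (s ^ B)⁻¹) (-(B * (s ^ B)⁻¹ * s⁻¹)) s := by
      have := (hasDerivAt_pow B s).inv (pow_pos hs0 B).ne'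
      refine this.congr_deriv ?_
      rcases B with _ | n
      · simp
      · simp only [Nat.add_sub_cancel]
        field_simp
        ring
    refine (h2.mul (hasDerivAt_V_scale hJ hW τ hσ β hs0)).congr_deriv ?_
    have : ∑ a ∈ τ, s⁻¹ * ((2 * Real.pi)⁻¹ * V J W (sc τ s σ) (β + Pi.single a 2) 0 +
        β a * V J W (sc τ s σ) β 0) = s⁻¹ * ((2 * Real.pi)⁻¹ * ∑ a ∈ τ,
          V J W (sc τ s σ) (β + Pi.single a 2) 0 + B * V J W (sc τ s σ) β 0) := by
      rw [← Finset.mul_sum, Finset.sum_add_distrib, ← Finset.mul_sum, ← Finset.sum_mul, hB]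
      push_cast
      rfl
    rw [this]
    ring
  · refine ContinuousOn.intervalIntegrable ?_
    have hsub : Set.uIcc s₁ s₂ ⊆ Set.Ioi 0 := hpos
    have hc : ContinuousOn (fun s => ∑ a ∈ τ, V J W (sc τ s σ) (β + Pi.single a 2) 0)
        (Set.uIcc s₁ s₂) := continuousOn_finsetSum _ fun a _ =>
      (continuousOn_V_scale hJ hW τ hσ _).mono hsub
    refine ContinuousOn.mul (ContinuousOn.mul (ContinuousOn.mul ?_ ?_) continuousOn_const) hc
    · exact (continuousOn_pow B).inv₀ fun s hs => (pow_pos (hpos s hs) B).ne'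
    · exact continuousOn_id.inv₀ fun s hs => (hpos s hs).ne'

lemma enorm_V_le_lintegral {m : ℕ} {J : Matrix (Idx m) (Fin m) ℝ}
    (hJ : (Amat J fun _ => 1).det ≠ 0) {W : (Idx m → ℝ) → ℝ} (hWm : Measurable W)
    (hW : Integrable W) (τ : Finset (Idx m)) {i : Fin m} (hi : Sum.inl i ∈ τ)
    {σ : Idx m → ℝ} (hσ : ∀ a, 0 < σ a) (β : Idx m → ℕ) :
    ‖V J W σ β 0‖ₑ ≤ ∑ a ∈ τ, ∫⁻ s in Set.Ioi (1 : ℝ),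
      ENNReal.ofReal ((s ^ (∑ a ∈ τ, β a))⁻¹ * s⁻¹) *
        ‖V J W (sc τ s σ) (β + Pi.single a 2) 0‖ₑ := by
  set B := ∑ a ∈ τ, β a with hB
  obtain ⟨C, hC0, hC⟩ := exists_enorm_V_le J hJ hW β 0
  set C' := C * ∏ i, (σ (Sum.inl i))⁻¹ with hC'
  have hdecay : ∀ s, 1 ≤ s → |V J W (sc τ s σ) β 0| ≤ C' * s⁻¹ := by
    intro s hs
    have hs0 : 0 < s := by linarith
    refine (hC _ fun a => sc_pos hs0 hσ a).trans ?_
    simp only [sub_self, sel_zero]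
    rw [hC', mul_assoc]
    gcongr
    rw [← Finset.mul_prod_erase _ _ (Finset.mem_univ i),
      ← Finset.mul_prod_erase Finset.univ (fun i => (σ (Sum.inl i))⁻¹) (Finset.mem_univ i),
      mul_comm _ s⁻¹, ← mul_assoc]
    have e1 : (sc τ s σ (Sum.inl i))⁻¹ = s⁻¹ * (σ (Sum.inl i))⁻¹ := by
      simp [sc, hi, mul_comm]
    rw [e1]
    have := hσ (Sum.inl i)
    gcongr with h _
    · exact fun h _ => (inv_pos.2 (sc_pos hs0 hσ _)).le
    · exact hσ _
    · unfold sc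
      have := hσ (Sum.inl h)
      split_ifs
      · nlinarith
      · exact le_rfl
  have hstep : ∀ s₂ : ℝ, 1 ≤ s₂ → ‖V J W σ β 0‖ₑ ≤ ENNReal.ofReal (C' * s₂⁻¹) +
      ∑ a ∈ τ, ∫⁻ s in Set.Ioi (1 : ℝ), ENNReal.ofReal ((s ^ B)⁻¹ * s⁻¹) *
        ‖V J W (sc τ s σ) (β + Pi.single a 2) 0‖ₑ := by
    intro s₂ hs₂
    have hs0 : 0 < s₂ := by linarith
    have h := V_scale_sub hJ hW τ hσ β one_pos hs₂
    rw [← hB, sc_one, one_pow, inv_one, one_mul] at h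
    have h' : V J W σ β 0 = (s₂ ^ B)⁻¹ * V J W (sc τ s₂ σ) β 0 - ∫ s in (1 : ℝ)..s₂,
        (s ^ B)⁻¹ * s⁻¹ * (2 * Real.pi)⁻¹ *
          ∑ a ∈ τ, V J W (sc τ s σ) (β + Pi.single a 2) 0 := by rw [← h]; ring
    rw [h']
    refine enorm_sub_le.trans (add_le_add ?_ ?_)
    · rw [Real.enorm_eq_ofReal_abs]
      refine ENNReal.ofReal_le_ofReal ?_
      rw [abs_mul, abs_of_pos (by positivity)]
      have h1 : (s₂ ^ B)⁻¹ ≤ 1 := inv_le_one_of_one_le₀ (one_le_pow₀ hs₂)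
      calc _ ≤ 1 * |V J W (sc τ s₂ σ) β 0| := by gcongr
        _ ≤ _ := by rw [one_mul]; exact hdecay _ hs₂
    · rw [intervalIntegral.integral_of_le hs₂]
      refine (enorm_integral_le_lintegral_enorm _).trans ?_
      refine (lintegral_mono_set Set.Ioc_subset_Ioi_self).trans ?_
      have hmeas : ∀ a : Idx m, Measurable fun s => ENNReal.ofReal ((s ^ B)⁻¹ * s⁻¹) *
          ‖V J W (sc τ s σ) (β + Pi.single a 2) 0‖ₑ := by
        intro a
        refine Measurable.mul (by fun_prop) (Measurable.enorm ?_)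
        refine (measurable_V J hWm _ 0).comp (measurable_pi_lambda _ fun b => ?_)
        unfold sc
        split_ifs <;> fun_prop
      rw [← lintegral_finsetSum _ fun a _ => hmeas a]
      refine setLIntegral_mono (Finset.measurable_fun_sum _ fun a _ => hmeas a) fun s hs => ?_
      have hs1 : (1 : ℝ) < s := hs
      have hpi := Real.pi_gt_three
      rw [← Finset.mul_sum, enorm_mul]
      gcongr
      · rw [Real.enorm_eq_ofReal_abs, abs_of_pos (by positivity)]
        refine ENNReal.ofReal_le_ofReal (mul_le_of_le_one_right (by positivity) ?_)
        exact inv_le_one_of_one_le₀ (by linarith)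
      · exact enorm_sum_le _ _
  have hlim : Filter.Tendsto (fun s₂ : ℝ => ENNReal.ofReal (C' * s₂⁻¹) +
      ∑ a ∈ τ, ∫⁻ s in Set.Ioi (1 : ℝ), ENNReal.ofReal ((s ^ B)⁻¹ * s⁻¹) *
        ‖V J W (sc τ s σ) (β + Pi.single a 2) 0‖ₑ) Filter.atTop
      (nhds (0 + ∑ a ∈ τ, ∫⁻ s in Set.Ioi (1 : ℝ), ENNReal.ofReal ((s ^ B)⁻¹ * s⁻¹) *
        ‖V J W (sc τ s σ) (β + Pi.single a 2) 0‖ₑ)) := by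
    refine Filter.Tendsto.add ?_ tendsto_const_nhds
    have := (tendsto_inv_atTop_zero (𝕜 := ℝ)).const_mul C'
    rw [mul_zero] at this
    simpa using ENNReal.tendsto_ofReal this
  rw [zero_add] at hlim
  exact ge_of_tendsto hlim (Filter.eventually_atTop.2 ⟨1, fun s hs => hstep s hs⟩)

/-- The hypotheses of the induction, with a general set `S` of symmetric directions. -/
structure Adm {m : ℕ} (Δ : ℝ) (S : Finset (Fin m)) (J : Matrix (Idx m) (Fin m) ℝ)
    (T : Set (ℤ × (Fin m → ℤ))) (Qt : ℤ × (Fin m → ℤ)) (d : Fin m → ℝ)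
    (F : Corner m → (Fin m → ℝ) → ℝ) : Prop where
  reg : ∀ j, IsReg Δ (Amat J j)
  row : ∀ h ∈ S, ∀ k, J (Sum.inl h) k = J (Sum.inr h) k
  tree : ConvexTree T Qt
  pos : ∀ h, 0 < d h
  le : ∀ h ∈ S, ∀ i ∉ S, d h ≤ d i
  eq : ∀ i ∉ S, ∀ i' ∉ S, d i = d i'
  cont : ∀ j, Continuous (F j)
  supp : ∀ j, HasCompactSupport (F j)
  symm : ∀ j, ∀ i ∈ S, F j = F (istar i j)

/-- The scales `t (d, d)`. -/
def dd {m : ℕ} (d : Fin m → ℝ) (t : ℝ) : Idx m → ℝ := fun a => t * Sum.elim d d a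

/-- The localized product of functions at scale `k`. -/
def Wk {m : ℕ} (J : Matrix (Idx m) (Fin m) ℝ) (T : Set (ℤ × (Fin m → ℤ)))
    (F : Corner m → (Fin m → ℝ) → ℝ) (k : ℤ) (x : Idx m → ℝ) : ℝ :=
  ∏ j, Set.indicator ((Amat J j).mulVec '' Tkset T k) (F j) (proj j x)

lemma abs_entry_le_opNorm {m : ℕ} (A : Matrix (Fin m) (Fin m) ℝ) (i k : Fin m) :
    |A i k| ≤ opNorm A := by
  have h := (LinearMap.toContinuousLinearMap (Matrix.toEuclideanLin A)).le_opNorm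
    (EuclideanSpace.single k 1)
  have h2 := PiLp.norm_apply_le (Matrix.toEuclideanLin A (EuclideanSpace.single k 1)) i
  simp only [PiLp.norm_single, norm_one, mul_one] at h
  refine le_trans ?_ h
  refine le_trans (le_of_eq ?_) h2
  simp [Matrix.toLpLin_apply]

/-- A bound for the entries of the inverse of a regular matrix. -/
def cInv (m : ℕ) (Δ : ℝ) : ℝ := Δ * (m.factorial * Δ ^ m)

lemma abs_inv_entry_le {m : ℕ} {Δ : ℝ} (hΔ : 1 ≤ Δ) {A : Matrix (Fin m) (Fin m) ℝ}
    (hA : IsReg Δ A) (i k : Fin m) : |A⁻¹ i k| ≤ cInv m Δ := by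
  obtain ⟨h1, h2, h3⟩ := hA
  have hadj : |A.adjugate i k| ≤ m.factorial * Δ ^ m := by
    rw [Matrix.adjugate_apply]
    have := Matrix.det_le (A := A.updateRow k (Pi.single i 1)) (abv := IsAbsoluteValue.toAbsoluteValue (abs : ℝ → ℝ))
      (x := Δ) (fun a b => by
        change |_| ≤ _
        by_cases hak : a = k
        · subst hak
          rw [Matrix.updateRow_self]
          by_cases hbi : b = i
          · subst hbi; simpa using hΔ
          · simp [Pi.single_eq_of_ne hbi]; linarith
        · rw [Matrix.updateRow_ne hak]
          exact (abs_entry_le_opNorm A a b).trans h1)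
    simpa [nsmul_eq_mul] using this
  rw [Matrix.inv_def, Matrix.smul_apply, smul_eq_mul, abs_mul, Ring.inverse_eq_inv', abs_inv,
    cInv]
  gcongr

lemma IsReg.isUnit_det {m : ℕ} {Δ : ℝ} {A : Matrix (Fin m) (Fin m) ℝ} (hA : IsReg Δ A) :
    IsUnit A.det := hA.2.1.isUnit

lemma dd_pos {m : ℕ} {d : Fin m → ℝ} (hd : ∀ h, 0 < d h) {t : ℝ} (ht : 0 < t) (a : Idx m) :
    0 < dd d t a := by
  unfold dd
  rcases a with h | h <;> simpa using mul_pos ht (hd h)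

lemma dd_sel {m : ℕ} (d : Fin m → ℝ) (t : ℝ) (j : Corner m) (h : Fin m) :
    dd d t (sel j h) = t * d h := by
  unfold dd sel
  split_ifs <;> simp

lemma sum_idx_eq {m : ℕ} {M : Type*} [AddCommMonoid M] (j : Corner m) (f : Idx m → M) :
    ∑ a, f a = (∑ i, f (sel j i)) + ∑ i, f (sel (fun h => 1 - j h) i) := by
  rw [Fintype.sum_sum_type, ← Finset.sum_add_distrib, ← Finset.sum_add_distrib]
  refine Finset.sum_congr rfl fun i _ => ?_
  unfold sel
  obtain h | h : j i = 0 ∨ j i = 1 := by omega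
  · simp [h]
  · simp [h, add_comm]

/-- Integration by parts solved for the derivative in one coordinate of a corner. -/
lemma V_ibp_corner {m : ℕ} {Δ : ℝ} (hΔ : 1 ≤ Δ) {S : Finset (Fin m)}
    {J : Matrix (Idx m) (Fin m) ℝ} {d : Fin m → ℝ} (hreg : ∀ j, IsReg Δ (Amat J j))
    (hrow : ∀ h ∈ S, ∀ k, J (Sum.inl h) k = J (Sum.inr h) k) (hpos : ∀ h, 0 < d h)
    (hle : ∀ h ∈ S, ∀ i ∉ S, d h ≤ d i) (heq : ∀ i ∉ S, ∀ i' ∉ S, d i = d i')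
    (j : Corner m) (h' : Fin m) :
    ∃ b : Fin m → ℝ, (∀ h, |b h| ≤ m * (Δ * cInv m Δ)) ∧
      ∀ {W : (Idx m → ℝ) → ℝ}, Integrable W → ∀ {t : ℝ}, 0 < t → ∀ (γ : Idx m → ℕ) (u : Idx m → ℝ),
        V J W (dd d t) (γ + Pi.single (sel j h') 1) u +
          (if h' ∈ S then V J W (dd d t) (γ + Pi.single (sel (fun h => 1 - j h) h') 1) u else 0) =
        ∑ h ∈ Sᶜ, b h * V J W (dd d t) (γ + Pi.single (sel (fun h => 1 - j h) h) 1) u := by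
  set j' : Corner m := fun h => 1 - j h with hj'
  set A := Amat J j with hA
  set A' := Amat J j' with hA'
  have hu : IsUnit A.det := (hreg j).isUnit_det
  set c := A' * A⁻¹ with hc
  have hcb : ∀ h k, |c h k| ≤ m * (Δ * cInv m Δ) := by
    intro h k
    rw [hc, Matrix.mul_apply]
    refine (Finset.abs_sum_le_sum_abs _ _).trans ?_
    refine (Finset.sum_le_card_nsmul _ _ (Δ * cInv m Δ) fun l _ => ?_).trans (by simp)
    rw [abs_mul]
    gcongr
    · exact (abs_entry_le_opNorm _ _ _).trans (hreg j').1
    · exact abs_inv_entry_le hΔ (hreg j) _ _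
  have hcS : ∀ h ∈ S, ∀ k, c h k = if h = k then 1 else 0 := by
    intro h hh k
    have hr : ∀ l, A' h l = A h l := by
      intro l
      simp only [hA, hA', Amat, Matrix.of_apply, sel]
      split_ifs <;> simp [hrow h hh]
    rw [hc, Matrix.mul_apply]
    simp only [hr]
    rw [← Matrix.mul_apply, Matrix.mul_nonsing_inv _ hu, Matrix.one_apply]
  refine ⟨fun h => if h ∈ S then 0 else -(c h h' * (d h' / d h)), fun h => ?_, ?_⟩
  · have hKnn : 0 ≤ m * (Δ * cInv m Δ) := (abs_nonneg _).trans (hcb h h')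
    beta_reduce
    split_ifs with hh
    · simpa using hKnn
    · rw [abs_neg, abs_mul]
      have h1 : |d h' / d h| ≤ 1 := by
        rw [abs_of_pos (div_pos (hpos _) (hpos _)), div_le_one (hpos _)]
        by_cases hS : h' ∈ S
        · exact hle _ hS _ hh
        · exact (heq _ hS _ hh).le
      calc _ ≤ |c h h'| * 1 := by gcongr
        _ ≤ _ := by rw [mul_one]; exact hcb _ _
  · intro W hW t ht γ u
    set v : Fin m → ℝ := fun i => (d i)⁻¹ * V J W (dd d t) (γ + Pi.single (sel j i) 1) u with hv
    set w : Fin m → ℝ := fun i => (d i)⁻¹ * V J W (dd d t) (γ + Pi.single (sel j' i) 1) u with hw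
    have key : v ᵥ* A = - (w ᵥ* A') := by
      ext k
      have := V_ibp (hreg j).2.1 hW (fun a => (dd_pos hpos ht a).ne') γ u k
      rw [sum_idx_eq j] at this
      simp only [dd_sel, mul_inv] at this
      simp only [Matrix.vecMul, dotProduct, Pi.neg_apply, hv, hw, hA, hA', Amat, Matrix.of_apply]
      have ht' : t⁻¹ ≠ 0 := inv_ne_zero ht.ne'
      refine mul_left_cancel₀ ht' ?_
      rw [mul_neg, Finset.mul_sum, Finset.mul_sum, ← sub_eq_zero, sub_neg_eq_add, ← this]
      congr 1 <;> exact Finset.sum_congr rfl fun _ _ => by ring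
    have hvw : v = -(w ᵥ* c) := by
      have h2 := congrArg (fun y => y ᵥ* A⁻¹) key
      simp only [Matrix.vecMul_vecMul, Matrix.mul_nonsing_inv _ hu, Matrix.vecMul_one,
        Matrix.neg_vecMul] at h2
      exact h2
    have h3 := congrFun hvw h'
    simp only [Matrix.vecMul, dotProduct, Pi.neg_apply] at h3
    rw [← Finset.sum_add_sum_compl S] at h3
    have h4 : ∑ h ∈ S, w h * c h h' = if h' ∈ S then w h' else 0 := by
      rw [Finset.sum_congr rfl fun h hh => by rw [hcS h hh h']]
      simp
    rw [h4] at h3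
    have hd' : d h' ≠ 0 := (hpos h').ne'
    have h5 : V J W (dd d t) (γ + Pi.single (sel j h') 1) u = d h' * v h' := by
      simp only [hv]; field_simp
    rw [h5, h3]
    have h6 : (if h' ∈ S then V J W (dd d t) (γ + Pi.single (sel j' h') 1) u else 0) =
        d h' * if h' ∈ S then w h' else 0 := by
      split_ifs
      · simp only [hw]; field_simp
      · simp
    rw [h6]
    have h7 : ∑ h ∈ Sᶜ, (if h ∈ S then 0 else -(c h h' * (d h' / d h))) *
        V J W (dd d t) (γ + Pi.single (sel j' h) 1) u = -(d h' * ∑ h ∈ Sᶜ, w h * c h h') := by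
      rw [Finset.mul_sum, ← Finset.sum_neg_distrib]
      refine Finset.sum_congr rfl fun h hh => ?_
      rw [if_neg (Finset.mem_compl.1 hh)]
      simp only [hw]
      ring
    rw [h7]
    ring

lemma measurableSet_dC {m : ℕ} (Q : ℤ × (Fin m → ℤ)) : MeasurableSet (dC Q) := by
  have : dC Q = ⋂ i, {x : Fin m → ℝ | (2:ℝ)^Q.1 * (Q.2 i : ℝ) ≤ x i ∧
      x i < (2:ℝ)^Q.1 * ((Q.2 i : ℝ) + 1)} := by
    ext x; simp [dC]
  rw [this]
  exact MeasurableSet.iInter fun i =>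
    (measurableSet_le measurable_const (measurable_pi_apply i)).inter
      (measurableSet_lt (measurable_pi_apply i) measurable_const)

lemma measurableSet_Tkset {m : ℕ} (T : Set (ℤ × (Fin m → ℤ))) (k : ℤ) :
    MeasurableSet (Tkset T k) :=
  MeasurableSet.biUnion (Set.to_countable _) fun Q _ => measurableSet_dC Q

lemma mulVec_image_eq_preimage {m : ℕ} {A : Matrix (Fin m) (Fin m) ℝ} (hA : IsUnit A.det)
    (E : Set (Fin m → ℝ)) : A.mulVec '' E = A⁻¹.mulVec ⁻¹' E := by
  ext y
  constructor
  · rintro ⟨x, hx, rfl⟩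
    simpa [Matrix.mulVec_mulVec, Matrix.nonsing_inv_mul _ hA] using hx
  · intro hy
    exact ⟨A⁻¹ *ᵥ y, hy, by simp [Matrix.mulVec_mulVec, Matrix.mul_nonsing_inv _ hA]⟩

lemma measurableSet_mulVec_image {m : ℕ} {A : Matrix (Fin m) (Fin m) ℝ} (hA : IsUnit A.det)
    {E : Set (Fin m → ℝ)} (hE : MeasurableSet E) : MeasurableSet (A.mulVec '' E) := by
  rw [mulVec_image_eq_preimage hA]
  exact (continuous_mulVec _).measurable hE

lemma continuous_proj {m : ℕ} (j : Corner m) : Continuous (proj j) :=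
  continuous_pi fun _ => continuous_apply _

lemma measurable_Wk {m : ℕ} {J : Matrix (Idx m) (Fin m) ℝ} (hJ : ∀ j, IsUnit (Amat J j).det)
    (T : Set (ℤ × (Fin m → ℤ))) {F : Corner m → (Fin m → ℝ) → ℝ} (hF : ∀ j, Continuous (F j))
    (k : ℤ) : Measurable (Wk J T F k) := by
  refine Finset.measurable_fun_prod _ fun j _ => ?_
  exact ((hF j).measurable.indicator
    (measurableSet_mulVec_image (hJ j) (measurableSet_Tkset T k))).comp
    (continuous_proj j).measurable

lemma integrable_prod_proj {m : ℕ} {F : Corner m → (Fin m → ℝ) → ℝ}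
    (hF : ∀ j, Continuous (F j)) (hs : ∀ j, HasCompactSupport (F j)) :
    Integrable fun x : Idx m → ℝ => ∏ j, F j (proj j x) := by
  have hR : ∃ R : ℝ, ∀ j y, F j y ≠ 0 → ‖y‖ ≤ R := by
    have : ∀ j, ∃ R : ℝ, ∀ y, F j y ≠ 0 → ‖y‖ ≤ R := fun j => by
      obtain ⟨R, hR⟩ := (hs j).isBounded.exists_norm_le
      exact ⟨R, fun y hy => hR y (subset_tsupport _ hy)⟩
    choose R hR using this
    refine ⟨∑ j, |R j|, fun j y hy => (hR j y hy).trans ((le_abs_self _).trans ?_)⟩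
    exact Finset.single_le_sum (f := fun j => |R j|) (fun _ _ => abs_nonneg _) (Finset.mem_univ j)
  obtain ⟨R, hR⟩ := hR
  refine Continuous.integrable_of_hasCompactSupport
    (continuous_finsetProd _ fun j _ => (hF j).comp (continuous_proj j)) ?_
  refine HasCompactSupport.of_support_subset_isCompact
    (isCompact_closedBall (0 : Idx m → ℝ) |R|) fun x hx => ?_
  rw [mem_closedBall_zero_iff, pi_norm_le_iff_of_nonneg (abs_nonneg R)]
  have hx' : ∀ j, F j (proj j x) ≠ 0 := fun j hj =>
    hx (Finset.prod_eq_zero (Finset.mem_univ j) hj)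
  intro a
  have h2 : ∀ j : Corner m, ∀ i, ‖x (sel j i)‖ ≤ |R| := fun j i =>
    ((norm_le_pi_norm (proj j x) i).trans (hR j _ (hx' j))).trans (le_abs_self R)
  rcases a with i | i
  · simpa [sel_zero] using h2 (fun _ => 0) i
  · simpa [sel_one] using h2 (fun _ => 1) i

lemma abs_Wk_le {m : ℕ} (J : Matrix (Idx m) (Fin m) ℝ) (T : Set (ℤ × (Fin m → ℤ)))
    (F : Corner m → (Fin m → ℝ) → ℝ) (k : ℤ) (x : Idx m → ℝ) :
    |Wk J T F k x| ≤ |∏ j, F j (proj j x)| := by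
  rw [Wk, Finset.abs_prod, Finset.abs_prod]
  refine Finset.prod_le_prod (fun _ _ => abs_nonneg _) fun j _ => ?_
  unfold Set.indicator
  split_ifs <;> simp

lemma integrable_Wk {m : ℕ} {J : Matrix (Idx m) (Fin m) ℝ} (hJ : ∀ j, IsUnit (Amat J j).det)
    (T : Set (ℤ × (Fin m → ℤ))) {F : Corner m → (Fin m → ℝ) → ℝ} (hF : ∀ j, Continuous (F j))
    (hs : ∀ j, HasCompactSupport (F j)) (k : ℤ) : Integrable (Wk J T F k) :=
  (integrable_prod_proj hF hs).mono (measurable_Wk hJ T hF k).aestronglyMeasurable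
    (Filter.Eventually.of_forall fun x => by
      rw [Real.norm_eq_abs, Real.norm_eq_abs]; exact abs_Wk_le J T F k x)

/-- The absolute multi-scale form. -/
def N {m : ℕ} (J : Matrix (Idx m) (Fin m) ℝ) (T : Set (ℤ × (Fin m → ℤ)))
    (F : Corner m → (Fin m → ℝ) → ℝ) (d : Fin m → ℝ) (β : Idx m → ℕ) (u : Idx m → ℝ) : ℝ≥0∞ :=
  ∑' k : ℤ, ∫⁻ t in Set.Ioc ((2:ℝ)^(k-1)) ((2:ℝ)^k),
    ‖V J (Wk J T F k) (dd d t) β u‖ₑ * ENNReal.ofReal t⁻¹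

/-- The dilation weight. -/
def Pd {m : ℕ} (α : ℝ) (d : Fin m → ℝ) : ℝ := ∏ h : Fin m, max (d h ^ (2*α)) (d h ^ (-2 : ℝ))

/-- The right-hand side of the estimates, without the constant. -/
def rhs {m : ℕ} (α : ℝ) (J : Matrix (Idx m) (Fin m) ℝ) (T : Set (ℤ × (Fin m → ℤ)))
    (Qt : ℤ × (Fin m → ℤ)) (d : Fin m → ℝ) (F : Corner m → (Fin m → ℝ) → ℝ) : ℝ≥0∞ :=
  ENNReal.ofReal (Pd α d) * volume (dC Qt) * ∏ j : Corner m, MalTree α (F j) (Amat J j) T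

/-- The uniform bound for the multi-scale forms with derivatives `β`. -/
def Bdd {m : ℕ} (Δ α : ℝ) (S : Finset (Fin m)) (β : Idx m → ℕ) : Prop :=
  ∃ C : ℝ≥0, ∀ J T Qt d F, Adm Δ S J T Qt d F → N J T F d β 0 ≤ C * rhs α J T Qt d F

section
variable {m : ℕ} {Δ α : ℝ} {S : Finset (Fin m)} {J : Matrix (Idx m) (Fin m) ℝ}
  {T : Set (ℤ × (Fin m → ℤ))} {Qt : ℤ × (Fin m → ℤ)} {d : Fin m → ℝ}
  {F : Corner m → (Fin m → ℝ) → ℝ}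

lemma Adm.isUnit (h : Adm Δ S J T Qt d F) (j : Corner m) : IsUnit (Amat J j).det :=
  (h.reg j).isUnit_det

lemma Adm.measurable_Wk (h : Adm Δ S J T Qt d F) (k : ℤ) : Measurable (Wk J T F k) :=
  SBL.measurable_Wk h.isUnit T h.cont k

lemma Adm.integrable_Wk (h : Adm Δ S J T Qt d F) (k : ℤ) : Integrable (Wk J T F k) :=
  SBL.integrable_Wk h.isUnit T h.cont h.supp k

lemma measurable_dd (d : Fin m → ℝ) : Measurable (dd d) :=
  measurable_pi_lambda _ fun a => by unfold dd; fun_prop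

lemma Adm.measurable_V (h : Adm Δ S J T Qt d F) (k : ℤ) (β : Idx m → ℕ) (u : Idx m → ℝ) :
    Measurable fun t => ‖V J (Wk J T F k) (dd d t) β u‖ₑ * ENNReal.ofReal t⁻¹ :=
  (((SBL.measurable_V J (h.measurable_Wk k) β u).comp (measurable_dd d)).enorm).mul
    (by fun_prop)

lemma pos_of_mem_Ioc {k : ℤ} {t : ℝ} (ht : t ∈ Set.Ioc ((2:ℝ)^(k-1)) ((2:ℝ)^k)) : 0 < t :=
  (zpow_pos two_pos _).trans ht.1

lemma Adm.N_le (h : Adm Δ S J T Qt d F) {β : Idx m → ℕ} {u : Idx m → ℝ}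
    {s : Finset (Idx m → ℕ)} {K : ℝ≥0}
    (hle : ∀ k t, 0 < t → ‖V J (Wk J T F k) (dd d t) β u‖ₑ ≤
      K * ∑ b ∈ s, ‖V J (Wk J T F k) (dd d t) b u‖ₑ) :
    N J T F d β u ≤ K * ∑ b ∈ s, N J T F d b u := by
  unfold N
  rw [← Summable.tsum_finsetSum fun _ _ => ENNReal.summable, ← ENNReal.tsum_mul_left]
  refine ENNReal.tsum_le_tsum fun k => ?_
  rw [← lintegral_finsetSum _ fun b _ => h.measurable_V k b u, ← lintegral_const_mul _
    (Finset.measurable_fun_sum _ fun b _ => h.measurable_V k b u)]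
  refine setLIntegral_mono (measurable_const.mul
    (Finset.measurable_fun_sum _ fun b _ => h.measurable_V k b u)) fun t ht => ?_
  rw [← Finset.sum_mul, ← mul_assoc]
  gcongr
  exact hle k t (pos_of_mem_Ioc ht)

lemma Bdd.of_le {β : Idx m → ℕ} {s : Finset (Idx m → ℕ)} {K : ℝ≥0}
    (hs : ∀ b ∈ s, Bdd Δ α S b)
    (hle : ∀ J T Qt d F, Adm Δ S J T Qt d F → ∀ k t, 0 < t →
      ‖V J (Wk J T F k) (dd d t) β 0‖ₑ ≤ K * ∑ b ∈ s, ‖V J (Wk J T F k) (dd d t) b 0‖ₑ) :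
    Bdd Δ α S β := by
  choose! C hC using hs
  refine ⟨K * ∑ b ∈ s, C b, fun J T Qt d F h => (h.N_le (hle J T Qt d F h)).trans ?_⟩
  push_cast
  rw [mul_assoc, Finset.sum_mul]
  gcongr with b hb
  exact hC b hb J T Qt d F h

end

lemma max_rpow_scale_le {α d c s : ℝ} (hα : 0 ≤ α) (hd : 0 < d) (hc : 1 ≤ c) (hcs : c ≤ s) :
    max ((c * d) ^ (2*α)) ((c * d) ^ (-2 : ℝ)) ≤ s ^ (2*α) * max (d ^ (2*α)) (d ^ (-2 : ℝ)) := by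
  have hc0 : 0 < c := by linarith
  have hs : 1 ≤ s ^ (2*α) := Real.one_le_rpow (hc.trans hcs) (by linarith)
  refine max_le ?_ ?_
  · rw [Real.mul_rpow hc0.le hd.le]
    have := Real.rpow_le_rpow hc0.le hcs (show 0 ≤ 2*α by linarith)
    have h3 := Real.rpow_nonneg hd.le (2*α)
    calc c ^ (2*α) * d ^ (2*α) ≤ s ^ (2*α) * d ^ (2*α) := by gcongr
      _ ≤ _ := by gcongr; exact le_max_left _ _
  · have h1 : (c * d) ^ (-2 : ℝ) ≤ d ^ (-2 : ℝ) :=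
      Real.rpow_le_rpow_of_nonpos hd (by nlinarith) (by norm_num)
    have h2 : 0 ≤ max (d ^ (2*α)) (d ^ (-2 : ℝ)) :=
      le_max_of_le_left (Real.rpow_nonneg hd.le _)
    calc (c * d) ^ (-2 : ℝ) ≤ 1 * max (d ^ (2*α)) (d ^ (-2 : ℝ)) := by
          rw [one_mul]; exact h1.trans (le_max_right _ _)
      _ ≤ _ := by gcongr

lemma Pd_nonneg {m : ℕ} {α : ℝ} {d : Fin m → ℝ} (hd : ∀ h, 0 < d h) : 0 ≤ Pd α d :=
  Finset.prod_nonneg fun h _ => le_max_of_le_left (Real.rpow_nonneg (hd h).le _)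

lemma Pd_scale_le {m : ℕ} {α s : ℝ} {c d : Fin m → ℝ} (hα : 0 ≤ α) (hd : ∀ h, 0 < d h)
    (hc : ∀ h, 1 ≤ c h) (hcs : ∀ h, c h ≤ s) :
    Pd α (fun h => c h * d h) ≤ (s ^ (2*α)) ^ m * Pd α d := by
  unfold Pd
  calc _ ≤ ∏ h : Fin m, (s ^ (2*α) * max (d h ^ (2*α)) (d h ^ (-2 : ℝ))) :=
        Finset.prod_le_prod (fun h _ => le_max_of_le_left
          (Real.rpow_nonneg (mul_pos (by linarith [hc h]) (hd h)).le _))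
          fun h _ => max_rpow_scale_le hα (hd h) (hc h) (hcs h)
    _ = _ := by rw [Finset.prod_mul_distrib]; simp

/-- The index in `{1, …, m}` of a coordinate of `ℝ^{2m}`. -/
def ix {m : ℕ} : Idx m → Fin m := Sum.elim id id

/-- Dilation in the directions outside of `S`. -/
def dS {m : ℕ} (S : Finset (Fin m)) (d : Fin m → ℝ) (s : ℝ) : Fin m → ℝ :=
  fun h => (if h ∈ S then 1 else s) * d h

/-- The coordinates with index outside of `S`. -/
def tau {m : ℕ} (S : Finset (Fin m)) : Finset (Idx m) := Finset.univ.filter fun a => ix a ∉ S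

section
variable {m : ℕ} {Δ α : ℝ} {S : Finset (Fin m)} {J : Matrix (Idx m) (Fin m) ℝ}
  {T : Set (ℤ × (Fin m → ℤ))} {Qt : ℤ × (Fin m → ℤ)} {d : Fin m → ℝ}
  {F : Corner m → (Fin m → ℝ) → ℝ}

lemma sc_tau_dd (s t : ℝ) : sc (tau S) s (dd d t) = dd (dS S d s) t := by
  funext a
  unfold sc dd dS tau ix
  rcases a with h | h <;> by_cases hS : h ∈ S <;> simp [hS, mul_left_comm]

lemma Adm.scale (h : Adm Δ S J T Qt d F) {s : ℝ} (hs : 1 ≤ s) :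
    Adm Δ S J T Qt (dS S d s) F where
  reg := h.reg
  row := h.row
  tree := h.tree
  pos i := mul_pos (by split_ifs <;> linarith) (h.pos i)
  le i hi i' hi' := by
    simp only [dS, hi, hi', if_true, if_false, one_mul]
    have := h.le i hi i' hi'
    nlinarith [h.pos i']
  eq i hi i' hi' := by simp only [dS, hi, hi', if_false, h.eq i hi i' hi']
  cont := h.cont
  supp := h.supp
  symm := h.symm

lemma Adm.rhs_scale_le (h : Adm Δ S J T Qt d F) (hα : 0 ≤ α) {s : ℝ} (hs : 1 ≤ s) :
    rhs α J T Qt (dS S d s) F ≤ ENNReal.ofReal ((s ^ (2*α)) ^ m) * rhs α J T Qt d F := by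
  unfold rhs
  rw [← mul_assoc, ← mul_assoc, ← ENNReal.ofReal_mul (by positivity)]
  gcongr
  exact Pd_scale_le hα h.pos (fun i => by split_ifs <;> linarith)
    (fun i => by split_ifs <;> linarith)

lemma measurable_V_dS (h : Adm Δ S J T Qt d F) (k : ℤ) (β : Idx m → ℕ) :
    Measurable fun z : ℝ × ℝ => ‖V J (Wk J T F k) (dd (dS S d z.1) z.2) β 0‖ₑ := by
  refine ((SBL.measurable_V J (h.measurable_Wk k) β 0).comp
    (measurable_pi_lambda _ fun a => ?_)).enorm
  unfold dd dS
  rcases a with i | i <;> by_cases hi : i ∈ S <;> simp [hi] <;> fun_prop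

lemma tsum_lintegral_swap {w : ℝ → ℝ≥0∞} (hw : Measurable w) {f : ℤ → ℝ → ℝ → ℝ≥0∞}
    (hf : ∀ k, Measurable fun z : ℝ × ℝ => f k z.1 z.2) (A : ℤ → Set ℝ) (B : Set ℝ) :
    ∑' k, ∫⁻ t in A k, ∫⁻ s in B, w s * f k s t =
      ∫⁻ s in B, w s * ∑' k, ∫⁻ t in A k, f k s t := by
  have hm : ∀ k, Measurable fun s => ∫⁻ t in A k, f k s t := fun k =>
    Measurable.lintegral_prod_right' (hf k)
  simp only [← ENNReal.tsum_mul_left]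
  rw [lintegral_tsum (f := fun k s => w s * ∫⁻ t in A k, f k s t)
    fun k => (hw.mul (hm k)).aemeasurable]
  congr 1; funext k
  have h2 : Measurable fun z : ℝ × ℝ => w z.2 * f k z.2 z.1 :=
    (hw.comp measurable_snd).mul ((hf k).comp measurable_swap)
  rw [lintegral_lintegral_swap (f := fun t s => w s * f k s t) h2.aemeasurable]
  refine lintegral_congr fun s => ?_
  exact lintegral_const_mul _ ((hf k).comp measurable_prodMk_left)

lemma tsum_lintegral_sum_swap {ι : Type*} (I : Finset ι) {w : ℝ → ℝ≥0∞} (hw : Measurable w)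
    {f : ι → ℤ → ℝ → ℝ → ℝ≥0∞} (hf : ∀ a k, Measurable fun z : ℝ × ℝ => f a k z.1 z.2)
    (A : ℤ → Set ℝ) (B : Set ℝ) :
    ∑' k, ∫⁻ t in A k, ∑ a ∈ I, ∫⁻ s in B, w s * f a k s t =
      ∑ a ∈ I, ∫⁻ s in B, w s * ∑' k, ∫⁻ t in A k, f a k s t := by
  rw [← Finset.sum_congr rfl fun a _ => tsum_lintegral_swap hw (hf a) A B,
    ← Summable.tsum_finsetSum fun _ _ => ENNReal.summable]
  congr 1; funext k
  exact lintegral_finsetSum _ fun a _ => Measurable.lintegral_prod_left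
    (f := fun s t => w s * f a k s t) ((hw.comp measurable_fst).mul (hf a k))

lemma mem_tau {a : Idx m} : a ∈ tau S ↔ ix a ∉ S := by
  unfold tau
  rw [Finset.mem_filter]
  exact ⟨fun h => h.2, fun h => ⟨Finset.mem_univ _, h⟩⟩

lemma Bdd.of_scale (hα : 0 ≤ α) (hαm : α * m < 1) {β : Idx m → ℕ} {i : Fin m} (hi : i ∉ S)
    (hβ : 2 ≤ ∑ a ∈ tau S, β a) (hb : ∀ a ∈ tau S, Bdd Δ α S (β + Pi.single a 2)) :
    Bdd Δ α S β := by
  choose! C hC using hb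
  have hI : ∫⁻ s in Set.Ioi (1 : ℝ), ENNReal.ofReal (s ^ (-3 + 2*α*m)) ≠ ∞ := by
    have := (integrableOn_Ioi_rpow_of_lt (a := -3 + 2*α*m) (by nlinarith) (one_pos)).lintegral_lt_top
    exact this.ne
  refine ⟨(∑ a ∈ tau S, C a) * (∫⁻ s in Set.Ioi (1 : ℝ),
    ENNReal.ofReal (s ^ (-3 + 2*α*m))).toNNReal, fun J T Qt d F h => ?_⟩
  set B := ∑ a ∈ tau S, β a with hB
  set w : ℝ → ℝ≥0∞ := fun s => ENNReal.ofReal ((s ^ B)⁻¹ * s⁻¹) with hw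
  have hwm : Measurable w := by fun_prop
  have hmeas : ∀ k b, Measurable fun z : ℝ × ℝ =>
      ‖V J (Wk J T F k) (dd (dS S d z.1) z.2) b 0‖ₑ * ENNReal.ofReal z.2⁻¹ := fun k b =>
    (measurable_V_dS h k b).mul (by fun_prop)
  have h1 : ∀ k t, 0 < t → ‖V J (Wk J T F k) (dd d t) β 0‖ₑ * ENNReal.ofReal t⁻¹ ≤
      ∑ a ∈ tau S, ∫⁻ s in Set.Ioi (1 : ℝ),
        w s * (‖V J (Wk J T F k) (dd (dS S d s) t) (β + Pi.single a 2) 0‖ₑ *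
          ENNReal.ofReal t⁻¹) := by
    intro k t ht
    have := enorm_V_le_lintegral (h.isUnit _).ne_zero (h.measurable_Wk k) (h.integrable_Wk k)
      (tau S) (i := i) (mem_tau.2 hi) (dd_pos h.pos ht) β
    refine (mul_le_mul_left this _).trans (le_of_eq ?_)
    rw [Finset.sum_mul]
    refine Finset.sum_congr rfl fun a _ => ?_
    rw [← lintegral_mul_const' _ _ ENNReal.ofReal_ne_top]
    simp only [sc_tau_dd, hw, hB, mul_assoc]
  have h2 : N J T F d β 0 ≤ ∑ a ∈ tau S, ∫⁻ s in Set.Ioi (1 : ℝ),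
      w s * N J T F (dS S d s) (β + Pi.single a 2) 0 := by
    calc N J T F d β 0 ≤ ∑' k : ℤ, ∫⁻ t in Set.Ioc ((2:ℝ)^(k-1)) ((2:ℝ)^k),
          ∑ a ∈ tau S, ∫⁻ s in Set.Ioi (1 : ℝ),
            w s * (‖V J (Wk J T F k) (dd (dS S d s) t) (β + Pi.single a 2) 0‖ₑ *
              ENNReal.ofReal t⁻¹) :=
          ENNReal.tsum_le_tsum fun k => setLIntegral_mono' measurableSet_Ioc fun t ht =>
            h1 k t (pos_of_mem_Ioc ht)
      _ = _ := tsum_lintegral_sum_swap _ hwm (f := fun a k s t =>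
            ‖V J (Wk J T F k) (dd (dS S d s) t) (β + Pi.single a 2) 0‖ₑ *
              ENNReal.ofReal t⁻¹) (fun a k => by exact hmeas k (β + Pi.single a 2)) _ _
  refine h2.trans ?_
  push_cast
  rw [ENNReal.coe_toNNReal hI, Finset.sum_mul, Finset.sum_mul]
  refine Finset.sum_le_sum fun a ha => ?_
  have hm1 : Measurable fun s : ℝ => ENNReal.ofReal (s ^ (-3 + 2*α*m)) := by fun_prop
  rw [mul_right_comm, ← lintegral_const_mul _ hm1]
  refine setLIntegral_mono' measurableSet_Ioi fun s hs => ?_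
  have hs1 : (1:ℝ) ≤ s := le_of_lt hs
  have hs0 : (0:ℝ) < s := by linarith
  calc w s * N J T F (dS S d s) (β + Pi.single a 2) 0
      ≤ w s * (C a * (ENNReal.ofReal ((s ^ (2*α)) ^ m) * rhs α J T Qt d F)) := by
        gcongr
        refine (hC a ha J T Qt _ F (h.scale hs1)).trans ?_
        gcongr
        exact h.rhs_scale_le hα hs1
    _ = C a * rhs α J T Qt d F * (w s * ENNReal.ofReal ((s ^ (2*α)) ^ m)) := by ring
    _ ≤ _ := by
        gcongr
        rw [hw, ← ENNReal.ofReal_mul (by positivity)]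
        apply ENNReal.ofReal_le_ofReal
        have e : s ^ (-3 + 2*α*m) = (s ^ 2)⁻¹ * s⁻¹ * (s ^ (2*α)) ^ m := by
          rw [Real.rpow_add hs0, Real.rpow_mul hs0.le, Real.rpow_natCast,
            Real.rpow_neg hs0.le, show (3:ℝ) = (3:ℕ) by norm_num, Real.rpow_natCast]
          congr 1
          rw [← mul_inv]; congr 1
        rw [e]
        gcongr

end

section
variable {m : ℕ} {Δ α : ℝ} {S : Finset (Fin m)}

/-- The directions in which some derivative is taken. -/
def dirs (β : Idx m → ℕ) : Finset (Fin m) :=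
  Finset.univ.filter fun i => β (Sum.inl i) ≠ 0 ∨ β (Sum.inr i) ≠ 0

lemma mem_dirs {β : Idx m → ℕ} {i : Fin m} :
    i ∈ dirs β ↔ β (Sum.inl i) ≠ 0 ∨ β (Sum.inr i) ≠ 0 := by
  simp [dirs]

lemma ix_sel (j : Corner m) (i : Fin m) : ix (sel j i) = i := by
  unfold ix sel; split_ifs <;> rfl

lemma mem_dirs_of_ne {β : Idx m → ℕ} {a : Idx m} (h : β a ≠ 0) : ix a ∈ dirs β := by
  rw [mem_dirs]
  rcases a with a | a
  · exact Or.inl h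
  · exact Or.inr h

lemma eq_sel_or (j : Corner m) (a : Idx m) :
    a = sel j (ix a) ∨ a = sel (fun h => 1 - j h) (ix a) := by
  unfold sel ix
  rcases a with i | i <;> obtain h | h : j i = 0 ∨ j i = 1 := by omega
  all_goals simp [h]

/-- If all forms with derivatives of both types in some direction are bounded, then so are all
forms with at least two derivatives, taken in directions outside of `S`. -/
lemma Bdd.of_two_le (hΔ : 1 ≤ Δ) (hα : 0 ≤ α) (hαm : α * m < 1)
    (hK : ∀ i ∉ S, ∀ β : Idx m → ℕ, β (Sum.inl i) ≠ 0 → β (Sum.inr i) ≠ 0 → Bdd Δ α S β)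
    (β : Idx m → ℕ) (hβS : ∀ a, ix a ∈ S → β a = 0) (hβ : 2 ≤ ∑ a, β a) : Bdd Δ α S β := by
  induction hn : m - (dirs β).card using Nat.strong_induction_on generalizing β with
  | _ n ih =>
  by_cases hgood : ∃ i ∉ S, β (Sum.inl i) ≠ 0 ∧ β (Sum.inr i) ≠ 0
  · obtain ⟨i, hi, h1, h2⟩ := hgood
    exact hK i hi β h1 h2
  have hgrow : ∀ β' : Idx m → ℕ, β ≤ β' → (∀ a, ix a ∈ S → β' a = 0) →
      ∀ a, β' a ≠ 0 → ix a ∉ dirs β → Bdd Δ α S β' := by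
    intro β' hle hS a ha hna
    refine ih _ ?_ β' hS (hβ.trans (Finset.sum_le_sum fun a _ => hle a)) rfl
    have hss : dirs β ⊂ dirs β' := by
      refine (Finset.ssubset_iff_of_subset fun i hi => ?_).2 ⟨ix a, mem_dirs_of_ne ha, hna⟩
      rw [mem_dirs] at hi ⊢
      have h1 : β (Sum.inl i) ≤ β' (Sum.inl i) := hle _
      have h2 : β (Sum.inr i) ≤ β' (Sum.inr i) := hle _
      omega
    have h1 := Finset.card_lt_card hss
    have h2 := Finset.card_le_univ (dirs β')
    rw [Fintype.card_fin] at h2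
    omega
  obtain ⟨a₀, ha₀⟩ : ∃ a, β a ≠ 0 := by
    by_contra hcon
    push Not at hcon
    simp [hcon] at hβ
  have ha₀S : ix a₀ ∉ S := fun h => ha₀ (hβS _ h)
  have hsum : ∑ a ∈ tau S, β a = ∑ a, β a :=
    Finset.sum_subset (Finset.subset_univ _) fun a _ ha => hβS a (by simpa [mem_tau] using ha)
  refine Bdd.of_scale hα hαm ha₀S (hsum ▸ hβ) fun a ha => ?_
  rw [mem_tau] at ha
  have hsuppA : ∀ (k : ℕ) (γ : Idx m → ℕ), (∀ a, ix a ∈ S → γ a = 0) → ∀ c, ix c ∉ S →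
      ∀ a, ix a ∈ S → (γ + Pi.single c k : Idx m → ℕ) a = 0 := by
    intro k γ hγ c hc a ha
    have : a ≠ c := by rintro rfl; exact hc ha
    simp [hγ a ha, Pi.single_eq_of_ne this]
  by_cases hd : ix a ∈ dirs β
  swap
  · exact hgrow _ (le_add_of_nonneg_right (zero_le)) (hsuppA 2 β hβS a ha) a (by simp) hd
  let j : Corner m := fun h => if β (Sum.inl h) ≠ 0 then 0 else 1
  have hj : ∀ h ∈ dirs β, β (sel j h) ≠ 0 := by
    intro h hh
    rw [mem_dirs] at hh
    by_cases h1 : β (Sum.inl h) = 0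
    · simpa [sel, j, h1] using hh
    · simp [sel, j, h1]
  have hpair : ∀ (γ : Idx m → ℕ) (h : Fin m), h ∉ S → γ (sel j h) ≠ 0 →
      γ (sel (fun h => 1 - j h) h) ≠ 0 → Bdd Δ α S γ := by
    intro γ h hS h1 h2
    by_cases hb : β (Sum.inl h) = 0
    · exact hK h hS γ (by simpa [sel, j, hb] using h2) (by simpa [sel, j, hb] using h1)
    · exact hK h hS γ (by simpa [sel, j, hb] using h1) (by simpa [sel, j, hb] using h2)
  rcases eq_sel_or j a with hja | hja
  swap
  · refine hpair _ (ix a) ha ?_ ?_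
    · have := hj _ hd
      simp only [Pi.add_apply]; omega
    · rw [← hja]; simp
  set γ := β + Pi.single a 1 with hγ
  have hγS := hsuppA 1 β hβS a ha
  have hγβ : β + Pi.single a 2 = γ + Pi.single (sel j (ix a)) 1 := by
    rw [← hja, hγ, add_assoc, ← Pi.single_add]
  refine Bdd.of_le (s := (Finset.univ : Finset (Fin m)).filter (· ∉ S) |>.image
      fun h => γ + Pi.single (sel (fun h => 1 - j h) h) 1)
    (K := ∑ h : Fin m, Real.toNNReal (m * (Δ * cInv m Δ))) ?_ ?_
  · intro b hb
    rw [Finset.mem_image] at hb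
    obtain ⟨h, hh, rfl⟩ := hb
    have hhS : h ∉ S := by simpa using hh
    by_cases hhd : h ∈ dirs β
    · refine hpair _ h hhS ?_ (by simp)
      have := hj h hhd
      simp only [hγ, Pi.add_apply]; omega
    · refine hgrow _ ?_ (hsuppA 1 γ hγS (sel (fun h => 1 - j h) h) (by rwa [ix_sel])) (sel (fun h => 1 - j h) h) (by simp)
        (by rwa [ix_sel])
      rw [hγ, add_assoc]
      exact le_add_of_nonneg_right zero_le
  · intro J T Qt d F h k t ht
    obtain ⟨b, hb, hV⟩ := V_ibp_corner hΔ h.reg h.row h.pos h.le h.eq j (ix a)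
    have := hV (h.integrable_Wk k) ht γ 0
    rw [if_neg ha, add_zero] at this
    rw [hγβ, this]
    refine (enorm_sum_le _ _).trans ?_
    push_cast
    rw [Finset.sum_mul]
    calc _ ≤ ∑ x : Fin m, if x ∈ S then 0 else
          ‖b x * V J (Wk J T F k) (dd d t) (γ + Pi.single (sel (fun h => 1 - j h) x) 1) 0‖ₑ := by
            rw [← Finset.sum_subset (Finset.subset_univ Sᶜ)]
            · refine Finset.sum_le_sum fun x hx => ?_
              rw [if_neg (by simpa using hx)]
            · intro x _ hx
              rw [if_pos (by simpa using hx)]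
      _ ≤ _ := by
        refine Finset.sum_le_sum fun x _ => ?_
        split_ifs with hx
        · exact zero_le
        rw [enorm_mul]
        gcongr
        · rw [Real.enorm_eq_ofReal_abs]
          exact ENNReal.ofReal_le_ofReal (hb x)
        · exact Finset.single_le_sum (f := fun b => ‖V J (Wk J T F k) (dd d t) b 0‖ₑ)
            (fun _ _ => zero_le) (Finset.mem_image.2 ⟨x, by simpa using hx, rfl⟩)

end

section
variable {m : ℕ}

/-- The coordinates with index different from `i`. -/
abbrev Rest (i : Fin m) := {a : Idx m // ¬ ix a = i}

/-- The two coordinates with index `i`. -/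
def pairEquiv (i : Fin m) : Fin 2 ≃ {a : Idx m // ix a = i} where
  toFun s := ⟨if s = 0 then Sum.inl i else Sum.inr i, by split_ifs <;> rfl⟩
  invFun a := Sum.elim (fun _ => 0) (fun _ => 1) a.1
  left_inv s := by fin_cases s <;> rfl
  right_inv a := by
    obtain ⟨a, ha⟩ := a
    subst ha
    rcases a with a | a <;> rfl

/-- Assembling a point of `ℝ^{2m}` from the two coordinates with index `i` and the others. -/
def glue (i : Fin m) : (ℝ × ℝ) × (Rest i → ℝ) ≃ᵐ (Idx m → ℝ) :=
  (MeasurableEquiv.prodCongr (MeasurableEquiv.finTwoArrow.symm.trans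
    (MeasurableEquiv.piCongrLeft (fun _ => ℝ) (pairEquiv i))) (MeasurableEquiv.refl _)).trans
    (MeasurableEquiv.piEquivPiSubtypeProd (fun _ : Idx m => ℝ) (fun a => ix a = i)).symm

lemma measurePreserving_glue (i : Fin m) : MeasurePreserving (glue i) :=
  ((volume_preserving_piEquivPiSubtypeProd (fun _ : Idx m => ℝ) (fun a => ix a = i)).symm _).comp
    ((((volume_measurePreserving_piCongrLeft (fun _ => ℝ) (pairEquiv i)).comp
      ((volume_preserving_finTwoArrow ℝ).symm _))).prod (MeasurePreserving.id volume))

lemma glue_inl (i : Fin m) (y : ℝ × ℝ) (x : Rest i → ℝ) : glue i (y, x) (Sum.inl i) = y.1 := by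
  have h : ix (Sum.inl i) = i := rfl
  have h2 : (⟨Sum.inl i, h⟩ : {a : Idx m // ix a = i}) = pairEquiv i 0 := rfl
  simp only [glue, MeasurableEquiv.trans_apply, MeasurableEquiv.prodCongr]
  change (if h : ix (Sum.inl i) = i then _ else _) = _
  rw [dif_pos h]
  change (Equiv.piCongrLeft (fun _ => ℝ) (pairEquiv i)) ![y.1, y.2] ⟨Sum.inl i, h⟩ = _
  rw [h2, Equiv.piCongrLeft_apply_apply]
  rfl

lemma glue_inr (i : Fin m) (y : ℝ × ℝ) (x : Rest i → ℝ) : glue i (y, x) (Sum.inr i) = y.2 := by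
  have h : ix (Sum.inr i) = i := rfl
  have h2 : (⟨Sum.inr i, h⟩ : {a : Idx m // ix a = i}) = pairEquiv i 1 := rfl
  simp only [glue, MeasurableEquiv.trans_apply, MeasurableEquiv.prodCongr]
  change (if h : ix (Sum.inr i) = i then _ else _) = _
  rw [dif_pos h]
  change (Equiv.piCongrLeft (fun _ => ℝ) (pairEquiv i)) ![y.1, y.2] ⟨Sum.inr i, h⟩ = _
  rw [h2, Equiv.piCongrLeft_apply_apply]
  rfl

lemma glue_rest (i : Fin m) (y : ℝ × ℝ) (x : Rest i → ℝ) (a : Rest i) :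
    glue i (y, x) a.1 = x a := by
  change (if h : ix a.1 = i then _ else _) = _
  rw [dif_neg a.2]
  rfl

lemma prod_idx_split {M : Type*} [CommMonoid M] (i : Fin m) (f : Idx m → M) :
    ∏ a, f a = (f (Sum.inl i) * f (Sum.inr i)) * ∏ a : Rest i, f a.1 := by
  rw [← Fintype.prod_subtype_mul_prod_subtype (fun a => ix a = i) f]
  congr 1
  rw [← Equiv.prod_comp (pairEquiv i) fun a => f a.1, Fin.prod_univ_two]
  rfl

/-- The part of the kernel in the coordinates with index different from `i`. -/
def G (i : Fin m) (J : Matrix (Idx m) (Fin m) ℝ) (σ : Idx m → ℝ) (β : Idx m → ℕ)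
    (u : Idx m → ℝ) (z : (Fin m → ℝ) × (Rest i → ℝ)) : ℝ :=
  ∏ a : Rest i, ph (σ a.1) (β a.1) (u a.1) (z.2 a + (J *ᵥ z.1) a.1)

/-- The integral in a single coordinate. -/
def X {i : Fin m} (w : ℝ → (Rest i → ℝ) → ℝ) (σ : ℝ) (b : ℕ) (u q : ℝ) (x : Rest i → ℝ) : ℝ :=
  ∫ y, w y x * ph σ b u (y + q)

/-- The reordering of variables used to integrate in the pair of coordinates with index `i`. -/
def shuffle (i : Fin m) :
    ((Fin m → ℝ) × (Rest i → ℝ)) × (ℝ × ℝ) ≃ᵐ (Fin m → ℝ) × (Idx m → ℝ) :=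
  (MeasurableEquiv.prodAssoc.trans (MeasurableEquiv.prodCongr (MeasurableEquiv.refl _)
    MeasurableEquiv.prodComm)).trans (MeasurableEquiv.prodCongr (MeasurableEquiv.refl _) (glue i))

lemma measurePreserving_shuffle (i : Fin m) : MeasurePreserving (shuffle i) :=
  ((MeasurePreserving.id volume).prod (measurePreserving_glue i)).comp
    (((MeasurePreserving.id volume).prod Measure.measurePreserving_swap).comp
      (volume_preserving_prodAssoc))

lemma shuffle_apply (i : Fin m) (p : Fin m → ℝ) (x : Rest i → ℝ) (y : ℝ × ℝ) :
    shuffle i ((p, x), y) = (p, glue i (y, x)) := rfl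

lemma V_split_integrand (i : Fin m) {J : Matrix (Idx m) (Fin m) ℝ} {W : (Idx m → ℝ) → ℝ}
    {w₀ w₁ : ℝ → (Rest i → ℝ) → ℝ}
    (hw : ∀ y x, W (glue i (y, x)) = w₀ y.1 x * w₁ y.2 x) (σ : Idx m → ℝ) (β : Idx m → ℕ)
    (u : Idx m → ℝ) (z : ((Fin m → ℝ) × (Rest i → ℝ)) × (ℝ × ℝ)) :
    W (shuffle i z).2 * ker J σ β u (shuffle i z).1 (shuffle i z).2 =
      G i J σ β u z.1 *
        ((w₀ z.2.1 z.1.2 * ph (σ (Sum.inl i)) (β (Sum.inl i)) (u (Sum.inl i))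
            (z.2.1 + (J *ᵥ z.1.1) (Sum.inl i))) *
          (w₁ z.2.2 z.1.2 * ph (σ (Sum.inr i)) (β (Sum.inr i)) (u (Sum.inr i))
            (z.2.2 + (J *ᵥ z.1.1) (Sum.inr i)))) := by
  obtain ⟨⟨p, x⟩, y⟩ := z
  rw [shuffle_apply]
  dsimp only
  rw [hw, ker, prod_idx_split i, glue_inl, glue_inr, G]
  simp only [glue_rest]
  ring

lemma V_split (i : Fin m) {J : Matrix (Idx m) (Fin m) ℝ} {j : Corner m}
    (hJ : (Amat J j).det ≠ 0) {W : (Idx m → ℝ) → ℝ} (hW : Integrable W)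
    {w₀ w₁ : ℝ → (Rest i → ℝ) → ℝ}
    (hw : ∀ y x, W (glue i (y, x)) = w₀ y.1 x * w₁ y.2 x)
    {σ : Idx m → ℝ} (hσ : ∀ a, σ a ≠ 0) (β : Idx m → ℕ) (u : Idx m → ℝ) :
    (Integrable fun z : (Fin m → ℝ) × (Rest i → ℝ) => G i J σ β u z *
      (X w₀ (σ (Sum.inl i)) (β (Sum.inl i)) (u (Sum.inl i)) ((J *ᵥ z.1) (Sum.inl i)) z.2 *
       X w₁ (σ (Sum.inr i)) (β (Sum.inr i)) (u (Sum.inr i)) ((J *ᵥ z.1) (Sum.inr i)) z.2)) ∧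
    V J W σ β u = ∫ z : (Fin m → ℝ) × (Rest i → ℝ), G i J σ β u z *
      (X w₀ (σ (Sum.inl i)) (β (Sum.inl i)) (u (Sum.inl i)) ((J *ᵥ z.1) (Sum.inl i)) z.2 *
       X w₁ (σ (Sum.inr i)) (β (Sum.inr i)) (u (Sum.inr i)) ((J *ᵥ z.1) (Sum.inr i)) z.2) := by
  have h1 := (measurePreserving_shuffle i).integrable_comp_of_integrable
    (integrable_V hJ hW hσ β u)
  have h2 : V J W σ β u = ∫ z, W (shuffle i z).2 * ker J σ β u (shuffle i z).1 (shuffle i z).2 :=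
    ((measurePreserving_shuffle i).integral_comp' (fun z => W z.2 * ker J σ β u z.1 z.2)).symm
  have h3 : ((fun z : (Fin m → ℝ) × (Idx m → ℝ) => W z.2 * ker J σ β u z.1 z.2) ∘ shuffle i) =
    fun z => W (shuffle i z).2 * ker J σ β u (shuffle i z).1 (shuffle i z).2 := rfl
  rw [h3] at h1
  simp only [V_split_integrand i hw] at h1 h2
  have h4 := h1.integral_prod_left
  have h5 : ∀ (c : ℝ) (f g : ℝ → ℝ), ∫ y : ℝ × ℝ, c * (f y.1 * g y.2) =
      c * ((∫ y, f y) * ∫ y, g y) := fun c f g => by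
    rw [integral_const_mul, Measure.volume_eq_prod, integral_prod_mul]
  have h6 := h2.trans (integral_prod _ h1)
  have h7 := fun z : (Fin m → ℝ) × (Rest i → ℝ) => h5 (G i J σ β u z)
    (fun y => w₀ y z.2 * ph (σ (Sum.inl i)) (β (Sum.inl i)) (u (Sum.inl i))
      (y + (J *ᵥ z.1) (Sum.inl i)))
    (fun y => w₁ y z.2 * ph (σ (Sum.inr i)) (β (Sum.inr i)) (u (Sum.inr i))
      (y + (J *ᵥ z.1) (Sum.inr i)))
  exact ⟨(integrable_congr (Filter.Eventually.of_forall h7)).1 h4,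
    h6.trans (integral_congr_ae (Filter.Eventually.of_forall h7))⟩

end

section
variable {m : ℕ}

lemma prod_corner_split {M : Type*} [CommMonoid M] (i : Fin m) (g : Corner m → M) :
    ∏ j, g j = (∏ j ∈ Finset.univ.filter (fun j : Corner m => j i = 0), g (Function.update j i 0)) *
      ∏ j ∈ Finset.univ.filter (fun j : Corner m => j i = 0), g (Function.update j i 1) := by
  rw [← Finset.prod_filter_mul_prod_filter_not Finset.univ (fun j : Corner m => j i = 0)]
  congr 1
  · refine Finset.prod_congr rfl fun j hj => ?_
    rw [Finset.mem_filter] at hj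
    rw [← hj.2, Function.update_eq_self]
  · refine (Finset.prod_bij' (fun j _ => Function.update j i 1)
      (fun j _ => Function.update j i 0) ?_ ?_ ?_ ?_ ?_).symm
    · intro j _; simp
    · intro j _; simp
    · intro j hj
      rw [Finset.mem_filter] at hj
      rw [Function.update_idem, ← hj.2, Function.update_eq_self]
    · intro j hj
      rw [Finset.mem_filter] at hj
      have : j i = 1 := by have := hj.2; omega
      rw [Function.update_idem, ← this, Function.update_eq_self]
    · intro j _; rfl

/-- The product of the functions at the corners with `i`-th entry `s`, as a function of the
`i`-th coordinate and the remaining coordinates. -/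
def wprod (i : Fin m) (f : Corner m → (Fin m → ℝ) → ℝ) (s : Fin 2) (y : ℝ) (x : Rest i → ℝ) : ℝ :=
  ∏ j ∈ Finset.univ.filter (fun j : Corner m => j i = 0),
    f (Function.update j i s) (proj j (glue i ((y, y), x)))

lemma proj_update_glue (i : Fin m) (j : Corner m) (s : Fin 2) (y : ℝ × ℝ) (x : Rest i → ℝ) :
    proj (Function.update j i s) (glue i (y, x)) =
      proj j (glue i (((if s = 0 then y.1 else y.2), (if s = 0 then y.1 else y.2)), x)) := by
  funext h
  unfold proj
  by_cases hi : h = i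
  · subst hi
    unfold sel
    rw [Function.update_self]
    split_ifs <;> simp only [glue_inl, glue_inr]
  · have h1 : sel (Function.update j i s) h = sel j h := by
      unfold sel; rw [Function.update_of_ne hi]
    have h2 : ¬ ix (sel j h) = i := by rwa [ix_sel]
    rw [h1, glue_rest i _ _ ⟨_, h2⟩, glue_rest i _ _ ⟨_, h2⟩]

lemma prod_proj_glue (i : Fin m) (f : Corner m → (Fin m → ℝ) → ℝ) (y : ℝ × ℝ) (x : Rest i → ℝ) :
    ∏ j, f j (proj j (glue i (y, x))) = wprod i f 0 y.1 x * wprod i f 1 y.2 x := by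
  rw [prod_corner_split i, wprod, wprod]
  simp [proj_update_glue]

lemma wprod_update (i : Fin m) (f : Corner m → (Fin m → ℝ) → ℝ) (r s : Fin 2) :
    wprod i (fun j => f (Function.update j i s)) r = wprod i f s := by
  funext y x
  unfold wprod
  simp only [Function.update_idem]

/-- The matrix in which both rows with index `i` agree. -/
def JS (J : Matrix (Idx m) (Fin m) ℝ) (i : Fin m) (s : Fin 2) : Matrix (Idx m) (Fin m) ℝ :=
  Matrix.of fun a k => if ix a = i then J (sel (fun _ => s) i) k else J a k

lemma Amat_JS (J : Matrix (Idx m) (Fin m) ℝ) (i : Fin m) (s : Fin 2) (j : Corner m) :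
    Amat (JS J i s) j = Amat J (Function.update j i s) := by
  ext h k
  simp only [Amat, JS, Matrix.of_apply, ix_sel]
  split_ifs with hi
  · subst hi; simp [sel]
  · congr 1; simp [sel, Function.update_of_ne hi]

/-- The localized functions. -/
def fk (J : Matrix (Idx m) (Fin m) ℝ) (T : Set (ℤ × (Fin m → ℤ)))
    (F : Corner m → (Fin m → ℝ) → ℝ) (k : ℤ) (j : Corner m) : (Fin m → ℝ) → ℝ :=
  Set.indicator ((Amat J j).mulVec '' Tkset T k) (F j)

lemma fk_JS (J : Matrix (Idx m) (Fin m) ℝ) (T : Set (ℤ × (Fin m → ℤ)))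
    (F : Corner m → (Fin m → ℝ) → ℝ) (k : ℤ) (i : Fin m) (s : Fin 2) :
    fk (JS J i s) T (fun j => F (Function.update j i s)) k =
      fun j => fk J T F k (Function.update j i s) := by
  funext j
  unfold fk
  rw [Amat_JS]

lemma Wk_glue (J : Matrix (Idx m) (Fin m) ℝ) (T : Set (ℤ × (Fin m → ℤ)))
    (F : Corner m → (Fin m → ℝ) → ℝ) (k : ℤ) (i : Fin m) (y : ℝ × ℝ) (x : Rest i → ℝ) :
    Wk J T F k (glue i (y, x)) =
      wprod i (fk J T F k) 0 y.1 x * wprod i (fk J T F k) 1 y.2 x :=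
  prod_proj_glue i (fk J T F k) y x

lemma Wk_JS_glue (J : Matrix (Idx m) (Fin m) ℝ) (T : Set (ℤ × (Fin m → ℤ)))
    (F : Corner m → (Fin m → ℝ) → ℝ) (k : ℤ) (i : Fin m) (s : Fin 2) (y : ℝ × ℝ)
    (x : Rest i → ℝ) :
    Wk (JS J i s) T (fun j => F (Function.update j i s)) k (glue i (y, x)) =
      wprod i (fk J T F k) s y.1 x * wprod i (fk J T F k) s y.2 x := by
  rw [Wk_glue, fk_JS, wprod_update, wprod_update]

lemma istar_eq_update (i : Fin m) (j : Corner m) :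
    istar i j = Function.update j i (1 - j i) := by
  funext h
  by_cases hi : h = i
  · subst hi; simp [istar]
  · simp [istar, hi]

variable {Δ α : ℝ} {S : Finset (Fin m)} {J : Matrix (Idx m) (Fin m) ℝ}
  {T : Set (ℤ × (Fin m → ℤ))} {Qt : ℤ × (Fin m → ℤ)} {d : Fin m → ℝ}
  {F : Corner m → (Fin m → ℝ) → ℝ}

lemma Adm.symmetrize (h : Adm Δ S J T Qt d F) (i : Fin m) (s : Fin 2) {d' : Fin m → ℝ}
    (hpos : ∀ h, 0 < d' h) (hle : ∀ h ∈ insert i S, ∀ i' ∉ insert i S, d' h ≤ d' i')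
    (heq : ∀ h ∉ insert i S, ∀ i' ∉ insert i S, d' h = d' i') :
    Adm Δ (insert i S) (JS J i s) T Qt d' (fun j => F (Function.update j i s)) where
  reg j := by rw [Amat_JS]; exact h.reg _
  row a ha k := by
    have h1 : ix (Sum.inl a : Idx m) = a := rfl
    have h2 : ix (Sum.inr a : Idx m) = a := rfl
    simp only [JS, Matrix.of_apply, h1, h2]
    split_ifs with hai
    · rfl
    · exact h.row a ((Finset.mem_insert.1 ha).resolve_left hai) k
  tree := h.tree
  pos := hpos
  le := hle
  eq := heq
  cont j := h.cont _
  supp j := h.supp _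
  symm j a ha := by
    by_cases hai : a = i
    · subst hai
      rw [istar_eq_update, Function.update_idem]
    · have haS := (Finset.mem_insert.1 ha).resolve_left hai
      rw [h.symm _ a haS, istar_eq_update, istar_eq_update, Function.update_of_ne hai,
        Function.update_comm hai]

lemma Adm.wprod_eq (h : Adm Δ S J T Qt d F) {i : Fin m} (hi : i ∈ S) (k : ℤ) :
    wprod i (fk J T F k) 1 = wprod i (fk J T F k) 0 := by
  funext y x
  refine Finset.prod_congr rfl fun j _ => ?_
  have h1 : istar i (Function.update j i 1) = Function.update j i 0 := by
    rw [istar_eq_update]; simp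
  have h2 : F (Function.update j i 1) = F (Function.update j i 0) := by
    rw [h.symm _ i hi, h1]
  have h3 : Amat J (Function.update j i 1) = Amat J (Function.update j i 0) := by
    ext a k
    by_cases ha : a = i
    · subst ha
      simp [Amat, sel, h.row a hi k]
    · simp [Amat, sel, Function.update_of_ne ha]
  unfold fk
  rw [h2, h3]

/-- Nonnegativity of the forms with a derivative in each of the two coordinates of a
symmetric direction. -/
lemma Adm.V_nonneg (h : Adm Δ S J T Qt d F) {i : Fin m} (hi : i ∈ S) (k : ℤ) {t : ℝ}
    (ht : 0 < t) :
    0 ≤ V J (Wk J T F k) (dd d t) (Pi.single (Sum.inl i) 1 + Pi.single (Sum.inr i) 1) 0 := by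
  rw [(V_split i (h.isUnit fun _ => 0).ne_zero (h.integrable_Wk k) (Wk_glue J T F k i)
    (fun a => (dd_pos h.pos ht a).ne') _ 0).2]
  refine integral_nonneg fun z => mul_nonneg ?_ ?_
  · refine Finset.prod_nonneg fun a _ => ?_
    have h0 : (Pi.single (Sum.inl i) 1 + Pi.single (Sum.inr i) 1 : Idx m → ℕ) a.1 = 0 := by
      have h1 : a.1 ≠ Sum.inl i := fun h => a.2 (by rw [h]; rfl)
      have h2 : a.1 ≠ Sum.inr i := fun h => a.2 (by rw [h]; rfl)
      simp [Pi.single_eq_of_ne h1, Pi.single_eq_of_ne h2]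
    rw [h0, ph, gd_zero]
    have := dd_pos h.pos ht a.1
    positivity
  · have h1 : (J *ᵥ z.1) (Sum.inr i) = (J *ᵥ z.1) (Sum.inl i) := by
      simp only [Matrix.mulVec, dotProduct, h.row i hi]
    have h2 : dd d t (Sum.inr i) = dd d t (Sum.inl i) := rfl
    rw [h.wprod_eq hi, h1, h2]
    simp
    exact mul_self_nonneg _

end

section

lemma one_add_norm_le_prod {ι : Type*} [Fintype ι] (y : ι → ℝ) :
    1 + ‖y‖ ≤ ∏ a, (1 + |y a|) := by
  classical
  have h1 : ∀ s : Finset ι, (1:ℝ) ≤ ∏ a ∈ s, (1 + |y a|) := fun s =>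
    Finset.prod_induction (fun a => 1 + |y a|) (fun r => (1:ℝ) ≤ r)
      (fun a b ha hb => one_le_mul_of_one_le_of_one_le ha hb) le_rfl
      fun a _ => by linarith [abs_nonneg (y a)]
  have h2 : ‖y‖ ≤ ∏ a, (1 + |y a|) - 1 := by
    rw [pi_norm_le_iff_of_nonneg (by linarith [h1 Finset.univ])]
    intro a
    rw [← Finset.mul_prod_erase Finset.univ _ (Finset.mem_univ a), Real.norm_eq_abs]
    nlinarith [h1 (Finset.univ.erase a), abs_nonneg (y a)]
  linarith

lemma prod_gd_le_tsum {ι : Type*} [Fintype ι] (β : ι → ℕ) (κ : ℕ) :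
    ∃ C : ℝ, 0 ≤ C ∧ ∀ (z u : ι → ℝ) (U : ℝ), 0 ≤ U → (∀ a, |u a| ≤ U) →
      ENNReal.ofReal (∏ a, |gd (β a) (z a + u a)|) ≤ ENNReal.ofReal (C * (1 + U) ^ κ) *
        ∑' n : ℕ, ENNReal.ofReal ((((2:ℝ) ^ n) ^ κ)⁻¹ * ∏ a, gd 0 (z a / 2 ^ n)) := by
  choose c hc0 hc using fun a => gd_decay (β a) κ
  refine ⟨(∏ a, c a) * Real.exp (4 * Real.pi) ^ Fintype.card ι, by
    have := Finset.prod_nonneg fun a (_ : a ∈ Finset.univ) => hc0 a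
    positivity, fun z u U hU hu => ?_⟩
  have hz : 1 + ‖z‖ ≤ (1 + ‖fun a => z a + u a‖) * (1 + U) := by
    have h1 : ‖z‖ ≤ ‖fun a => z a + u a‖ + U := by
      rw [pi_norm_le_iff_of_nonneg (by positivity)]
      intro a
      have h2 : |z a + u a| ≤ ‖fun a => z a + u a‖ := norm_le_pi_norm (fun a => z a + u a) a
      have h3 := abs_sub (z a + u a) (u a)
      rw [add_sub_cancel_right] at h3
      rw [Real.norm_eq_abs]
      linarith [hu a]
    nlinarith [norm_nonneg (fun a => z a + u a)]
  set Y := 1 + ‖fun a => z a + u a‖ with hY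
  have hY0 : 1 ≤ Y := by rw [hY]; linarith [norm_nonneg (fun a => z a + u a)]
  have h1 : (∏ a, |gd (β a) (z a + u a)|) * Y ^ κ ≤ ∏ a, c a := by
    calc _ ≤ (∏ a, |gd (β a) (z a + u a)|) * (∏ a, (1 + |z a + u a|)) ^ κ := by
          gcongr
          exact one_add_norm_le_prod _
      _ = ∏ a, |gd (β a) (z a + u a)| * (1 + |z a + u a|) ^ κ := by
          rw [Finset.prod_mul_distrib, Finset.prod_pow]
      _ ≤ _ := Finset.prod_le_prod (fun a _ => by positivity) fun a _ => hc a _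
  obtain ⟨n, hn1, hn2⟩ := exists_nat_pow_near (x := 1 + ‖z‖) (y := (2:ℝ))
    (by linarith [norm_nonneg z]) one_lt_two
  have h2 : Real.exp (-(4 * Real.pi)) ^ Fintype.card ι ≤ ∏ a, gd 0 (z a / 2 ^ n) := by
    rw [← Finset.card_univ, ← Finset.prod_const]
    refine Finset.prod_le_prod (fun a _ => (Real.exp_pos _).le) fun a _ => ?_
    rw [gd_zero, Real.exp_le_exp]
    have h3 : |z a / 2 ^ n| ≤ 2 := by
      rw [abs_div, abs_of_pos (by positivity : (0:ℝ) < 2 ^ n), div_le_iff₀ (by positivity)]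
      have := norm_le_pi_norm z a
      rw [Real.norm_eq_abs] at this
      rw [pow_succ] at hn2
      linarith
    have h4 : (z a / 2 ^ n) ^ 2 ≤ 4 := by
      rw [← sq_abs]; nlinarith [abs_nonneg (z a / 2 ^ n)]
    nlinarith [Real.pi_pos]
  refine le_trans ?_ (mul_le_mul_right (ENNReal.le_tsum n) _)
  rw [← ENNReal.ofReal_mul (by
    have := Finset.prod_nonneg fun a (_ : a ∈ Finset.univ) => hc0 a
    positivity)]
  refine ENNReal.ofReal_le_ofReal ?_
  have h5 : (((2:ℝ) ^ n) ^ κ) ≤ Y ^ κ * (1 + U) ^ κ := by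
    rw [← mul_pow]; gcongr; linarith
  have hc' := Finset.prod_nonneg fun a (_ : a ∈ Finset.univ) => hc0 a
  calc ∏ a, |gd (β a) (z a + u a)| ≤ (∏ a, c a) * (Y ^ κ)⁻¹ := by
        rw [← div_eq_mul_inv, le_div_iff₀ (by positivity)]; exact h1
    _ ≤ (∏ a, c a) * ((1 + U) ^ κ * (((2:ℝ) ^ n) ^ κ)⁻¹) := by
        gcongr
        rw [← div_eq_mul_inv, le_div_iff₀ (by positivity), inv_mul_le_iff₀ (by positivity)]
        exact h5
    _ = (∏ a, c a) * (1 + U) ^ κ * ((((2:ℝ) ^ n) ^ κ)⁻¹ *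
          (Real.exp (4 * Real.pi) ^ Fintype.card ι *
            Real.exp (-(4 * Real.pi)) ^ Fintype.card ι)) := by
        rw [← mul_pow, ← Real.exp_add, add_neg_cancel, Real.exp_zero, one_pow]; ring
    _ ≤ (∏ a, c a) * (1 + U) ^ κ * ((((2:ℝ) ^ n) ^ κ)⁻¹ *
          (Real.exp (4 * Real.pi) ^ Fintype.card ι * ∏ a, gd 0 (z a / 2 ^ n))) := by gcongr
    _ = _ := by ring

lemma sq_lintegral_mul_le {α : Type*} [MeasurableSpace α] {μ : Measure α} {f g : α → ℝ≥0∞}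
    (hf : AEMeasurable f μ) (hg : AEMeasurable g μ) :
    (∫⁻ a, f a * g a ∂μ) ^ 2 ≤ (∫⁻ a, f a ∂μ) * ∫⁻ a, f a * g a ^ 2 ∂μ := by
  have h1 := ENNReal.lintegral_mul_le_Lp_mul_Lq μ (p := 2) (q := 2)
    ⟨by norm_num, by norm_num, by norm_num⟩ (hf.pow_const (1/2 : ℝ)) ((hf.pow_const (1/2 : ℝ)).mul hg)
  have h2 : ∀ r : ℝ≥0∞, (r ^ (1/2 : ℝ)) * r ^ (1/2 : ℝ) = r := fun r => by
    rw [← ENNReal.rpow_add_of_nonneg _ _ (by norm_num) (by norm_num)]; norm_num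
  have h3 : ∀ r : ℝ≥0∞, (r ^ (1/2 : ℝ)) ^ (2:ℝ) = r := fun r => by
    rw [← ENNReal.rpow_mul]; norm_num
  have h4 : ∀ r : ℝ≥0∞, (r ^ (1/2 : ℝ)) ^ 2 = r := fun r => by rw [sq, h2]
  simp only [Pi.mul_apply, ← mul_assoc, h2, h3, ENNReal.mul_rpow_of_nonneg _ _ zero_le_two] at h1
  calc _ ≤ _ := pow_le_pow_left' h1 2
    _ = _ := by
      rw [mul_pow, h4, h4]
      simp only [ENNReal.rpow_two]

lemma measurable_X {m : ℕ} {i : Fin m} {w : ℝ → (Rest i → ℝ) → ℝ}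
    (hw : Measurable (Function.uncurry w)) (σ : ℝ) (b : ℕ) (u : ℝ) :
    Measurable fun p : ℝ × (Rest i → ℝ) => X w σ b u p.1 p.2 := by
  refine (StronglyMeasurable.integral_prod_right
    (f := fun (p : ℝ × (Rest i → ℝ)) y => w y p.2 * ph σ b u (y + p.1)) ?_).measurable
  refine Measurable.stronglyMeasurable ?_
  refine (hw.comp (measurable_snd.prodMk (measurable_snd.comp measurable_fst))).mul ?_
  exact (continuous_ph σ b u).measurable.comp
    (measurable_snd.add (measurable_fst.comp measurable_fst))

lemma X_eq_integral {m : ℕ} {i : Fin m} {w : ℝ → (Rest i → ℝ) → ℝ} {x : Rest i → ℝ}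
    (hw : Integrable fun y => w y x) {σ : ℝ} (hσ : σ ≠ 0) (b : ℕ) (u q : ℝ) :
    X w σ (b + 1) u q x = 2 * √2 ^ b *
      ∫ v, gd b (√2 * v) * X w (σ / √2) 1 0 (q + σ * (u - v)) x := by
  have h2 : √(2:ℝ) ≠ 0 := by positivity
  have h1 : ∀ y, w y x * ph σ (b + 1) u (y + q) = 2 * √2 ^ b *
      ∫ v, gd b (√2 * v) * (w y x * ph (σ / √2) 1 0 (y + (q + σ * (u - v)))) := fun y => by
    have h3 : ∀ v, gd b (√2 * v) * (w y x * ph (σ / √2) 1 0 (y + (q + σ * (u - v)))) =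
        (w y x * (√2 / σ)) * (gd b (√2 * v) * gd 1 (√2 * ((y + q) / σ + u - v))) := fun v => by
      have h4 : (y + (q + σ * (u - v))) / (σ / √2) + 0 = √2 * ((y + q) / σ + u - v) := by
        field_simp; ring
      rw [ph, h4, inv_div]; ring
    simp only [h3]
    rw [integral_const_mul, ph, gd_conv]
    field_simp
  have hI : Integrable fun z : ℝ × ℝ => gd b (√2 * z.2) *
      (w z.1 x * ph (σ / √2) 1 0 (z.1 + (q + σ * (u - z.2)))) := by
    obtain ⟨C, hC0, hC⟩ := ph_bounded (σ / √2) 1 0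
    have h5 := hw.mul_prod ((integrable_gd b).comp_mul_left' h2)
    have h6 : AEStronglyMeasurable
        (fun z : ℝ × ℝ => ph (σ / √2) 1 0 (z.1 + (q + σ * (u - z.2)))) (volume.prod volume) := by
      have := continuous_ph (σ / √2) 1 0
      exact Continuous.aestronglyMeasurable (by fun_prop)
    refine (h5.mul_bdd (c := C) h6 (Filter.Eventually.of_forall fun z => hC _)).congr
      (Filter.Eventually.of_forall fun z => ?_)
    dsimp only
    ring
  rw [X]
  simp only [h1]
  rw [integral_const_mul, integral_integral_swap hI]
  simp only [integral_const_mul, X]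

lemma enorm_X_sq_le (b : ℕ) : ∃ C : ℝ≥0, ∀ {m : ℕ} {i : Fin m} {w : ℝ → (Rest i → ℝ) → ℝ}
    {x : Rest i → ℝ} (_ : Measurable (Function.uncurry w)) (_ : Integrable fun y => w y x) {σ : ℝ}
    (_ : σ ≠ 0) (u q : ℝ),
    ‖X w σ (b + 1) u q x‖ₑ ^ 2 ≤ C * ∫⁻ v, ‖gd b (√2 * v)‖ₑ *
      ‖X w (σ / √2) 1 0 (q + σ * (u - v)) x‖ₑ ^ 2 := by
  have h2 : √(2:ℝ) ≠ 0 := by positivity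
  have h0 : ∫⁻ v, ‖gd b (√2 * v)‖ₑ ≠ ⊤ := ((integrable_gd b).comp_mul_left' h2).2.ne
  refine ⟨(‖2 * √(2:ℝ) ^ b‖₊ ^ 2 * (∫⁻ v, ‖gd b (√2 * v)‖ₑ).toNNReal),
    fun {m i w x} hwm hw σ hσ u q => ?_⟩
  have h1 := continuous_gd b
  rw [X_eq_integral hw hσ, enorm_mul, mul_pow, ENNReal.coe_mul, ENNReal.coe_toNNReal h0,
    ENNReal.coe_pow, mul_assoc]
  refine mul_le_mul_right ?_ _
  refine (pow_le_pow_left' (enorm_integral_le_lintegral_enorm _) 2).trans ?_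
  simp only [enorm_mul]
  refine sq_lintegral_mul_le (Continuous.measurable (by fun_prop)).enorm.aemeasurable ?_
  exact (((measurable_X hwm (σ / √2) 1 0).comp (Measurable.prodMk (Continuous.measurable
    (by fun_prop)) measurable_const) : Measurable fun v => X w (σ / √2) 1 0 (q + σ * (u - v)) x)).enorm.aemeasurable

end

section

lemma prod_ph_le_tsum {ι : Type*} [Fintype ι] (β : ι → ℕ) :
    ∃ C : ℝ, 0 ≤ C ∧ ∀ (σ u c y : ι → ℝ) (U : ℝ), (∀ a, 0 < σ a) → 0 ≤ U →
      (∀ a, |u a - c a| ≤ U) →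
      ENNReal.ofReal (∏ a, |ph (σ a) (β a) (u a) (y a - σ a * c a)|) ≤
        ENNReal.ofReal (C * (1 + U) ^ (Fintype.card ι + 2)) *
        ∑' n : ℕ, ENNReal.ofReal ((4 ^ n)⁻¹) *
          ENNReal.ofReal (∏ a, ph (2 ^ n * σ a) 0 0 (y a)) := by
  obtain ⟨C, hC0, hC⟩ := prod_gd_le_tsum β (Fintype.card ι + 2)
  refine ⟨C, hC0, fun σ u c y U hσ hU hu => ?_⟩
  have h1 := hC (fun a => y a / σ a) (fun a => u a - c a) U hU hu
  have h2 : ∏ a, |ph (σ a) (β a) (u a) (y a - σ a * c a)| =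
      (∏ a, (σ a)⁻¹) * ∏ a, |gd (β a) (y a / σ a + (u a - c a))| := by
    rw [← Finset.prod_mul_distrib]
    refine Finset.prod_congr rfl fun a _ => ?_
    have h3 : (y a - σ a * c a) / σ a + u a = y a / σ a + (u a - c a) := by
      have := (hσ a).ne'
      field_simp; ring
    rw [ph, h3, abs_mul, abs_of_pos (inv_pos.2 (hσ a))]
  have h4 : 0 ≤ ∏ a, (σ a)⁻¹ := Finset.prod_nonneg fun a _ => (inv_pos.2 (hσ a)).le
  rw [h2, ENNReal.ofReal_mul h4]
  refine (mul_le_mul_right h1 _).trans (le_of_eq ?_)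
  rw [mul_left_comm, ← ENNReal.tsum_mul_left]
  congr 2
  funext n
  rw [← ENNReal.ofReal_mul h4, ← ENNReal.ofReal_mul (by positivity)]
  congr 1
  have h5 : ∏ a, ph (2 ^ n * σ a) 0 0 (y a) = (((2:ℝ) ^ n) ^ Fintype.card ι)⁻¹ *
      ((∏ a, (σ a)⁻¹) * ∏ a, gd 0 (y a / σ a / 2 ^ n)) := by
    rw [← Finset.card_univ, ← inv_pow, ← Finset.prod_const, ← Finset.prod_mul_distrib,
      ← Finset.prod_mul_distrib]
    refine Finset.prod_congr rfl fun a _ => ?_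
    rw [ph, mul_inv, add_zero, div_div, mul_comm (σ a)]
    ring
  rw [h5, pow_add, mul_inv, ← pow_mul (2:ℝ) n 2, mul_comm n 2, pow_mul]
  norm_num
  ring

end

section
variable {m : ℕ} {Δ α : ℝ} {S : Finset (Fin m)} {J : Matrix (Idx m) (Fin m) ℝ}
  {T : Set (ℤ × (Fin m → ℤ))} {Qt : ℤ × (Fin m → ℤ)} {d : Fin m → ℝ}
  {F : Corner m → (Fin m → ℝ) → ℝ}

lemma Adm.exists_direction (h : Adm Δ S J T Qt d F) (hΔ : 1 ≤ Δ) {i : Fin m} (hi : i ∉ S)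
    (s : Fin 2) : ∃ e : Fin m → ℝ, (J *ᵥ e) (sel (fun _ => s) i) = 1 ∧
      (∀ a, ix a ∈ S → (J *ᵥ e) a = 0) ∧ ∀ a, |(J *ᵥ e) a| ≤ m * (Δ * cInv m Δ) := by
  set j : Corner m := fun _ => s
  have hA : ∀ i', (J *ᵥ ((Amat J j)⁻¹ *ᵥ Pi.single i 1)) (sel j i') =
      (Pi.single i 1 : Fin m → ℝ) i' := fun i' => by
    have h1 : (J *ᵥ ((Amat J j)⁻¹ *ᵥ Pi.single i 1)) (sel j i') =
      (Amat J j *ᵥ ((Amat J j)⁻¹ *ᵥ Pi.single i 1)) i' := rfl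
    rw [h1, Matrix.mulVec_mulVec, Matrix.mul_nonsing_inv _ (h.isUnit j), Matrix.one_mulVec]
  refine ⟨(Amat J j)⁻¹ *ᵥ Pi.single i 1, ?_, ?_, ?_⟩
  · rw [hA, Pi.single_eq_same]
  · intro a ha
    have hai : ix a ≠ i := fun hh => hi (hh ▸ ha)
    have h2 := hA (ix a)
    rw [Pi.single_eq_of_ne hai] at h2
    have h3 : J a = J (sel j (ix a)) := by
      funext k
      have h4 := h.row (ix a) ha k
      rcases a with a | a <;> simp only [ix, Sum.elim_inl, Sum.elim_inr, sel, id] at h4 ⊢ <;>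
        split_ifs <;> first | rfl | exact h4 | exact h4.symm
    rw [← h2]
    simp only [Matrix.mulVec, h3]
  · intro a
    have hJ : ∀ k, |J a k| ≤ Δ := fun k => by
      have h1 : ∃ j' : Corner m, a = sel j' (ix a) := by
        rcases a with a | a
        · exact ⟨fun _ => 0, rfl⟩
        · exact ⟨fun _ => 1, rfl⟩
      obtain ⟨j', hj'⟩ := h1
      have h2 := (abs_entry_le_opNorm (Amat J j') (ix a) k).trans (h.reg j').1
      simpa [Amat, ← hj'] using h2
    rw [Matrix.mulVec, dotProduct]
    refine (Finset.abs_sum_le_sum_abs _ _).trans ?_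
    refine (Finset.sum_le_card_nsmul _ _ (Δ * cInv m Δ) fun k _ => ?_).trans (by simp)
    rw [abs_mul, Matrix.mulVec_single_one]
    exact mul_le_mul (hJ k) (abs_inv_entry_le hΔ (h.reg j) k i) (abs_nonneg _) (by linarith)

/-- The dilation parameters that arise after symmetrizing in direction `i`. -/
def dn (i : Fin m) (d : Fin m → ℝ) (n : ℕ) : Fin m → ℝ :=
  fun h => if h = i then d h / √2 else 2 ^ n * d h

lemma dd_dn_pair (i : Fin m) (d : Fin m → ℝ) (n : ℕ) (t : ℝ) {a : Idx m} (ha : ix a = i) :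
    dd (dn i d n) t a = dd d t a / √2 := by
  subst ha
  rcases a with a | a <;> simp [dd, dn, ix, mul_div_assoc]

lemma dd_dn_rest (i : Fin m) (d : Fin m → ℝ) (n : ℕ) (t : ℝ) (a : Rest i) :
    dd (dn i d n) t a.1 = 2 ^ n * dd d t a.1 := by
  obtain ⟨a, ha⟩ := a
  rcases a with a | a <;> simp only [ix, Sum.elim_inl, Sum.elim_inr, id] at ha <;>
    simp only [dd, dn, Sum.elim_inl, Sum.elim_inr, if_neg ha] <;> ring

lemma single_pair_rest (i : Fin m) (a : Rest i) :
    (Pi.single (Sum.inl i) 1 + Pi.single (Sum.inr i) 1 : Idx m → ℕ) a.1 = 0 := by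
  have h1 : a.1 ≠ Sum.inl i := fun h => a.2 (by rw [h]; rfl)
  have h2 : a.1 ≠ Sum.inr i := fun h => a.2 (by rw [h]; rfl)
  simp [Pi.single_eq_of_ne h1, Pi.single_eq_of_ne h2]

lemma JS_mulVec_rest (J : Matrix (Idx m) (Fin m) ℝ) (i : Fin m) (s : Fin 2) (a : Rest i)
    (p : Fin m → ℝ) : (JS J i s *ᵥ p) a.1 = (J *ᵥ p) a.1 := by
  simp only [Matrix.mulVec, dotProduct, JS, Matrix.of_apply, if_neg a.2]

lemma JS_mulVec_pair (J : Matrix (Idx m) (Fin m) ℝ) (i : Fin m) (s : Fin 2) {a : Idx m}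
    (ha : ix a = i) (p : Fin m → ℝ) :
    (JS J i s *ᵥ p) a = (J *ᵥ p) (sel (fun _ => s) i) := by
  simp only [Matrix.mulVec, dotProduct, JS, Matrix.of_apply, if_pos ha]

lemma Adm.symmetrize_dn (h : Adm Δ S J T Qt d F) {i : Fin m} (hi : i ∉ S) (s : Fin 2) (n : ℕ) :
    Adm Δ (insert i S) (JS J i s) T Qt (dn i d n) (fun j => F (Function.update j i s)) := by
  have h2 : (1:ℝ) ≤ 2 ^ n := one_le_pow₀ one_le_two
  have h3 : 1 ≤ √(2:ℝ) := by rw [Real.one_le_sqrt]; norm_num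
  refine h.symmetrize i s (fun a => ?_) (fun a ha b hb => ?_) (fun a ha b hb => ?_)
  · have := h.pos a
    unfold dn; split_ifs <;> positivity
  · rw [Finset.mem_insert, not_or] at hb
    have hab : d a ≤ d b := by
      rcases Finset.mem_insert.1 ha with rfl | ha
      · exact (h.eq _ hi _ hb.2).le
      · exact h.le a ha b hb.2
    unfold dn
    rw [if_neg hb.1]
    have ha0 := h.pos a
    split_ifs
    · refine (div_le_self ha0.le h3).trans ?_
      nlinarith
    · gcongr
  · rw [Finset.mem_insert, not_or] at ha hb
    unfold dn
    rw [if_neg ha.1, if_neg hb.1, h.eq _ ha.2 _ hb.2]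

end

section
variable {m : ℕ} {Δ α : ℝ} {S : Finset (Fin m)} {J : Matrix (Idx m) (Fin m) ℝ}
  {T : Set (ℤ × (Fin m → ℤ))} {Qt : ℤ × (Fin m → ℤ)} {d : Fin m → ℝ}
  {F : Corner m → (Fin m → ℝ) → ℝ}

lemma Adm.measurable_fk (h : Adm Δ S J T Qt d F) (k : ℤ) (j : Corner m) :
    Measurable (fk J T F k j) :=
  (h.cont j).measurable.indicator
    (measurableSet_mulVec_image (h.isUnit j) (measurableSet_Tkset T k))

lemma Adm.measurable_wprod (h : Adm Δ S J T Qt d F) (k : ℤ) (i : Fin m) (s : Fin 2) :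
    Measurable (Function.uncurry (wprod i (fk J T F k) s)) := by
  refine Finset.measurable_fun_prod _ fun j _ => ?_
  refine (h.measurable_fk k _).comp ((continuous_proj j).measurable.comp ?_)
  exact (glue i).measurable.comp
    ((measurable_fst.prodMk measurable_fst).prodMk measurable_snd)

lemma Adm.integrable_wprod (h : Adm Δ S J T Qt d F) (k : ℤ) (i : Fin m) (s : Fin 2)
    (x : Rest i → ℝ) : Integrable fun y => wprod i (fk J T F k) s y x := by
  have hb : ∀ j, ∃ C : ℝ, ∀ v, |fk J T F k j v| ≤ C := fun j => by
    obtain ⟨C, hC⟩ := (h.supp j).exists_bound_of_continuous (h.cont j)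
    refine ⟨C, fun v => ?_⟩
    unfold fk Set.indicator
    split_ifs
    · exact hC v
    · rw [abs_zero]; exact (norm_nonneg _).trans (hC v)
  choose C hC using hb
  obtain ⟨R, hR⟩ := (h.supp (Function.update (fun _ => 0) i s)).isBounded.exists_norm_le
  have hsupp : Function.support (fun y => wprod i (fk J T F k) s y x) ⊆ Set.Icc (-R) R := by
    intro y hy
    have h1 : fk J T F k (Function.update (fun _ => 0) i s)
        (proj (fun _ => 0) (glue i ((y, y), x))) ≠ 0 :=
      Finset.prod_ne_zero_iff.1 hy _ (by simp)
    have h2 : F (Function.update (fun _ => 0) i s)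
        (proj (fun _ => 0) (glue i ((y, y), x))) ≠ 0 := fun h0 => h1 (by
      unfold fk Set.indicator
      split_ifs
      · exact h0
      · rfl)
    have h3 := (norm_le_pi_norm _ i).trans (hR _ (subset_tsupport _ h2))
    have h4 : proj (fun _ => 0) (glue i ((y, y), x)) i = y := glue_inl i (y, y) x
    rw [h4, Real.norm_eq_abs] at h3
    exact abs_le.1 h3
  rw [← integrableOn_iff_integrable_of_support_subset hsupp]
  refine Measure.integrableOn_of_bounded (M := ∏ j ∈ Finset.univ.filter
    (fun j : Corner m => j i = 0), C (Function.update j i s)) (by simp) ?_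
    (Filter.Eventually.of_forall fun y => ?_)
  · exact ((h.measurable_wprod k i s).comp
      (measurable_id.prodMk measurable_const)).aestronglyMeasurable
  · rw [Real.norm_eq_abs, wprod, Finset.abs_prod]
    exact Finset.prod_le_prod (fun _ _ => abs_nonneg _) fun j _ => hC _ _

lemma G_symm_nonneg (i : Fin m) (J : Matrix (Idx m) (Fin m) ℝ) {σ : Idx m → ℝ}
    (hσ : ∀ a, 0 < σ a) (z : (Fin m → ℝ) × (Rest i → ℝ)) :
    0 ≤ G i J σ (Pi.single (Sum.inl i) 1 + Pi.single (Sum.inr i) 1) 0 z := by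
  refine Finset.prod_nonneg fun a _ => ?_
  rw [single_pair_rest, ph, gd_zero]
  have := hσ a.1
  positivity

lemma Adm.lintegral_G_mul_X_sq (h : Adm Δ S J T Qt d F) {i : Fin m} (hi : i ∉ S) (s : Fin 2)
    (n : ℕ) (k : ℤ) {t : ℝ} (ht : 0 < t) :
    ∫⁻ z, ENNReal.ofReal (G i (JS J i s) (dd (dn i d n) t)
        (Pi.single (Sum.inl i) 1 + Pi.single (Sum.inr i) 1) 0 z) *
      ‖X (wprod i (fk J T F k) s) (t * d i / √2) 1 0 ((J *ᵥ z.1) (sel (fun _ => s) i)) z.2‖ₑ ^ 2 =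
    ‖V (JS J i s) (Wk (JS J i s) T (fun j => F (Function.update j i s)) k) (dd (dn i d n) t)
      (Pi.single (Sum.inl i) 1 + Pi.single (Sum.inr i) 1) 0‖ₑ := by
  have h' := h.symmetrize_dn hi s n
  have h0 := h'.V_nonneg (Finset.mem_insert_self i S) k ht
  obtain ⟨h1, h2⟩ := V_split i (h'.isUnit fun _ => 0).ne_zero (h'.integrable_Wk k)
    (Wk_JS_glue J T F k i s) (fun a => (dd_pos h'.pos ht a).ne')
    (Pi.single (Sum.inl i) 1 + Pi.single (Sum.inr i) 1) 0
  rw [← ofReal_norm, Real.norm_of_nonneg h0, h2]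
  have e1 : dd (dn i d n) t (Sum.inl i) = t * d i / √2 := dd_dn_pair i d n t rfl
  have e2 : dd (dn i d n) t (Sum.inr i) = t * d i / √2 := dd_dn_pair i d n t rfl
  simp only [JS_mulVec_pair J i s (a := Sum.inl i) rfl, JS_mulVec_pair J i s (a := Sum.inr i) rfl,
    Pi.add_apply, Pi.single_eq_same, Pi.single_eq_of_ne (Sum.inl_ne_inr (a := i) (b := i)),
    Pi.single_eq_of_ne (Sum.inr_ne_inl (a := i) (b := i)), add_zero, zero_add, Pi.zero_apply,
    e1, e2] at h1 ⊢
  rw [ofReal_integral_eq_lintegral_ofReal h1 (Filter.Eventually.of_forall fun z =>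
    mul_nonneg (G_symm_nonneg i _ (dd_pos h'.pos ht) z) (mul_self_nonneg _))]
  refine lintegral_congr fun z => ?_
  rw [ENNReal.ofReal_mul (G_symm_nonneg i _ (dd_pos h'.pos ht) z), ← sq, ← sq_abs,
    ENNReal.ofReal_pow (abs_nonneg _), ← Real.norm_eq_abs, ofReal_norm]

end

section
variable {m : ℕ} {Δ α : ℝ} {S : Finset (Fin m)} {J : Matrix (Idx m) (Fin m) ℝ}
  {T : Set (ℤ × (Fin m → ℤ))} {Qt : ℤ × (Fin m → ℤ)} {d : Fin m → ℝ}
  {F : Corner m → (Fin m → ℝ) → ℝ}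

lemma measurable_G (i : Fin m) (J : Matrix (Idx m) (Fin m) ℝ) (σ : Idx m → ℝ) (β : Idx m → ℕ)
    (u : Idx m → ℝ) : Measurable (G i J σ β u) := by
  refine Finset.measurable_fun_prod _ fun a _ => ?_
  refine (continuous_ph _ _ _).measurable.comp ?_
  exact ((measurable_pi_apply a).comp measurable_snd).add
    ((measurable_pi_apply a.1).comp ((continuous_mulVec J).measurable.comp measurable_fst))

lemma measurable_X_mulVec {i : Fin m} {w : ℝ → (Rest i → ℝ) → ℝ}
    (hw : Measurable (Function.uncurry w)) (J : Matrix (Idx m) (Fin m) ℝ) (σ : ℝ) (b : ℕ) (u : ℝ)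
    (a : Idx m) : Measurable fun q : ((Fin m → ℝ) × (Rest i → ℝ)) × ℝ =>
      X w σ b u ((J *ᵥ q.1.1) a + q.2) q.1.2 := by
  refine (measurable_X hw σ b u).comp (Measurable.prodMk ?_
    (measurable_snd.comp measurable_fst))
  exact ((measurable_pi_apply a).comp ((continuous_mulVec J).measurable.comp
    (measurable_fst.comp measurable_fst))).add measurable_snd

lemma exists_G_shift_le (i : Fin m) (β : Idx m → ℕ) :
    ∃ C : ℝ, 0 ≤ C ∧ ∀ {Δ : ℝ} {S : Finset (Fin m)} {J : Matrix (Idx m) (Fin m) ℝ}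
      {T : Set (ℤ × (Fin m → ℤ))} {Qt : ℤ × (Fin m → ℤ)} {d : Fin m → ℝ}
      {F : Corner m → (Fin m → ℝ) → ℝ} (_ : Adm Δ S J T Qt d F) (_ : i ∉ S) (s : Fin 2)
      {u : Idx m → ℝ} {U κ r t : ℝ} (_ : 0 ≤ U) (_ : 0 ≤ κ) (_ : ∀ a, |u a| ≤ U) (_ : 0 < t)
      {e : Fin m → ℝ} (_ : ∀ a, ix a ∈ S → (J *ᵥ e) a = 0) (_ : ∀ a, |(J *ᵥ e) a| ≤ κ)
      (z : (Fin m → ℝ) × (Rest i → ℝ)),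
      ‖G i J (dd d t) β u (z - ((t * d i * r) • e, 0))‖ₑ ≤
        ENNReal.ofReal (C * (1 + (U + κ * |r|)) ^ (Fintype.card (Rest i) + 2)) *
        ∑' n : ℕ, ENNReal.ofReal ((4 ^ n)⁻¹) * ENNReal.ofReal (G i (JS J i s)
          (dd (dn i d n) t) (Pi.single (Sum.inl i) 1 + Pi.single (Sum.inr i) 1) 0 z) := by
  obtain ⟨C, hC0, hC⟩ := prod_ph_le_tsum (fun a : Rest i => β a.1)
  refine ⟨C, hC0, fun {Δ S J T Qt d F} h hi s u U κ r t hU hκ hu ht e he0 he z => ?_⟩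
  have hc : ∀ a : Rest i, dd d t a.1 * (r * (J *ᵥ e) a.1) = (t * d i * r) * (J *ᵥ e) a.1 := by
    intro a
    by_cases ha : ix a.1 ∈ S
    · rw [he0 _ ha]; ring
    · have h1 : dd d t a.1 = t * d i := by
        rw [← h.eq _ ha _ hi]
        rcases a with ⟨a | a, _⟩ <;> rfl
      rw [h1]; ring
  have h1 := hC (fun a => dd d t a.1) (fun a => u a.1) (fun a => r * (J *ᵥ e) a.1)
    (fun a => z.2 a + (J *ᵥ z.1) a.1) (U + κ * |r|) (fun a => dd_pos h.pos ht a.1)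
    (by positivity) (fun a => by
      refine (abs_sub _ _).trans (add_le_add (hu _) ?_)
      rw [abs_mul, mul_comm]
      gcongr
      exact he _)
  have h2 : ‖G i J (dd d t) β u (z - ((t * d i * r) • e, 0))‖ₑ =
      ENNReal.ofReal (∏ a : Rest i, |ph (dd d t a.1) (β a.1) (u a.1)
        (z.2 a + (J *ᵥ z.1) a.1 - dd d t a.1 * (r * (J *ᵥ e) a.1))|) := by
    rw [← ofReal_norm, Real.norm_eq_abs, G, Finset.abs_prod]
    congr 1
    refine Finset.prod_congr rfl fun a _ => ?_
    rw [hc]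
    simp only [Prod.fst_sub, Prod.snd_sub, Matrix.mulVec_sub, Matrix.mulVec_smul,
      Pi.sub_apply, Pi.smul_apply, smul_eq_mul, Pi.zero_apply, sub_zero, add_sub_assoc]
  rw [h2]
  refine h1.trans (le_of_eq ?_)
  congr 2
  funext n
  congr 2
  refine Finset.prod_congr rfl fun a _ => ?_
  rw [dd_dn_rest, single_pair_rest, JS_mulVec_rest]
  rfl

/-- The positive forms obtained by symmetrizing in direction `i`. -/
def Vsym (J : Matrix (Idx m) (Fin m) ℝ) (T : Set (ℤ × (Fin m → ℤ)))
    (F : Corner m → (Fin m → ℝ) → ℝ) (d : Fin m → ℝ) (i : Fin m) (s : Fin 2) (n : ℕ) (k : ℤ)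
    (t : ℝ) : ℝ≥0∞ :=
  ‖V (JS J i s) (Wk (JS J i s) T (fun j => F (Function.update j i s)) k) (dd (dn i d n) t)
    (Pi.single (Sum.inl i) 1 + Pi.single (Sum.inr i) 1) 0‖ₑ

lemma exists_lintegral_shift_le (Δ : ℝ) (hΔ : 1 ≤ Δ) (i : Fin m) (β : Idx m → ℕ) :
    ∃ C : ℝ, 0 ≤ C ∧ ∀ {S : Finset (Fin m)} {J : Matrix (Idx m) (Fin m) ℝ}
      {T : Set (ℤ × (Fin m → ℤ))} {Qt : ℤ × (Fin m → ℤ)} {d : Fin m → ℝ}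
      {F : Corner m → (Fin m → ℝ) → ℝ} (_ : Adm Δ S J T Qt d F) (_ : i ∉ S) (s : Fin 2)
      {u : Idx m → ℝ} {U r t : ℝ} (_ : 0 ≤ U) (_ : ∀ a, |u a| ≤ U) (_ : 0 < t) (k : ℤ),
      ∫⁻ z, ‖G i J (dd d t) β u z‖ₑ * ‖X (wprod i (fk J T F k) s) (t * d i / √2) 1 0
        ((J *ᵥ z.1) (sel (fun _ => s) i) + t * d i * r) z.2‖ₑ ^ 2 ≤
      ENNReal.ofReal (C * ((1 + U) * (1 + |r|)) ^ (Fintype.card (Rest i) + 2)) *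
        ∑' n : ℕ, ENNReal.ofReal ((4 ^ n)⁻¹) * Vsym J T F d i s n k t := by
  obtain ⟨C, hC0, hC⟩ := exists_G_shift_le i β
  set κ : ℝ := m * (Δ * cInv m Δ) with hκd
  have hκ : 0 ≤ κ := by
    have h0 : 0 ≤ Δ := by linarith
    rw [hκd, cInv]
    positivity
  refine ⟨C * (1 + κ) ^ (Fintype.card (Rest i) + 2), by positivity,
    fun {S J T Qt d F} h hi s u U r t hU hu ht k => ?_⟩
  obtain ⟨e, he1, he0, he⟩ := h.exists_direction hΔ hi s
  have hX := measurable_X_mulVec (h.measurable_wprod k i s) J (t * d i / √2) 1 0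
    (sel (fun _ => s) i)
  have hX' : Measurable fun z : (Fin m → ℝ) × (Rest i → ℝ) =>
      X (wprod i (fk J T F k) s) (t * d i / √2) 1 0 ((J *ᵥ z.1) (sel (fun _ => s) i)) z.2 := by
    have h1 := hX.comp (measurable_id.prodMk (measurable_const (a := (0:ℝ))))
    simpa only [Function.comp_def, id, add_zero] using h1
  have : (volume : Measure ((Fin m → ℝ) × (Rest i → ℝ))).IsAddRightInvariant :=
    inferInstanceAs (Measure.IsAddRightInvariant ((volume : Measure (Fin m → ℝ)).prod
      (volume : Measure (Rest i → ℝ))))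
  rw [← lintegral_sub_right_eq_self _ (((t * d i * r) • e, 0) : (Fin m → ℝ) × (Rest i → ℝ))]
  have hs : ∀ z : (Fin m → ℝ) × (Rest i → ℝ),
      (J *ᵥ (z - ((t * d i * r) • e, 0)).1) (sel (fun _ => s) i) + t * d i * r =
        (J *ᵥ z.1) (sel (fun _ => s) i) := fun z => by
    simp only [Prod.fst_sub, Matrix.mulVec_sub, Matrix.mulVec_smul, Pi.sub_apply, Pi.smul_apply,
      smul_eq_mul, he1]
    ring
  simp only [hs, Prod.snd_sub, sub_zero]
  refine (lintegral_mono fun z => mul_le_mul_left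
    (hC h hi s hU hκ hu ht he0 he z (r := r)) _).trans ?_
  simp only [mul_assoc, ← ENNReal.tsum_mul_right]
  have hm : ∀ n, Measurable fun z => ENNReal.ofReal (G i (JS J i s)
      (dd (dn i d n) t) (Pi.single (Sum.inl i) 1 + Pi.single (Sum.inr i) 1) 0 z) *
      ‖X (wprod i (fk J T F k) s) (t * d i / √2) 1 0
        ((J *ᵥ z.1) (sel (fun _ => s) i)) z.2‖ₑ ^ 2 := fun n =>
    (measurable_G _ _ _ _ _).ennreal_ofReal.mul (hX'.enorm.pow_const 2)
  rw [lintegral_const_mul _ (Measurable.tsum fun n => (hm n).const_mul _),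
    lintegral_tsum fun n => ((hm n).const_mul _).aemeasurable]
  refine mul_le_mul' (ENNReal.ofReal_le_ofReal ?_) (ENNReal.tsum_le_tsum fun n => ?_)
  · rw [← mul_assoc, mul_assoc C, ← mul_pow]
    gcongr
    nlinarith [abs_nonneg r, mul_nonneg hU (abs_nonneg r), mul_nonneg hκ (abs_nonneg r),
      mul_nonneg hκ hU, mul_nonneg hκ (mul_nonneg hU (abs_nonneg r))]
  · rw [lintegral_const_mul _ (hm n), h.lintegral_G_mul_X_sq hi s n k ht, Vsym]

end

section
variable {m : ℕ}

lemma lintegral_gd_mul_pow_ne_top (b κ : ℕ) :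
    ∫⁻ v, ‖gd b (√2 * v)‖ₑ * ENNReal.ofReal ((1 + |v|) ^ κ) ≠ ⊤ := by
  have h2 : √(2:ℝ) ≠ 0 := by positivity
  have h3 : 1 ≤ √(2:ℝ) := by rw [Real.one_le_sqrt]; norm_num
  have h1 := ((integrable_gd_mul_pow b κ).comp_mul_left' h2).2
  refine ne_top_of_le_ne_top h1.ne (lintegral_mono fun v => ?_)
  dsimp only
  rw [← ofReal_norm, ← ENNReal.ofReal_mul (norm_nonneg _), ← ofReal_norm, norm_mul,
    Real.norm_eq_abs |_|, abs_abs, Real.norm_eq_abs, Real.norm_of_nonneg (by positivity)]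
  refine ENNReal.ofReal_le_ofReal ?_
  have h4 : |v| ≤ |√2 * v| := by
    rw [abs_mul, abs_of_pos (by positivity : 0 < √(2:ℝ))]
    nlinarith [abs_nonneg v]
  gcongr _ * (1 + ?_) ^ κ

lemma exists_lintegral_X_sq_le (Δ : ℝ) (hΔ : 1 ≤ Δ) (i : Fin m) (β : Idx m → ℕ) (b : ℕ) :
    ∃ C : ℝ≥0, ∀ {S : Finset (Fin m)} {J : Matrix (Idx m) (Fin m) ℝ}
      {T : Set (ℤ × (Fin m → ℤ))} {Qt : ℤ × (Fin m → ℤ)} {d : Fin m → ℝ}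
      {F : Corner m → (Fin m → ℝ) → ℝ} (_ : Adm Δ S J T Qt d F) (_ : i ∉ S) (s : Fin 2)
      {u : Idx m → ℝ} {U t : ℝ} (_ : 0 ≤ U) (_ : ∀ a, |u a| ≤ U) (_ : 0 < t) (k : ℤ),
      ∫⁻ z, ‖G i J (dd d t) β u z‖ₑ * ‖X (wprod i (fk J T F k) s) (t * d i) (b + 1)
        (u (sel (fun _ => s) i)) ((J *ᵥ z.1) (sel (fun _ => s) i)) z.2‖ₑ ^ 2 ≤
      C * ENNReal.ofReal ((1 + U) ^ (2 * (Fintype.card (Rest i) + 2))) *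
        ∑' n : ℕ, ENNReal.ofReal ((4 ^ n)⁻¹) * Vsym J T F d i s n k t := by
  set κ := Fintype.card (Rest i) + 2
  obtain ⟨C, hC0, hC⟩ := exists_lintegral_shift_le Δ hΔ i β
  obtain ⟨C', hC'⟩ := enorm_X_sq_le b
  have hI := lintegral_gd_mul_pow_ne_top b κ
  set I := ∫⁻ v, ‖gd b (√2 * v)‖ₑ * ENNReal.ofReal ((1 + |v|) ^ κ)
  refine ⟨C' * (C.toNNReal * I.toNNReal),
    fun {S J T Qt d F} h hi s u U t hU hu ht k => ?_⟩
  set Sn := ∑' n : ℕ, ENNReal.ofReal ((4 ^ n)⁻¹) * Vsym J T F d i s n k t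
  set a := sel (fun _ => s) i
  set w := wprod i (fk J T F k) s
  have hw := h.measurable_wprod k i s
  have hσ : t * d i ≠ 0 := (mul_pos ht (h.pos i)).ne'
  have hg := continuous_gd b
  have hX : Measurable fun q : ((Fin m → ℝ) × (Rest i → ℝ)) × ℝ =>
      X w (t * d i / √2) 1 0 ((J *ᵥ q.1.1) a + t * d i * (u a - q.2)) q.1.2 :=
    (measurable_X_mulVec hw J (t * d i / √2) 1 0 a).comp
      (measurable_fst.prodMk ((measurable_const.sub measurable_snd).const_mul _))
  calc _ ≤ ∫⁻ z, ‖G i J (dd d t) β u z‖ₑ * (C' * ∫⁻ v, ‖gd b (√2 * v)‖ₑ *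
        ‖X w (t * d i / √2) 1 0 ((J *ᵥ z.1) a + t * d i * (u a - v)) z.2‖ₑ ^ 2) :=
        lintegral_mono fun z => mul_le_mul_right
          (hC' hw (h.integrable_wprod k i s z.2) hσ (u a) ((J *ᵥ z.1) a)) _
    _ = C' * ∫⁻ z, ∫⁻ v, ‖gd b (√2 * v)‖ₑ * (‖G i J (dd d t) β u z‖ₑ *
        ‖X w (t * d i / √2) 1 0 ((J *ᵥ z.1) a + t * d i * (u a - v)) z.2‖ₑ ^ 2) := by
        rw [← lintegral_const_mul' _ _ ENNReal.coe_ne_top]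
        refine lintegral_congr fun z => ?_
        rw [mul_left_comm]
        congr 1
        rw [← lintegral_const_mul' _ _ enorm_ne_top]
        exact lintegral_congr fun v => mul_left_comm _ _ _
    _ = C' * ∫⁻ v, ∫⁻ z, ‖gd b (√2 * v)‖ₑ * (‖G i J (dd d t) β u z‖ₑ *
        ‖X w (t * d i / √2) 1 0 ((J *ᵥ z.1) a + t * d i * (u a - v)) z.2‖ₑ ^ 2) := by
        rw [lintegral_lintegral_swap]
        have h1 : Measurable fun q : ((Fin m → ℝ) × (Rest i → ℝ)) × ℝ => ‖gd b (√2 * q.2)‖ₑ :=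
          (Continuous.measurable (by fun_prop)).enorm
        have h2 : Measurable fun q : ((Fin m → ℝ) × (Rest i → ℝ)) × ℝ =>
            ‖G i J (dd d t) β u q.1‖ₑ := ((measurable_G i J (dd d t) β u).comp measurable_fst).enorm
        exact (h1.mul (h2.mul (hX.enorm.pow_const 2))).aemeasurable
    _ ≤ C' * ∫⁻ v, ‖gd b (√2 * v)‖ₑ * ENNReal.ofReal ((1 + |v|) ^ κ) *
        (ENNReal.ofReal C * ENNReal.ofReal ((1 + U) ^ (2 * κ)) * Sn) := by
        refine mul_le_mul_right (lintegral_mono fun v => ?_) _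
        rw [lintegral_const_mul' _ _ enorm_ne_top, mul_assoc ‖gd b (√2 * v)‖ₑ]
        refine mul_le_mul_right ((hC h hi s hU hu ht k (r := u a - v)).trans ?_) _
        rw [← mul_assoc]
        refine mul_le_mul_left ?_ _
        rw [← ENNReal.ofReal_mul hC0, ← ENNReal.ofReal_mul (by positivity)]
        refine ENNReal.ofReal_le_ofReal ?_
        have h1 : (1 + U) * (1 + |u a - v|) ≤ (1 + U) ^ 2 * (1 + |v|) := by
          have h2 := abs_sub (u a) v
          have h3 : 1 + |u a - v| ≤ (1 + U) * (1 + |v|) := by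
            nlinarith [hu a, mul_nonneg hU (abs_nonneg v)]
          rw [sq, mul_assoc]
          gcongr
        calc C * ((1 + U) * (1 + |u a - v|)) ^ κ ≤ C * ((1 + U) ^ 2 * (1 + |v|)) ^ κ := by gcongr
          _ = _ := by rw [mul_pow, ← pow_mul]; ring
    _ = C' * (I * (ENNReal.ofReal C * ENNReal.ofReal ((1 + U) ^ (2 * κ)) * Sn)) := by
        rw [lintegral_mul_const]
        refine Measurable.mul (Continuous.measurable (by fun_prop)).enorm ?_
        exact (Continuous.measurable (by fun_prop)).ennreal_ofReal
    _ = _ := by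
        push_cast
        rw [ENNReal.coe_toNNReal hI]
        change C' * (I * (ENNReal.ofReal C * _ * Sn)) = C' * (ENNReal.ofReal C * I) * _ * Sn
        ring

end

section
variable {m : ℕ}

lemma volume_dC (Q : ℤ × (Fin m → ℤ)) : volume (dC Q) = ENNReal.ofReal (((2:ℝ) ^ Q.1) ^ m) := by
  have h1 : dC Q = Set.pi Set.univ fun i => Set.Ico ((2:ℝ)^Q.1 * (Q.2 i : ℝ))
      ((2:ℝ)^Q.1 * ((Q.2 i : ℝ) + 1)) := by
    ext x; simp [dC]
  have h2 : ∀ i, (2:ℝ)^Q.1 * ((Q.2 i : ℝ) + 1) - (2:ℝ)^Q.1 * (Q.2 i : ℝ) = 2 ^ Q.1 :=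
    fun i => by ring
  rw [h1, Real.volume_pi_Ico]
  simp only [h2, Finset.prod_const, Finset.card_univ, Fintype.card_fin]
  rw [ENNReal.ofReal_pow (by positivity)]

lemma ecc_nonneg {a b : Fin m → ℝ} (hab : ∀ i, a i < b i) : 0 ≤ ecc a b :=
  div_nonneg (Real.iInf_nonneg fun i => (sub_pos.2 (hab i)).le)
    (Real.iSup_nonneg fun i => (sub_pos.2 (hab i)).le)

lemma ecc_le_one {a b : Fin m → ℝ} (hab : ∀ i, a i < b i) : ecc a b ≤ 1 := by
  refine div_le_one_of_le₀ ?_ (Real.iSup_nonneg fun i => (sub_pos.2 (hab i)).le)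
  rcases isEmpty_or_nonempty (Fin m) with h | h
  · simp [Real.iInf_of_isEmpty, Real.iSup_of_isEmpty]
  · exact ciInf_le_ciSup (Set.finite_range _).bddBelow (Set.finite_range _).bddAbove

lemma two_pow_mul_two_zpow (hm : 1 ≤ m) :
    ((2 ^ (m - 1) : ℕ) : ℝ) * (2:ℝ) ^ ((1:ℤ) - (m:ℤ)) = 1 := by
  have h1 : (1:ℤ) - m = -((m - 1 : ℕ) : ℤ) := by omega
  rw [h1, _root_.zpow_neg, zpow_natCast]
  push_cast
  exact mul_inv_cancel₀ (by positivity)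

lemma avg_le {F : (Fin m → ℝ) → ℝ} {E : Set (Fin m → ℝ)} {C : ℝ} (hm : 1 ≤ m) (hC : ∀ x, |F x| ≤ C)
    (hE : volume E ≠ ⊤) : avg E F ≤ C := by
  have hC0 : 0 ≤ C := (abs_nonneg _).trans (hC 0)
  have h1 : ∫ x in E, |F x| ^ (2^(m-1) : ℕ) ≤ C ^ (2^(m-1) : ℕ) * (volume E).toReal := by
    have h0 := norm_setIntegral_le_of_norm_le_const (μ := (volume : Measure (Fin m → ℝ)))
      (f := fun x => |F x| ^ (2^(m-1) : ℕ)) (C := C ^ (2^(m-1) : ℕ)) hE.lt_top fun x _ => by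
        rw [norm_pow, Real.norm_eq_abs, abs_abs]
        exact pow_le_pow_left₀ (abs_nonneg _) (hC x) _
    exact (le_abs_self _).trans h0
  have h2 : ((volume E).toReal)⁻¹ * ∫ x in E, |F x| ^ (2^(m-1) : ℕ) ≤ C ^ (2^(m-1) : ℕ) := by
    rcases (ENNReal.toReal_nonneg (a := volume E)).eq_or_lt with h0 | h0
    · rw [← h0, _root_.inv_zero, zero_mul]; positivity
    · rw [inv_mul_le_iff₀ h0, mul_comm]; exact h1
  have h3 : 0 ≤ ((volume E).toReal)⁻¹ * ∫ x in E, |F x| ^ (2^(m-1) : ℕ) :=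
    mul_nonneg (inv_nonneg.2 ENNReal.toReal_nonneg) (integral_nonneg fun x => by positivity)
  refine (Real.rpow_le_rpow h3 h2 (by positivity)).trans (le_of_eq ?_)
  rw [← Real.rpow_natCast, ← Real.rpow_mul hC0, two_pow_mul_two_zpow hm, Real.rpow_one]

lemma volume_box_ne_top (a b : Fin m → ℝ) : volume (box a b) ≠ ⊤ := by
  have h1 : box a b = Set.Icc a b := by
    ext x; simp [box, Pi.le_def, forall_and]
  rw [h1]
  exact measure_Icc_lt_top.ne

lemma MalTree_ne_top {F : (Fin m → ℝ) → ℝ} (hm : 1 ≤ m) {α : ℝ} (hα : 0 ≤ α) (hF : Continuous F)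
    (hs : HasCompactSupport F) (A : Matrix (Fin m) (Fin m) ℝ) (T : Set (ℤ × (Fin m → ℤ))) :
    MalTree α F A T ≠ ⊤ := by
  obtain ⟨C, hC⟩ := hs.exists_bound_of_continuous hF
  have hC0 : 0 ≤ C := (norm_nonneg _).trans (hC 0)
  refine ne_top_of_le_ne_top (ENNReal.ofReal_ne_top (r := C)) ?_
  refine iSup₂_le fun Q _ => iSup₂_le fun a b => iSup₂_le fun hab _ => ?_
  refine ENNReal.ofReal_le_ofReal ?_
  have h1 : (ecc a b ^ α) ^ ((2:ℝ) ^ ((1:ℤ) - (m:ℤ))) ≤ 1 :=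
    Real.rpow_le_one (Real.rpow_nonneg (ecc_nonneg hab) _)
      (Real.rpow_le_one (ecc_nonneg hab) (ecc_le_one hab) hα) (by positivity)
  have h2 := avg_le hm hC (volume_box_ne_top a b)
  calc _ ≤ (ecc a b ^ α) ^ ((2:ℝ) ^ ((1:ℤ) - (m:ℤ))) * C := by
        gcongr
        exact Real.rpow_nonneg (Real.rpow_nonneg (ecc_nonneg hab) _) _
    _ ≤ 1 * C := by gcongr
    _ = C := one_mul C

lemma le_of_forall_scaled {x K a b : ℝ≥0∞} (hK : K ≠ ⊤) (ha : a ≠ ⊤) (hb : b ≠ ⊤)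
    (h : ∀ c : ℝ≥0, c ≠ 0 → x ≤ K * (c * a ^ 2 + (c⁻¹ : ℝ≥0) * b ^ 2)) : x ≤ K * (2 * (a * b)) := by
  lift a to ℝ≥0 using ha
  lift b to ℝ≥0 using hb
  have h1 : ∀ ε : ℝ≥0, ε ≠ 0 → x ≤ K * ((2 * ((a + ε) * (b + ε)) : ℝ≥0) : ℝ≥0∞) := fun ε hε => by
    have hae : a + ε ≠ 0 := by simp [hε]
    have hbe : b + ε ≠ 0 := by simp [hε]
    refine (h ((b + ε) / (a + ε)) (div_ne_zero hbe hae)).trans (mul_le_mul_right ?_ _)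
    norm_cast
    rw [inv_div]
    have e1 : (b + ε) / (a + ε) * a ^ 2 ≤ (a + ε) * (b + ε) := by
      calc _ ≤ (b + ε) / (a + ε) * (a + ε) ^ 2 := by gcongr; exact le_self_add
        _ = _ := by field_simp
    have e2 : (a + ε) / (b + ε) * b ^ 2 ≤ (a + ε) * (b + ε) := by
      calc _ ≤ (a + ε) / (b + ε) * (b + ε) ^ 2 := by gcongr; exact le_self_add
        _ = _ := by field_simp
    rw [two_mul]
    exact add_le_add e1 e2
  have h2 : Filter.Tendsto (fun ε : ℝ≥0 => K * ((2 * ((a + ε) * (b + ε)) : ℝ≥0) : ℝ≥0∞))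
      (nhdsWithin 0 {0}ᶜ) (nhds (K * ((2 * ((a + 0) * (b + 0)) : ℝ≥0) : ℝ≥0∞))) := by
    refine ENNReal.Tendsto.const_mul ?_ (Or.inr hK)
    rw [ENNReal.tendsto_coe]
    exact (Continuous.tendsto (by fun_prop) 0).mono_left nhdsWithin_le_nhds
  have h3 := ge_of_tendsto h2 (eventually_mem_nhdsWithin.mono fun ε hε => h1 ε hε)
  simpa using h3

lemma mul_le_scaled_sq (c : ℝ≥0) (hc : c ≠ 0) (a b : ℝ≥0∞) :
    a * b ≤ c * a ^ 2 + (c⁻¹ : ℝ≥0) * b ^ 2 := by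
  have hc' : (c : ℝ≥0∞) ≠ 0 := by simpa using hc
  rcases le_total (c * a) b with h | h
  · refine le_trans ?_ le_add_self
    have h1 : a ≤ (c⁻¹ : ℝ≥0) * b := by
      rw [ENNReal.coe_inv hc]
      calc a = (c:ℝ≥0∞)⁻¹ * (c * a) := by
            rw [← mul_assoc, ENNReal.inv_mul_cancel hc' ENNReal.coe_ne_top, one_mul]
        _ ≤ _ := by gcongr
    calc a * b ≤ (c⁻¹ : ℝ≥0) * b * b := by gcongr
      _ = _ := by ring
  · refine le_trans ?_ le_self_add
    calc a * b ≤ a * (c * a) := by gcongr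
      _ = _ := by ring

lemma Pd_dn_le {α : ℝ} (hα : 0 ≤ α) (i : Fin m) {d : Fin m → ℝ} (hd : ∀ h, 0 < d h) (n : ℕ) :
    Pd α (dn i d n) ≤ ((√2 * 2 ^ n) ^ (2 * α)) ^ m * (2 ^ m * Pd α d) := by
  have h3 : 1 ≤ √(2:ℝ) := by rw [Real.one_le_sqrt]; norm_num
  have h20 : 0 < √(2:ℝ) := by positivity
  have h4 : (1:ℝ) ≤ 2 ^ n := one_le_pow₀ one_le_two
  have h5 : (1:ℝ) ≤ √2 * 2 ^ n := one_le_mul_of_one_le_of_one_le h3 h4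
  have h1 : dn i d n = fun h => (if h = i then 1 else √2 * 2 ^ n) * (d h / √2) := by
    funext h
    unfold dn
    split_ifs
    · rw [one_mul]
    · field_simp
  rw [h1]
  refine (Pd_scale_le hα (fun h => div_pos (hd h) h20) (c := fun h => if h = i then 1 else √2 * 2 ^ n)
    (s := √2 * 2 ^ n) (fun h => by split_ifs <;> simp [h5])
    (fun h => by split_ifs <;> simp [h5])).trans ?_
  gcongr
  unfold Pd
  have h6 : (2:ℝ) ^ m = ∏ _h : Fin m, (2:ℝ) := by simp
  rw [h6, ← Finset.prod_mul_distrib]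
  refine Finset.prod_le_prod (fun h _ => ?_) fun h _ => ?_
  · have := div_pos (hd h) h20
    positivity
  · have hh := hd h
    have e1 : (d h / √2) ^ (2 * α) ≤ d h ^ (2 * α) :=
      Real.rpow_le_rpow (by positivity) (div_le_self hh.le h3) (by positivity)
    have e2 : (d h / √2) ^ (-2 : ℝ) = 2 * d h ^ (-2 : ℝ) := by
      rw [Real.div_rpow hh.le h20.le, Real.rpow_neg h20.le, Real.rpow_two, Real.sq_sqrt zero_le_two]
      field_simp
    rw [e2]
    have e3 := le_max_left (d h ^ (2 * α)) (d h ^ (-2 : ℝ))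
    have e4 := le_max_right (d h ^ (2 * α)) (d h ^ (-2 : ℝ))
    have e5 : 0 < d h ^ (-2 : ℝ) := by positivity
    refine max_le ?_ ?_ <;> linarith

end

section
variable {m : ℕ} {Δ α : ℝ} {S : Finset (Fin m)} {J : Matrix (Idx m) (Fin m) ℝ}
  {T : Set (ℤ × (Fin m → ℤ))} {Qt : ℤ × (Fin m → ℤ)} {d : Fin m → ℝ}
  {F : Corner m → (Fin m → ℝ) → ℝ}

/-- The weighted sum of the symmetrised forms. -/
def Msum (J : Matrix (Idx m) (Fin m) ℝ) (T : Set (ℤ × (Fin m → ℤ)))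
    (F : Corner m → (Fin m → ℝ) → ℝ) (d : Fin m → ℝ) (i : Fin m) (s : Fin 2) (k : ℤ)
    (t : ℝ) : ℝ≥0∞ :=
  ∑' n : ℕ, ENNReal.ofReal ((4 ^ n)⁻¹) * Vsym J T F d i s n k t

lemma lintegral_mul_mul_le_scaled {Ω : Type*} [MeasurableSpace Ω] {μ : Measure Ω}
    {g x y : Ω → ℝ≥0∞} (hg : Measurable g) (hx : Measurable x) (hy : Measurable y) {c : ℝ≥0}
    (hc : c ≠ 0) : ∫⁻ z, g z * (x z * y z) ∂μ ≤
      c * (∫⁻ z, g z * x z ^ 2 ∂μ) + (c⁻¹ : ℝ≥0) * ∫⁻ z, g z * y z ^ 2 ∂μ := by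
  rw [← lintegral_const_mul _ (by fun_prop), ← lintegral_const_mul _ (by fun_prop),
    ← lintegral_add_left (by fun_prop)]
  refine lintegral_mono fun z => ?_
  calc _ ≤ g z * (c * x z ^ 2 + (c⁻¹ : ℝ≥0) * y z ^ 2) :=
        mul_le_mul_right (mul_le_scaled_sq c hc _ _) _
    _ = _ := by ring

lemma lintegral_linear_comb {Ω : Type*} [MeasurableSpace Ω] {μ : Measure Ω} {f g : Ω → ℝ≥0∞}
    (hf : Measurable f) (hg : Measurable g) (K a b : ℝ≥0∞) :
    ∫⁻ z, K * (a * f z + b * g z) ∂μ = K * (a * ∫⁻ z, f z ∂μ + b * ∫⁻ z, g z ∂μ) := by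
  rw [lintegral_const_mul _ (by fun_prop), lintegral_add_left (by fun_prop),
    lintegral_const_mul _ hf, lintegral_const_mul _ hg]

lemma Adm.measurable_X (h : Adm Δ S J T Qt d F) (k : ℤ) (i : Fin m) (s : Fin 2) (σ : ℝ) (b : ℕ)
    (u : ℝ) (a : Idx m) : Measurable fun z : (Fin m → ℝ) × (Rest i → ℝ) =>
      ‖X (wprod i (fk J T F k) s) σ b u ((J *ᵥ z.1) a) z.2‖ₑ := by
  have h1 := (measurable_X_mulVec (h.measurable_wprod k i s) J σ b u a).comp
    (measurable_id.prodMk (measurable_const (a := (0:ℝ))))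
  simpa [Function.comp_def] using h1.enorm

lemma exists_enorm_V_le_Msum (Δ : ℝ) (hΔ : 1 ≤ Δ) (i : Fin m) (β : Idx m → ℕ)
    (h0 : β (Sum.inl i) ≠ 0) (h1 : β (Sum.inr i) ≠ 0) :
    ∃ C : ℝ≥0, ∀ {S : Finset (Fin m)} {J : Matrix (Idx m) (Fin m) ℝ}
      {T : Set (ℤ × (Fin m → ℤ))} {Qt : ℤ × (Fin m → ℤ)} {d : Fin m → ℝ}
      {F : Corner m → (Fin m → ℝ) → ℝ} (_ : Adm Δ S J T Qt d F) (_ : i ∉ S)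
      {u : Idx m → ℝ} {U t : ℝ} (_ : 0 ≤ U) (_ : ∀ a, |u a| ≤ U) (_ : 0 < t) (k : ℤ) {c : ℝ≥0}
      (_ : c ≠ 0),
      ‖V J (Wk J T F k) (dd d t) β u‖ₑ ≤
      C * ENNReal.ofReal ((1 + U) ^ (2 * (Fintype.card (Rest i) + 2))) *
        (c * Msum J T F d i 0 k t + (c⁻¹ : ℝ≥0) * Msum J T F d i 1 k t) := by
  obtain ⟨b0, hb0⟩ := Nat.exists_eq_succ_of_ne_zero h0
  obtain ⟨b1, hb1⟩ := Nat.exists_eq_succ_of_ne_zero h1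
  obtain ⟨C0, hC0⟩ := exists_lintegral_X_sq_le Δ hΔ i β b0
  obtain ⟨C1, hC1⟩ := exists_lintegral_X_sq_le Δ hΔ i β b1
  refine ⟨C0 + C1, fun {S J T Qt d F} h hi {u U t} hU hu ht k {c} hc => ?_⟩
  obtain ⟨-, hV⟩ := V_split i (h.isUnit 0).ne_zero (h.integrable_Wk k) (Wk_glue J T F k i)
    (fun a => (dd_pos h.pos ht a).ne') β u
  have e0 := hC0 h hi 0 hU hu ht k
  have e1 := hC1 h hi 1 hU hu ht k
  rw [sel_zero] at e0
  rw [sel_one] at e1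
  rw [hV]
  refine (enorm_integral_le_lintegral_enorm _).trans ?_
  simp only [enorm_mul]
  have d0 : dd d t (Sum.inl i) = t * d i := by simp [dd]
  have d1 : dd d t (Sum.inr i) = t * d i := by simp [dd]
  rw [d0, d1, hb0, hb1]
  refine (lintegral_mul_mul_le_scaled (measurable_G i J _ β u).enorm (h.measurable_X k i 0 _ _ _ _)
    (h.measurable_X k i 1 _ _ _ _) hc).trans ?_
  set E := ENNReal.ofReal ((1 + U) ^ (2 * (Fintype.card (Rest i) + 2)))
  calc _ ≤ c * (C0 * E * Msum J T F d i 0 k t) + (c⁻¹ : ℝ≥0) * (C1 * E * Msum J T F d i 1 k t) :=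
        add_le_add (mul_le_mul_right e0 _) (mul_le_mul_right e1 _)
    _ ≤ c * ((C0 + C1) * E * Msum J T F d i 0 k t) +
        (c⁻¹ : ℝ≥0) * ((C0 + C1) * E * Msum J T F d i 1 k t) := by
      gcongr
      · exact le_self_add
      · exact le_add_self
    _ = _ := by push_cast; ring

lemma Adm.measurable_Vsym (h : Adm Δ S J T Qt d F) {i : Fin m} (hi : i ∉ S) (s : Fin 2) (n : ℕ)
    (k : ℤ) : Measurable (fun t => Vsym J T F d i s n k t * ENNReal.ofReal t⁻¹) :=
  (h.symmetrize_dn hi s n).measurable_V k _ _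

lemma Adm.measurable_Msum (h : Adm Δ S J T Qt d F) {i : Fin m} (hi : i ∉ S) (s : Fin 2)
    (k : ℤ) : Measurable (fun t => Msum J T F d i s k t * ENNReal.ofReal t⁻¹) := by
  unfold Msum
  simp only [← ENNReal.tsum_mul_right, mul_assoc]
  exact Measurable.tsum fun n => measurable_const.mul (h.measurable_Vsym hi s n k)

lemma Adm.tsum_lintegral_Msum (h : Adm Δ S J T Qt d F) {i : Fin m} (hi : i ∉ S) (s : Fin 2) :
    ∑' k : ℤ, ∫⁻ t in Set.Ioc ((2:ℝ)^(k-1)) ((2:ℝ)^k),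
      Msum J T F d i s k t * ENNReal.ofReal t⁻¹ =
    ∑' n : ℕ, ENNReal.ofReal ((4 ^ n)⁻¹) * N (JS J i s) T (fun j => F (Function.update j i s))
      (dn i d n) (Pi.single (Sum.inl i) 1 + Pi.single (Sum.inr i) 1) 0 := by
  unfold Msum N
  simp only [← ENNReal.tsum_mul_right, mul_assoc, ← ENNReal.tsum_mul_left]
  rw [ENNReal.tsum_comm]
  congr 1; funext k
  refine (lintegral_tsum fun n =>
    (measurable_const.mul (h.measurable_Vsym hi s n k)).aemeasurable).trans ?_
  congr 1; funext n
  exact lintegral_const_mul _ (h.measurable_Vsym hi s n k)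

lemma rhs_symmetrize (α : ℝ) (J : Matrix (Idx m) (Fin m) ℝ) (T : Set (ℤ × (Fin m → ℤ)))
    (Qt : ℤ × (Fin m → ℤ)) (d : Fin m → ℝ) (F : Corner m → (Fin m → ℝ) → ℝ) (i : Fin m)
    (s : Fin 2) :
    rhs α (JS J i s) T Qt d (fun j => F (Function.update j i s)) =
      ENNReal.ofReal (Pd α d) * volume (dC Qt) *
        (∏ j ∈ Finset.univ.filter (fun j : Corner m => j i = 0),
          MalTree α (F (Function.update j i s)) (Amat J (Function.update j i s)) T) ^ 2 := by
  unfold rhs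
  rw [prod_corner_split i, sq]
  simp [Amat_JS]

lemma tsum_four_pow_ne_top (hαm : α * m < 1) :
    ∑' n : ℕ, ENNReal.ofReal ((4 ^ n)⁻¹) * ENNReal.ofReal (((√2 * 2 ^ n) ^ (2 * α)) ^ m) ≠ ⊤ := by
  have h1 : ∀ n : ℕ, ENNReal.ofReal ((4 ^ n)⁻¹) * ENNReal.ofReal (((√2 * 2 ^ n) ^ (2 * α)) ^ m) =
      ENNReal.ofReal ((√2 ^ (2 * α)) ^ m) * ENNReal.ofReal ((4:ℝ) ^ (α * m - 1)) ^ n := fun n => by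
    rw [← ENNReal.ofReal_mul (by positivity), ← ENNReal.ofReal_pow (by positivity),
      ← ENNReal.ofReal_mul (by positivity)]
    congr 1
    have h2 : ((2:ℝ) ^ n) ^ (2 * α) = (4 ^ α) ^ n := by
      rw [← Real.rpow_natCast, ← Real.rpow_mul zero_le_two, ← Real.rpow_natCast,
        ← Real.rpow_mul (by positivity), show (4:ℝ) = 2 ^ (2:ℝ) by norm_num,
        ← Real.rpow_mul zero_le_two]
      congr 1; ring
    have h3 : (4:ℝ) ^ (α * m - 1) = (4 ^ α) ^ m / 4 := by
      rw [Real.rpow_sub (by norm_num), Real.rpow_mul (by norm_num), Real.rpow_one,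
        Real.rpow_natCast]
    rw [Real.mul_rpow (by positivity) (by positivity), h2, h3, mul_pow, div_pow]
    ring
  simp only [h1]
  rw [ENNReal.tsum_mul_left]
  refine ENNReal.mul_ne_top ENNReal.ofReal_ne_top ?_
  rw [ENNReal.tsum_geometric, ne_eq, ENNReal.inv_eq_top, tsub_eq_zero_iff_le, not_le,
    ENNReal.ofReal_lt_one]
  exact Real.rpow_lt_one_of_one_lt_of_neg (by norm_num) (by linarith)

lemma Bdd.tsum_Msum_le {i : Fin m} (hi : i ∉ S) (hα : 0 ≤ α) (hαm : α * m < 1)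
    (hB : Bdd Δ α (insert i S) (Pi.single (Sum.inl i) 1 + Pi.single (Sum.inr i) 1)) :
    ∃ C : ℝ≥0, ∀ J T Qt d F, Adm Δ S J T Qt d F → ∀ s : Fin 2,
      ∑' k : ℤ, ∫⁻ t in Set.Ioc ((2:ℝ)^(k-1)) ((2:ℝ)^k),
        Msum J T F d i s k t * ENNReal.ofReal t⁻¹ ≤
      C * (ENNReal.ofReal (Pd α d) * volume (dC Qt)) *
        (∏ j ∈ Finset.univ.filter (fun j : Corner m => j i = 0),
          MalTree α (F (Function.update j i s)) (Amat J (Function.update j i s)) T) ^ 2 := by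
  obtain ⟨C, hC⟩ := hB
  have hfin := tsum_four_pow_ne_top hαm
  set I := ∑' n : ℕ, ENNReal.ofReal ((4 ^ n)⁻¹) * ENNReal.ofReal (((√2 * 2 ^ n) ^ (2 * α)) ^ m)
    with hI
  refine ⟨C * 2 ^ m * I.toNNReal, fun J T Qt d F h s => ?_⟩
  rw [h.tsum_lintegral_Msum hi s]
  push_cast
  rw [ENNReal.coe_toNNReal hfin]
  set P := (∏ j ∈ Finset.univ.filter (fun j : Corner m => j i = 0),
          MalTree α (F (Function.update j i s)) (Amat J (Function.update j i s)) T) ^ 2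
  calc _ ≤ ∑' n : ℕ, C * 2 ^ m * (ENNReal.ofReal (Pd α d) * volume (dC Qt)) * P *
        (ENNReal.ofReal ((4 ^ n)⁻¹) * ENNReal.ofReal (((√2 * 2 ^ n) ^ (2 * α)) ^ m)) := by
        refine ENNReal.tsum_le_tsum fun n => ?_
        have h1 := hC _ _ _ _ _ (h.symmetrize_dn hi s n)
        rw [rhs_symmetrize] at h1
        have h2 : ENNReal.ofReal (Pd α (dn i d n)) ≤
            ENNReal.ofReal (((√2 * 2 ^ n) ^ (2 * α)) ^ m) * (2 ^ m * ENNReal.ofReal (Pd α d)) := by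
          refine (ENNReal.ofReal_le_ofReal (Pd_dn_le hα i h.pos n)).trans (le_of_eq ?_)
          rw [ENNReal.ofReal_mul (by positivity), ENNReal.ofReal_mul (by positivity),
            ENNReal.ofReal_pow zero_le_two]
          simp
        calc _ ≤ ENNReal.ofReal ((4 ^ n)⁻¹) * (C * ((ENNReal.ofReal (((√2 * 2 ^ n) ^ (2 * α)) ^ m) *
              (2 ^ m * ENNReal.ofReal (Pd α d))) * volume (dC Qt) * P)) :=
            mul_le_mul_right (h1.trans (by gcongr)) _
          _ = _ := by ring
    _ = _ := by rw [ENNReal.tsum_mul_left]; ring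

/-- The Cauchy–Schwarz inequality for the symmetrised forms. -/
lemma Bdd.exists_N_le (hm : 1 ≤ m) {i : Fin m} (hi : i ∉ S) (hΔ : 1 ≤ Δ) (hα : 0 ≤ α)
    (hαm : α * m < 1)
    (hB : Bdd Δ α (insert i S) (Pi.single (Sum.inl i) 1 + Pi.single (Sum.inr i) 1))
    (β : Idx m → ℕ) (h0 : β (Sum.inl i) ≠ 0) (h1 : β (Sum.inr i) ≠ 0) :
    ∃ C : ℝ≥0, ∀ J T Qt d F, Adm Δ S J T Qt d F → ∀ u : Idx m → ℝ, ∀ U : ℝ, 0 ≤ U →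
      (∀ a, |u a| ≤ U) → N J T F d β u ≤
        C * ENNReal.ofReal ((1 + U) ^ (2 * (Fintype.card (Rest i) + 2))) * rhs α J T Qt d F := by
  obtain ⟨C, hC⟩ := exists_enorm_V_le_Msum Δ hΔ i β h0 h1
  obtain ⟨C', hC'⟩ := hB.tsum_Msum_le hi hα hαm
  refine ⟨C * C' * 2, fun J T Qt d F h u U hU hu => ?_⟩
  have hfin : ∀ s : Fin 2, ∏ j ∈ Finset.univ.filter (fun j : Corner m => j i = 0),
      MalTree α (F (Function.update j i s)) (Amat J (Function.update j i s)) T ≠ ⊤ := fun s =>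
    ENNReal.prod_ne_top fun j _ => MalTree_ne_top hm hα (h.cont _) (h.supp _) _ _
  unfold rhs
  rw [prod_corner_split i]
  set P : Fin 2 → ℝ≥0∞ := fun s => ∏ j ∈ Finset.univ.filter (fun j : Corner m => j i = 0),
      MalTree α (F (Function.update j i s)) (Amat J (Function.update j i s)) T with hP
  set E := ENNReal.ofReal ((1 + U) ^ (2 * (Fintype.card (Rest i) + 2)))
  set R := ENNReal.ofReal (Pd α d) * volume (dC Qt) with hR
  have hRt : R ≠ ⊤ := ENNReal.mul_ne_top ENNReal.ofReal_ne_top (by rw [volume_dC]; simp)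
  have key := le_of_forall_scaled (x := N J T F d β u) (K := C * E * (C' * R)) (a := P 0) (b := P 1)
    (by simp only [ne_eq, ENNReal.mul_eq_top, not_or, not_and]; simp [hRt, E])
    (hfin 0) (hfin 1) fun c hc => ?_
  · refine key.trans (le_of_eq ?_)
    push_cast
    simp only [hP]
    ring
  have e0 := hC' J T Qt d F h 0
  have e1 := hC' J T Qt d F h 1
  have hm0 := fun k => h.measurable_Msum hi 0 k
  have hm1 := fun k => h.measurable_Msum hi 1 k
  calc N J T F d β u ≤ ∑' k : ℤ, ∫⁻ t in Set.Ioc ((2:ℝ)^(k-1)) ((2:ℝ)^k), C * E *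
        (c * (Msum J T F d i 0 k t * ENNReal.ofReal t⁻¹) +
          (c⁻¹ : ℝ≥0) * (Msum J T F d i 1 k t * ENNReal.ofReal t⁻¹)) := by
        refine ENNReal.tsum_le_tsum fun k => setLIntegral_mono (measurable_const.mul
          ((measurable_const.mul (hm0 k)).add (measurable_const.mul (hm1 k)))) fun t ht => ?_
        refine (mul_le_mul_left (hC h hi hU hu (pos_of_mem_Ioc ht) k hc) _).trans (le_of_eq ?_)
        ring
    _ = C * E * (c * (∑' k : ℤ, ∫⁻ t in Set.Ioc ((2:ℝ)^(k-1)) ((2:ℝ)^k),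
          Msum J T F d i 0 k t * ENNReal.ofReal t⁻¹) +
        (c⁻¹ : ℝ≥0) * ∑' k : ℤ, ∫⁻ t in Set.Ioc ((2:ℝ)^(k-1)) ((2:ℝ)^k),
          Msum J T F d i 1 k t * ENNReal.ofReal t⁻¹) := by
        rw [← ENNReal.tsum_mul_left, ← ENNReal.tsum_mul_left, ← ENNReal.tsum_add,
          ← ENNReal.tsum_mul_left]
        congr 1; funext k
        exact lintegral_linear_comb (hm0 k) (hm1 k) _ _ _
    _ ≤ C * E * (c * (C' * R * P 0 ^ 2) + (c⁻¹ : ℝ≥0) * (C' * R * P 1 ^ 2)) := by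
        gcongr
    _ = _ := by ring

end

section
variable {m : ℕ}

/-- The permutation of the coordinates taking the two halves to a corner and its opposite. -/
def flipE (j : Corner m) : Idx m ≃ Idx m :=
  Function.Involutive.toPerm (Sum.elim (sel j) (sel fun h => 1 - j h)) (by
    rintro (i | i) <;> obtain h | h : j i = 0 ∨ j i = 1 := by omega
    all_goals simp [sel, h])

lemma lintegral_proj_mul (j : Corner m) {a b : (Fin m → ℝ) → ℝ≥0∞} (ha : Measurable a)
    (hb : Measurable b) :
    ∫⁻ x : Idx m → ℝ, a (proj j x) * b (proj (fun h => 1 - j h) x) = (∫⁻ y, a y) * ∫⁻ y, b y := by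
  have h1 := (volume_measurePreserving_piCongrLeft (fun _ : Idx m => ℝ) (flipE j)).symm
  have h2 := h1.trans (volume_measurePreserving_sumPiEquivProdPi (fun _ : Idx m => ℝ))
  rw [← lintegral_prod_mul ha.aemeasurable hb.aemeasurable, ← Measure.volume_eq_prod]
  exact h2.lintegral_comp (f := fun z : (Fin m → ℝ) × (Fin m → ℝ) => a z.1 * b z.2)
    ((ha.comp measurable_fst).mul (hb.comp measurable_snd))

lemma two_pow_rpow_half (hm : 1 ≤ m) (x : ℝ≥0∞) :
    (x ^ (2 ^ (m - 1) : ℕ)) ^ ((2:ℝ) ^ m)⁻¹ = x ^ (2⁻¹ : ℝ) := by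
  rw [← ENNReal.rpow_natCast, ← ENNReal.rpow_mul]
  congr 1
  obtain ⟨n, rfl⟩ := Nat.exists_eq_add_of_le' hm
  push_cast
  rw [pow_succ]
  field_simp

lemma prod_opposite {M : Type*} [CommMonoid M] (y : Corner m → M) :
    ∏ j : Corner m, y (fun h => 1 - j h) = ∏ j, y j :=
  Equiv.prod_comp (Equiv.subLeft (1 : Corner m)) y

lemma prod_pair (hm : 1 ≤ m) (y : Corner m → ℝ≥0∞) :
    ∏ j : Corner m, (y j ^ (2 ^ (m - 1) : ℕ) * y (fun h => 1 - j h) ^ (2 ^ (m - 1) : ℕ)) ^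
      ((2:ℝ) ^ m)⁻¹ = ∏ j, y j := by
  have h1 : ∀ j : Corner m, (y j ^ (2 ^ (m - 1) : ℕ) *
      y (fun h => 1 - j h) ^ (2 ^ (m - 1) : ℕ)) ^ ((2:ℝ) ^ m)⁻¹ =
      y j ^ (2⁻¹ : ℝ) * y (fun h => 1 - j h) ^ (2⁻¹ : ℝ) := fun j => by
    rw [ENNReal.mul_rpow_of_nonneg _ _ (by positivity), two_pow_rpow_half hm,
      two_pow_rpow_half hm]
  rw [Finset.prod_congr rfl fun j _ => h1 j, Finset.prod_mul_distrib,
    prod_opposite fun j => y j ^ (2⁻¹ : ℝ), ← Finset.prod_mul_distrib]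
  refine Finset.prod_congr rfl fun j _ => ?_
  rw [← ENNReal.rpow_add_of_nonneg _ _ (by norm_num) (by norm_num)]
  norm_num

lemma prod_const_rpow (x : ℝ≥0∞) : ∏ _j : Corner m, x ^ ((2:ℝ) ^ m)⁻¹ = x := by
  rw [Finset.prod_const, Finset.card_univ, ← ENNReal.rpow_natCast, ← ENNReal.rpow_mul]
  simp

/-- Hölder's inequality for products of functions of the projections to the corners. -/
lemma lintegral_prod_proj_le (hm : 1 ≤ m) {f : Corner m → (Fin m → ℝ) → ℝ≥0∞}
    (hf : ∀ j, Measurable (f j)) :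
    ∫⁻ x : Idx m → ℝ, ∏ j, f j (proj j x) ≤
      ∏ j : Corner m, ((∫⁻ y, f j y ^ (2 ^ (m - 1) : ℕ)) *
        ∫⁻ y, f (fun h => 1 - j h) y ^ (2 ^ (m - 1) : ℕ)) ^ ((2:ℝ) ^ m)⁻¹ := by
  have h1 : ∀ x : Idx m → ℝ, ∏ j, f j (proj j x) = ∏ j : Corner m,
      (f j (proj j x) ^ (2 ^ (m - 1) : ℕ) * f (fun h => 1 - j h) (proj (fun h => 1 - j h) x) ^
        (2 ^ (m - 1) : ℕ)) ^ ((2:ℝ) ^ m)⁻¹ := fun x =>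
    (prod_pair hm fun j => f j (proj j x)).symm
  simp only [h1]
  have hm' : ∀ j : Corner m, Measurable fun x : Idx m → ℝ => f j (proj j x) ^ (2 ^ (m - 1) : ℕ) :=
    fun j => ((hf j).comp (continuous_proj j).measurable).pow_const _
  refine (ENNReal.lintegral_prod_norm_pow_le (p := fun _ : Corner m => ((2:ℝ) ^ m)⁻¹) _
    (fun j _ => ((hm' j).mul (hm' _)).aemeasurable) (by simp) fun _ _ => by positivity).trans
    (le_of_eq ?_)
  refine Finset.prod_congr rfl fun j _ => ?_
  congr 1
  exact lintegral_proj_mul j ((hf j).pow_const _) ((hf _).pow_const _)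

lemma box_eq_Icc (a b : Fin m → ℝ) : box a b = Set.Icc a b := by
  ext x; simp [box, Pi.le_def, forall_and]

lemma volume_box {a b : Fin m → ℝ} (hab : ∀ i, a i < b i) :
    volume (box a b) = ENNReal.ofReal (∏ i, (b i - a i)) := by
  rw [box_eq_Icc, Real.volume_Icc_pi, ENNReal.ofReal_prod_of_nonneg]
  exact fun i _ => (sub_pos.2 (hab i)).le

lemma lintegral_box_pow_le_Mal (hm : 1 ≤ m) {α ε : ℝ} (hα : 0 ≤ α) (hε : 0 < ε)
    {F : (Fin m → ℝ) → ℝ} (hF : Continuous F) {a b : Fin m → ℝ} (hab : ∀ i, a i < b i)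
    (he : ε ≤ ecc a b) {E : Set (Fin m → ℝ)} (hE : E ⊆ box a b) :
    ∫⁻ y in box a b, ‖F y‖ₑ ^ (2 ^ (m - 1) : ℕ) ≤
      ENNReal.ofReal (∏ i, (b i - a i)) * ENNReal.ofReal (ε ^ (-α)) *
        Mal α F E ^ (2 ^ (m - 1) : ℕ) := by
  set q : ℕ := 2 ^ (m - 1) with hq
  have hR : 0 < ∏ i, (b i - a i) := Finset.prod_pos fun i _ => sub_pos.2 (hab i)
  have hInt : IntegrableOn (fun y => |F y| ^ q) (box a b) := by
    rw [box_eq_Icc]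
    exact (hF.abs.pow q).continuousOn.integrableOn_Icc
  have h1 : ∫⁻ y in box a b, ‖F y‖ₑ ^ q = ENNReal.ofReal (∫ y in box a b, |F y| ^ q) := by
    rw [ofReal_integral_eq_lintegral_ofReal hInt
      (Filter.Eventually.of_forall fun y => by positivity)]
    refine lintegral_congr fun y => ?_
    rw [Real.enorm_eq_ofReal_abs, ENNReal.ofReal_pow (abs_nonneg _)]
  have h2 : ENNReal.ofReal ((ecc a b ^ α) ^ ((2:ℝ) ^ ((1:ℤ) - (m:ℤ))) * avg (box a b) F) ≤
      Mal α F E :=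
    le_iSup₂_of_le a b (le_iSup₂_of_le hab hE le_rfl)
  have hI : 0 ≤ ∫ y in box a b, |F y| ^ q := integral_nonneg fun y => by positivity
  set I := ∫ y in box a b, |F y| ^ q with hIdef
  have he0 : 0 < ecc a b := hε.trans_le he
  have hexp : ((2:ℝ) ^ ((1:ℤ) - (m:ℤ))) * (q : ℝ) = 1 := by
    rw [mul_comm]; exact two_pow_mul_two_zpow hm
  have h3 : ((ecc a b ^ α) ^ ((2:ℝ) ^ ((1:ℤ) - (m:ℤ))) * avg (box a b) F) ^ q =
      ecc a b ^ α * ((∏ i, (b i - a i))⁻¹ * I) := by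
    have hcancel : ∀ x : ℝ, 0 ≤ x → (x ^ ((2:ℝ) ^ ((1:ℤ) - (m:ℤ)))) ^ q = x := fun x hx => by
      rw [← Real.rpow_natCast, ← Real.rpow_mul hx, hexp, Real.rpow_one]
    unfold avg
    rw [volume_box hab, ENNReal.toReal_ofReal hR.le, mul_pow, hcancel _ (by positivity),
      hcancel _ (by positivity)]
  have h4 := pow_le_pow_left₀ zero_le h2 q
  rw [← ENNReal.ofReal_pow (by unfold avg; positivity), h3] at h4
  rw [h1]
  calc ENNReal.ofReal I ≤ ENNReal.ofReal ((∏ i, (b i - a i)) * ε ^ (-α) *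
        (ecc a b ^ α * ((∏ i, (b i - a i))⁻¹ * I))) := by
        refine ENNReal.ofReal_le_ofReal ?_
        have h5 : 1 ≤ ε ^ (-α) * ecc a b ^ α := by
          rw [Real.rpow_neg hε.le, ← div_eq_inv_mul, one_le_div (by positivity)]
          exact Real.rpow_le_rpow hε.le he hα
        calc I ≤ ε ^ (-α) * ecc a b ^ α * I := le_mul_of_one_le_left hI h5
          _ = _ := by field_simp
    _ = ENNReal.ofReal (∏ i, (b i - a i)) * ENNReal.ofReal (ε ^ (-α)) *
        ENNReal.ofReal (ecc a b ^ α * ((∏ i, (b i - a i))⁻¹ * I)) := by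
        rw [ENNReal.ofReal_mul (by positivity), ENNReal.ofReal_mul hR.le]
    _ ≤ _ := by gcongr

/-- The integral of a product over a box in `ℝ^{2m}`. -/
lemma lintegral_box_prod_le (hm : 1 ≤ m) {α ε : ℝ} (hα : 0 ≤ α) (hε : 0 < ε)
    {F : Corner m → (Fin m → ℝ) → ℝ} (hF : ∀ j, Continuous (F j)) {a b : Idx m → ℝ}
    (hab : ∀ i, a i < b i) (he : ∀ j, ε ≤ ecc (proj j a) (proj j b))
    {E : Corner m → Set (Fin m → ℝ)} (hE : ∀ j, E j ⊆ box (proj j a) (proj j b)) :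
    ∫⁻ x in Set.Icc a b, ∏ j, ‖F j (proj j x)‖ₑ ≤
      ENNReal.ofReal (∏ i, (b i - a i)) * ENNReal.ofReal (ε ^ (-α)) ^ 2 *
        ∏ j, Mal α (F j) (E j) := by
  set f : Corner m → (Fin m → ℝ) → ℝ≥0∞ := fun j =>
    (box (proj j a) (proj j b)).indicator fun y => ‖F j y‖ₑ with hf
  have hbm : ∀ j, MeasurableSet (box (proj j a) (proj j b)) := fun j => by
    rw [box_eq_Icc]; exact measurableSet_Icc
  have hInt : ∀ j, ∫⁻ y, f j y ^ (2 ^ (m - 1) : ℕ) =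
      ∫⁻ y in box (proj j a) (proj j b), ‖F j y‖ₑ ^ (2 ^ (m - 1) : ℕ) := fun j => by
    rw [← lintegral_indicator (hbm j)]
    refine lintegral_congr fun y => ?_
    simp only [hf, Set.indicator]
    split_ifs <;> simp
  have hx : ∀ j, ∫⁻ y, f j y ^ (2 ^ (m - 1) : ℕ) ≤ ENNReal.ofReal (∏ i, (b (sel j i) - a (sel j i))) *
      ENNReal.ofReal (ε ^ (-α)) * Mal α (F j) (E j) ^ (2 ^ (m - 1) : ℕ) := fun j => by
    rw [hInt]
    exact lintegral_box_pow_le_Mal hm hα hε (hF j) (fun i => hab _) (he j) (hE j)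
  have h1 : ∫⁻ x in Set.Icc a b, ∏ j, ‖F j (proj j x)‖ₑ ≤ ∫⁻ x, ∏ j, f j (proj j x) := by
    rw [← lintegral_indicator measurableSet_Icc]
    refine lintegral_mono fun x => ?_
    unfold Set.indicator
    split_ifs with hx
    · refine Finset.prod_le_prod' fun j _ => ?_
      have : proj j x ∈ box (proj j a) (proj j b) := fun i => ⟨hx.1 _, hx.2 _⟩
      simp [hf, this]
    · exact zero_le
  refine h1.trans ((lintegral_prod_proj_le hm fun j => (hF j).enorm.measurable.indicator
    (hbm j)).trans ?_)
  calc _ ≤ ∏ j : Corner m, (ENNReal.ofReal (∏ i, (b i - a i)) * ENNReal.ofReal (ε ^ (-α)) ^ 2 *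
        (Mal α (F j) (E j) ^ (2 ^ (m - 1) : ℕ) * Mal α (F fun h => 1 - j h) (E fun h => 1 - j h) ^
          (2 ^ (m - 1) : ℕ))) ^ ((2:ℝ) ^ m)⁻¹ := by
        refine Finset.prod_le_prod' fun j _ => ENNReal.rpow_le_rpow ?_ (by positivity)
        refine (mul_le_mul' (hx j) (hx _)).trans (le_of_eq ?_)
        rw [prod_idx_eq j fun i => b i - a i, ENNReal.ofReal_mul
          (Finset.prod_nonneg fun i _ => (sub_pos.2 (hab _)).le)]
        ring
    _ = _ := by
      simp only [ENNReal.mul_rpow_of_nonneg (ENNReal.ofReal (∏ i, (b i - a i)) *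
        ENNReal.ofReal (ε ^ (-α)) ^ 2) _ (inv_nonneg.2 (pow_nonneg zero_le_two m))]
      rw [Finset.prod_mul_distrib, prod_const_rpow, prod_pair hm fun j => Mal α (F j) (E j)]

end

section
variable {m : ℕ} {Δ α : ℝ} {S : Finset (Fin m)} {J : Matrix (Idx m) (Fin m) ℝ}
  {T : Set (ℤ × (Fin m → ℤ))} {Qt : ℤ × (Fin m → ℤ)} {d : Fin m → ℝ}
  {F : Corner m → (Fin m → ℝ) → ℝ}

lemma exists_prod_gd_le_tsum_indicator (m κ : ℕ) :
    ∃ C : ℝ, 0 ≤ C ∧ ∀ v : Idx m → ℝ, ENNReal.ofReal (∏ a, gd 0 (v a)) ≤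
      ∑' n : ℕ, ENNReal.ofReal (C * (((2:ℝ) ^ n) ^ κ)⁻¹) *
        {v : Idx m → ℝ | ∀ a, |v a| ≤ 2 ^ n}.indicator 1 v := by
  obtain ⟨c, hc0, hc⟩ := gd_decay 0 κ
  refine ⟨c ^ Fintype.card (Idx m) * 2 ^ κ, by positivity, fun v => ?_⟩
  have hg : ∀ a, 0 ≤ gd 0 (v a) := fun a => by rw [gd_zero]; positivity
  have h1 : (∏ a, gd 0 (v a)) * (1 + ‖v‖) ^ κ ≤ c ^ Fintype.card (Idx m) := by
    calc _ ≤ (∏ a, gd 0 (v a)) * (∏ a, (1 + |v a|)) ^ κ := by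
          have := Finset.prod_nonneg fun a (_ : a ∈ Finset.univ) => hg a
          gcongr
          exact one_add_norm_le_prod _
      _ = ∏ a, gd 0 (v a) * (1 + |v a|) ^ κ := by
          rw [Finset.prod_mul_distrib, Finset.prod_pow]
      _ ≤ ∏ _a : Idx m, c := Finset.prod_le_prod (fun a _ => mul_nonneg (hg a) (by positivity))
          fun a _ => by simpa [abs_of_nonneg (hg a)] using hc (v a)
      _ = _ := by rw [Finset.prod_const, Finset.card_univ]
  obtain ⟨n, hn1, hn2⟩ := exists_nat_pow_near (x := 1 + ‖v‖) (y := (2:ℝ))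
    (by linarith [norm_nonneg v]) one_lt_two
  refine le_trans ?_ (ENNReal.le_tsum (n + 1))
  have hmem : v ∈ {v : Idx m → ℝ | ∀ a, |v a| ≤ 2 ^ (n + 1)} := fun a => by
    have := norm_le_pi_norm v a
    rw [Real.norm_eq_abs] at this
    linarith
  rw [Set.indicator_of_mem hmem, Pi.one_apply, mul_one]
  refine ENNReal.ofReal_le_ofReal ?_
  have h2 : (∏ a, gd 0 (v a)) * (2 ^ n) ^ κ ≤ c ^ Fintype.card (Idx m) :=
    le_trans (by
      have := Finset.prod_nonneg fun a (_ : a ∈ Finset.univ) => hg a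
      gcongr) h1
  rw [← le_div_iff₀ (by positivity)] at h2
  refine h2.trans (le_of_eq ?_)
  rw [pow_succ, mul_pow]
  field_simp

/-- The constant governing the size of the boxes. -/
def cBox (m : ℕ) (Δ : ℝ) : ℝ := (1 + m * Δ * (m * cInv m Δ)) * (2 * (m * Δ) + 2)

lemma cInv_nonneg (hΔ : 1 ≤ Δ) : 0 ≤ cInv m Δ := by
  unfold cInv; positivity

lemma cBox_ge (hΔ : 1 ≤ Δ) : 2 * (m * Δ) + 2 ≤ cBox m Δ := by
  have := cInv_nonneg (m := m) hΔ
  have h0 : 0 ≤ m * Δ * (m * cInv m Δ) := by positivity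
  have h1 : 0 ≤ m * Δ := by positivity
  unfold cBox
  nlinarith

lemma cBox_pos (hΔ : 1 ≤ Δ) : 0 < cBox m Δ :=
  lt_of_lt_of_le (by positivity) (cBox_ge hΔ)

lemma abs_mulVec_le {A : Matrix (Fin m) (Fin m) ℝ} {K M : ℝ} (hK : 0 ≤ K) (hA : ∀ i k, |A i k| ≤ K)
    {v : Fin m → ℝ} (hv : ∀ k, |v k| ≤ M) (i : Fin m) : |(A *ᵥ v) i| ≤ m * K * M := by
  unfold Matrix.mulVec dotProduct
  refine (Finset.abs_sum_le_sum_abs _ _).trans ?_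
  refine (Finset.sum_le_card_nsmul _ _ (K * M) fun k _ => ?_).trans (by simp [mul_assoc])
  rw [abs_mul]
  exact mul_le_mul (hA i k) (hv k) (abs_nonneg _) hK

lemma IsReg.abs_le {A : Matrix (Fin m) (Fin m) ℝ} (hA : IsReg Δ A) (i k : Fin m) : |A i k| ≤ Δ :=
  (abs_entry_le_opNorm A i k).trans hA.1

lemma Amat_mulVec (J : Matrix (Idx m) (Fin m) ℝ) (j : Corner m) (p : Fin m → ℝ) (h : Fin m) :
    (Amat J j *ᵥ p) h = (J *ᵥ p) (sel j h) := by
  simp [Amat, Matrix.mulVec, dotProduct]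

lemma Adm.abs_sub_le (h : Adm Δ S J T Qt d F) (hΔ : 1 ≤ Δ) (j : Corner m) {t : ℝ}
    {q e : Fin m → ℝ} (he : ∀ k, |e k - q k| ≤ 2 * t) (i : Fin m) :
    |(Amat J j *ᵥ e) i - (J *ᵥ q) (sel j i)| ≤ 2 * (m * Δ) * t := by
  have h1 := abs_mulVec_le (by linarith) (h.reg j).abs_le (v := e - q) he i
  rw [Matrix.mulVec_sub, Pi.sub_apply, Amat_mulVec J j q] at h1
  linarith

/-- The points seen by the kernel lie in a box. -/
lemma Adm.mem_box (h : Adm Δ S J T Qt d F) (hΔ : 1 ≤ Δ) (j : Corner m) {t L : ℝ} (ht : 0 < t)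
    (hL : 0 ≤ L) {q e p : Fin m → ℝ} {x : Idx m → ℝ} (he : ∀ k, |e k - q k| ≤ 2 * t)
    (hx : proj j x = Amat J j *ᵥ e) (hp : ∀ a, |x a + (J *ᵥ p) a| ≤ L * dd d t a) (i : Fin m) :
    |x (sel j i) - (J *ᵥ q) (sel j i)| ≤ cBox m Δ * t ∧
    |x (sel (fun h => 1 - j h) i) - (J *ᵥ q) (sel (fun h => 1 - j h) i)| ≤
      cBox m Δ * t * (1 + L * d i) := by
  have hc := cInv_nonneg (m := m) hΔ
  have hmΔ : 0 ≤ m * Δ := by positivity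
  set j' : Corner m := fun h => 1 - j h with hj'
  have hxi : ∀ i, x (sel j i) = (Amat J j *ᵥ e) i := fun i => congrFun hx i
  have h1 : ∀ i, |x (sel j i) - (J *ᵥ q) (sel j i)| ≤ 2 * (m * Δ) * t := fun i => by
    rw [hxi]; exact h.abs_sub_le hΔ j he i
  have hdi := h.pos
  refine ⟨(h1 i).trans (mul_le_mul_of_nonneg_right (by linarith [cBox_ge (m := m) hΔ]) ht.le), ?_⟩
  have hadd : ∀ a, (J *ᵥ (p + q)) a = (J *ᵥ p) a + (J *ᵥ q) a := fun a => by
    rw [Matrix.mulVec_add]; rfl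
  have h2 : ∀ i, |(J *ᵥ (p + q)) (sel j i)| ≤ 2 * (m * Δ) * t + L * (t * d i) := fun i => by
    have e1 := hp (sel j i)
    have e2 := h1 i
    rw [dd_sel] at e1
    rw [hadd]
    rw [abs_le] at *
    constructor <;> linarith [e1.1, e1.2, e2.1, e2.2]
  have h3 : |x (sel j' i) - (J *ᵥ q) (sel j' i)| ≤
      L * (t * d i) + |(J *ᵥ (p + q)) (sel j' i)| := by
    have e1 := hp (sel j' i)
    rw [dd_sel] at e1
    have e3 : x (sel j' i) - (J *ᵥ q) (sel j' i) =
        (x (sel j' i) + (J *ᵥ p) (sel j' i)) - (J *ᵥ (p + q)) (sel j' i) := by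
      rw [hadd]; ring
    rw [e3]
    exact (abs_sub _ _).trans (by linarith)
  have hLd : 0 ≤ L * (t * d i) := mul_nonneg hL (mul_pos ht (hdi i)).le
  have hK : 0 ≤ m * Δ * (m * cInv m Δ) := by positivity
  have hLdt : 0 ≤ L * d i := mul_nonneg hL (hdi i).le
  by_cases hi : i ∈ S
  · have e1 : (J *ᵥ (p + q)) (sel j' i) = (J *ᵥ (p + q)) (sel j i) := by
      have : ∀ b : Corner m, (J *ᵥ (p + q)) (sel b i) = (J *ᵥ (p + q)) (Sum.inl i) := fun b => by
        unfold sel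
        split_ifs
        · rfl
        · simp only [Matrix.mulVec, dotProduct, h.row i hi]
      rw [this, this]
    rw [e1] at h3
    have h4 := h2 i
    calc _ ≤ (2 * (m * Δ) + 2) * t * (1 + L * d i) := by nlinarith [mul_nonneg hmΔ ht.le]
      _ ≤ _ := by
        have := cBox_ge (m := m) hΔ
        gcongr
  · have hd : ∀ i', d i' ≤ d i := fun i' => by
      by_cases hi' : i' ∈ S
      · exact h.le i' hi' i hi
      · exact (h.eq i' hi' i hi).le
    have h5 : ∀ i', |(Amat J j *ᵥ (p + q)) i'| ≤ 2 * (m * Δ) * t + L * (t * d i) := fun i' => by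
      rw [Amat_mulVec]
      refine (h2 i').trans ?_
      have := hd i'
      gcongr
    have h6 : ∀ k, |(p + q) k| ≤ m * cInv m Δ * (2 * (m * Δ) * t + L * (t * d i)) := fun k => by
      have e1 : p + q = (Amat J j)⁻¹ *ᵥ (Amat J j *ᵥ (p + q)) := by
        rw [Matrix.mulVec_mulVec, Matrix.nonsing_inv_mul _ (h.isUnit j), Matrix.one_mulVec]
      rw [e1]
      exact abs_mulVec_le hc (abs_inv_entry_le hΔ (h.reg j)) h5 k
    have h7 := abs_mulVec_le (by linarith) (h.reg j').abs_le h6 i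
    rw [Amat_mulVec] at h7
    refine h3.trans ((add_le_add_right h7 _).trans ?_)
    unfold cBox
    have e4 : 0 ≤ m * Δ * (m * cInv m Δ) * (L * (t * d i)) := mul_nonneg hK hLd
    have e5 : 0 ≤ m * Δ * (m * cInv m Δ) * t := mul_nonneg hK ht.le
    have e6 : 0 ≤ (m * Δ) * (L * (t * d i)) := mul_nonneg hmΔ hLd
    have e7 : 0 ≤ (m * Δ) * t := mul_nonneg hmΔ ht.le
    have e8 : 0 ≤ m * Δ * (m * cInv m Δ) * ((m * Δ) * (L * (t * d i))) := mul_nonneg hK e6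
    nlinarith [e4, e5, e6, e7, e8, hLd]

end

section
variable {m : ℕ} {Δ α : ℝ} {S : Finset (Fin m)} {J : Matrix (Idx m) (Fin m) ℝ}
  {T : Set (ℤ × (Fin m → ℤ))} {Qt : ℤ × (Fin m → ℤ)} {d : Fin m → ℝ}
  {F : Corner m → (Fin m → ℝ) → ℝ}

lemma one_add_inv_mul_max_le {x : ℝ} (hx : 0 < x) :
    (1 + x⁻¹) * (max 1 x ^ α) ^ 2 ≤ 2 * max (x ^ (2 * α)) (x ^ (-2 : ℝ)) := by
  rcases le_total 1 x with h | h
  · rw [max_eq_right h, ← Real.rpow_natCast, ← Real.rpow_mul hx.le, mul_comm α]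
    have h1 : x⁻¹ ≤ 1 := inv_le_one_of_one_le₀ h
    have h2 := le_max_left (x ^ (2 * α)) (x ^ (-2 : ℝ))
    have h3 : 0 ≤ x ^ (2 * α) := by positivity
    push_cast
    nlinarith
  · rw [max_eq_left h, Real.one_rpow, one_pow, mul_one]
    have h1 : 1 ≤ x⁻¹ := (one_le_inv₀ hx).2 h
    have h2 := le_max_right (x ^ (2 * α)) (x ^ (-2 : ℝ))
    have h3 : x ^ (-2 : ℝ) = x⁻¹ ^ 2 := by
      rw [Real.rpow_neg hx.le, inv_pow]
      norm_num
    rw [h3] at h2 ⊢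
    nlinarith

lemma scale_coeff_le (hd : ∀ h, 0 < d h) {t c L : ℝ} (ht : 0 < t) (hc : 0 < c) (hL : 1 ≤ L)
    (hα1 : α ≤ 1) :
    (∏ h, (t * d h)⁻¹ ^ 2 * (2 * (L * (t * d h))) * ((2 * (c * t)) * (2 * (c * t * (1 + L * d h))))) *
      ((2 * L * ∏ h, max 1 (d h)) ^ α) ^ 2 ≤
    ((16 * c ^ 2) ^ m * 4 * L ^ (2 * m + 2)) * (t ^ m * Pd α d) := by
  have h1 : ((2 * L * ∏ h, max 1 (d h)) ^ α) ^ 2 ≤ (2 * L) ^ 2 * ∏ h, (max 1 (d h) ^ α) ^ 2 := by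
    rw [Real.mul_rpow (by positivity) (by positivity), mul_pow, Finset.prod_pow,
      Real.finsetProd_rpow _ _ (fun h _ => by positivity)]
    gcongr
    calc (2 * L) ^ α ≤ (2 * L) ^ (1:ℝ) := Real.rpow_le_rpow_of_exponent_le (by linarith) hα1
      _ = _ := Real.rpow_one _
  have h2 : ∀ h, (t * d h)⁻¹ ^ 2 * (2 * (L * (t * d h))) *
      ((2 * (c * t)) * (2 * (c * t * (1 + L * d h)))) ≤ 8 * c ^ 2 * L ^ 2 * t * (1 + (d h)⁻¹) := by
    intro h
    have := hd h
    have e : (t * d h)⁻¹ ^ 2 * (2 * (L * (t * d h))) *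
      ((2 * (c * t)) * (2 * (c * t * (1 + L * d h)))) = 8 * c ^ 2 * L * t * ((d h)⁻¹ + L) := by
      field_simp
      ring
    rw [e]
    have h3 : (d h)⁻¹ + L ≤ L * (1 + (d h)⁻¹) := by
      have : 0 < (d h)⁻¹ := by positivity
      nlinarith
    calc _ ≤ 8 * c ^ 2 * L * t * (L * (1 + (d h)⁻¹)) := by gcongr
      _ = _ := by ring
  calc _ ≤ (∏ h, 8 * c ^ 2 * L ^ 2 * t * (1 + (d h)⁻¹)) *
        ((2 * L) ^ 2 * ∏ h, (max 1 (d h) ^ α) ^ 2) := by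
        refine mul_le_mul (Finset.prod_le_prod (fun h _ => ?_) fun h _ => h2 h) h1 (by positivity)
          (Finset.prod_nonneg fun h _ => ?_) <;>
        · have := hd h
          positivity
    _ = (2 * L) ^ 2 * (∏ _h : Fin m, 8 * c ^ 2 * L ^ 2 * t) *
        ∏ h, (1 + (d h)⁻¹) * (max 1 (d h) ^ α) ^ 2 := by
        simp only [Finset.prod_mul_distrib]; ring
    _ ≤ (2 * L) ^ 2 * (∏ _h : Fin m, 8 * c ^ 2 * L ^ 2 * t) *
        ∏ h, 2 * max (d h ^ (2 * α)) (d h ^ (-2 : ℝ)) := by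
        refine mul_le_mul_of_nonneg_left (Finset.prod_le_prod (fun h _ => ?_)
          fun h _ => one_add_inv_mul_max_le (hd h)) (by positivity)
        have := hd h
        positivity
    _ = _ := by
        simp only [Finset.prod_mul_distrib, Finset.prod_const, Finset.card_univ]
        rw [Fintype.card_fin, Pd, pow_add, pow_mul, show (16:ℝ) * c ^ 2 = (8 * c ^ 2) * 2 by ring]
        simp only [mul_pow]
        ring


lemma inv_le_ecc {a b : Fin m → ℝ} (hm : 1 ≤ m) {w X : ℝ} (hw : 0 < w) (hX : 0 < X)
    (h1 : ∀ i, w ≤ b i - a i) (h2 : ∀ i, b i - a i ≤ w * X) : X⁻¹ ≤ ecc a b := by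
  have : Nonempty (Fin m) := ⟨⟨0, hm⟩⟩
  have h3 : w ≤ ⨅ i, (b i - a i) := le_ciInf h1
  have h4 : ⨆ i, (b i - a i) ≤ w * X := ciSup_le h2
  have h5 : w ≤ ⨆ i, (b i - a i) := (h1 ⟨0, hm⟩).trans
    (le_ciSup (Set.finite_range fun i => b i - a i).bddAbove (⟨0, hm⟩ : Fin m))
  unfold ecc
  rw [le_div_iff₀ (hw.trans_le h5)]
  calc X⁻¹ * _ ≤ X⁻¹ * (w * X) := by gcongr
    _ = w := by field_simp
    _ ≤ _ := h3

lemma ker_zero_eq (p : Fin m → ℝ) (x : Idx m → ℝ) (σ : Idx m → ℝ) :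
    ker J σ 0 0 p x = (∏ a, (σ a)⁻¹) * ∏ a, gd 0 ((x a + (J *ᵥ p) a) / σ a) := by
  simp [ker, ph, Finset.prod_mul_distrib]

end

section
variable {m : ℕ} {Δ α : ℝ} {S : Finset (Fin m)} {J : Matrix (Idx m) (Fin m) ℝ}
  {T : Set (ℤ × (Fin m → ℤ))} {Qt : ℤ × (Fin m → ℤ)} {d : Fin m → ℝ}
  {F : Corner m → (Fin m → ℝ) → ℝ}

lemma sel_one_sub_ne (j : Corner m) (i : Fin m) : sel (fun h => 1 - j h) i ≠ sel j i := by
  unfold sel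
  obtain h | h : j i = 0 ∨ j i = 1 := by omega
  all_goals simp [h]

/-- The half side lengths of the box seen by the kernel truncated at height `L`. -/
def rad (Δ : ℝ) (d : Fin m → ℝ) (j : Corner m) (t L : ℝ) (a : Idx m) : ℝ :=
  if a = sel j (ix a) then cBox m Δ * t else cBox m Δ * t * (1 + L * d (ix a))

lemma rad_sel (d : Fin m → ℝ) (j : Corner m) (t L : ℝ) (i : Fin m) :
    rad Δ d j t L (sel j i) = cBox m Δ * t := by
  simp [rad, ix_sel]

lemma rad_sel_one_sub (d : Fin m → ℝ) (j : Corner m) (t L : ℝ) (i : Fin m) :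
    rad Δ d j t L (sel (fun h => 1 - j h) i) = cBox m Δ * t * (1 + L * d i) := by
  simp [rad, ix_sel, sel_one_sub_ne]

lemma forall_idx_of_sel {P : Idx m → Prop} (j : Corner m) (h0 : ∀ i, P (sel j i))
    (h1 : ∀ i, P (sel (fun h => 1 - j h) i)) (a : Idx m) : P a := by
  rcases eq_sel_or j a with h | h <;> rw [h]
  exacts [h0 _, h1 _]

lemma Adm.le_rad (h : Adm Δ S J T Qt d F) (hΔ : 1 ≤ Δ) (j : Corner m) {t L : ℝ} (ht : 0 < t)
    (hL : 0 ≤ L) (a : Idx m) : cBox m Δ * t ≤ rad Δ d j t L a := by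
  have hc := cBox_pos (m := m) hΔ
  have h0 := h.pos
  refine forall_idx_of_sel (P := fun a => cBox m Δ * t ≤ rad Δ d j t L a) j
    (fun i => (rad_sel d j t L i).ge) (fun i => ?_) a
  rw [rad_sel_one_sub]
  exact le_mul_of_one_le_right (by positivity) (by nlinarith [mul_nonneg hL (h0 i).le])

lemma one_le_prod_max_one (s : Finset (Fin m)) (d : Fin m → ℝ) : 1 ≤ ∏ h ∈ s, max 1 (d h) := by
  calc (1:ℝ) = ∏ _h ∈ s, 1 := by simp
    _ ≤ _ := Finset.prod_le_prod (by simp) fun i _ => le_max_left _ _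

lemma le_prod_max_one (d : Fin m → ℝ) (i : Fin m) : d i ≤ ∏ h, max 1 (d h) := by
  rw [← Finset.mul_prod_erase _ _ (Finset.mem_univ i)]
  exact (le_max_right 1 (d i)).trans
    (le_mul_of_one_le_right (by positivity) (one_le_prod_max_one _ d))

lemma rad_le (hΔ : 1 ≤ Δ) (j : Corner m) {t L : ℝ} (ht : 0 < t)
    (hL : 1 ≤ L) (a : Idx m) :
    rad Δ d j t L a ≤ cBox m Δ * t * (2 * L * ∏ h, max 1 (d h)) := by
  have hc := cBox_pos (m := m) hΔ
  have h1 : 1 ≤ ∏ h, max 1 (d h) := one_le_prod_max_one _ d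
  refine forall_idx_of_sel
    (P := fun a => rad Δ d j t L a ≤ cBox m Δ * t * (2 * L * ∏ h, max 1 (d h))) j
    (fun i => ?_) (fun i => ?_) a
  · rw [rad_sel]
    exact le_mul_of_one_le_right (by positivity) (by nlinarith)
  · rw [rad_sel_one_sub]
    have := le_prod_max_one d i
    gcongr
    nlinarith

lemma Adm.lintegral_truncated_le (hm : 1 ≤ m) (h : Adm Δ S J T Qt d F) (hΔ : 1 ≤ Δ) (hα : 0 ≤ α)
    (j : Corner m) {t L : ℝ} (ht : 0 < t) (hL : 1 ≤ L) {q : Fin m → ℝ} {E B : Set (Fin m → ℝ)}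
    (hE : ∀ e ∈ E, ∀ k, |e k - q k| ≤ 2 * t) (hB : ∀ e ∈ B, ∀ k, |e k - q k| ≤ 2 * t) :
    ∫⁻ z : (Fin m → ℝ) × (Idx m → ℝ),
      ({x | proj j x ∈ (Amat J j).mulVec '' E}.indicator 1 z.2 * ∏ j, ‖F j (proj j z.2)‖ₑ) *
        {v : Idx m → ℝ | ∀ a, |v a| ≤ L}.indicator 1
          (fun a => (z.2 a + (J *ᵥ z.1) a) / dd d t a) ≤
    ENNReal.ofReal Δ * ENNReal.ofReal (∏ h, 2 * (L * (t * d h))) *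
      (ENNReal.ofReal (∏ a, 2 * rad Δ d j t L a) *
        ENNReal.ofReal ((2 * L * ∏ h, max 1 (d h)) ^ α) ^ 2 *
          ∏ j, Mal α (F j) ((Amat J j).mulVec '' B)) := by
  have hc := cBox_pos (m := m) hΔ
  have hd := h.pos
  have hL0 : 0 ≤ L := by linarith
  have hr0 : ∀ a, 0 < rad Δ d j t L a := fun a => lt_of_lt_of_le (by positivity) (h.le_rad hΔ j ht hL0 a)
  set r := rad Δ d j t L with hr
  set a₀ : Idx m → ℝ := J *ᵥ q - r
  set b₀ : Idx m → ℝ := J *ᵥ q + r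
  set ρ : Fin m → ℝ := fun h => L * (t * d h) with hρ
  set χ : (Fin m → ℝ) → ℝ≥0∞ := (Set.Icc (-ρ) ρ).indicator 1 with hχ
  have hχm : Measurable χ := measurable_one.indicator measurableSet_Icc
  set w : (Idx m → ℝ) → ℝ≥0∞ := fun x => ∏ j, ‖F j (proj j x)‖ₑ with hw
  have hwm : Measurable w := Finset.measurable_fun_prod _ fun j _ =>
    ((h.cont j).measurable.comp (continuous_proj j).measurable).enorm
  have hvol : ∫⁻ y, χ y = ENNReal.ofReal (∏ h, 2 * (L * (t * d h))) := by
    rw [hχ, lintegral_indicator_one measurableSet_Icc, Real.volume_Icc_pi,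
      ENNReal.ofReal_prod_of_nonneg fun i _ => by have := hd i; positivity]
    refine Finset.prod_congr rfl fun i _ => ?_
    congr 1
    simp only [hρ, Pi.neg_apply]
    ring
  calc _ ≤ ∫⁻ z : (Fin m → ℝ) × (Idx m → ℝ), (Set.Icc a₀ b₀).indicator w z.2 *
        χ (proj j z.2 + Amat J j *ᵥ z.1) := by
        refine lintegral_mono fun z => ?_
        by_cases hz1 : proj j z.2 ∈ (Amat J j).mulVec '' E
        swap
        · rw [Set.indicator_of_notMem (by exact hz1)]
          simp
        by_cases hz2 : ∀ a, |(z.2 a + (J *ᵥ z.1) a) / dd d t a| ≤ L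
        swap
        · rw [Set.indicator_of_notMem (a := fun a => (z.2 a + (J *ᵥ z.1) a) / dd d t a) (by exact hz2)]
          simp
        have hz3 : ∀ a, |z.2 a + (J *ᵥ z.1) a| ≤ L * dd d t a := fun a => by
          have h1 := hz2 a
          have h2 := dd_pos hd ht a
          rwa [abs_div, abs_of_pos h2, div_le_iff₀ h2] at h1
        obtain ⟨e, he, hex⟩ := hz1
        have hbox := h.mem_box hΔ j ht hL0 (hE e he) hex.symm hz3
        have hx : z.2 ∈ Set.Icc a₀ b₀ := by
          have : ∀ a, |z.2 a - (J *ᵥ q) a| ≤ r a :=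
            forall_idx_of_sel j (fun i => by rw [hr, rad_sel]; exact (hbox i).1)
              fun i => by rw [hr, rad_sel_one_sub]; exact (hbox i).2
          constructor <;> intro a <;> have := abs_le.1 (this a) <;>
            simp only [a₀, b₀, Pi.sub_apply, Pi.add_apply] <;> linarith
        have hp : proj j z.2 + Amat J j *ᵥ z.1 ∈ Set.Icc (-ρ) ρ := by
          have : ∀ i, |(proj j z.2 + Amat J j *ᵥ z.1) i| ≤ ρ i := fun i => by
            have := hz3 (sel j i)
            rwa [dd_sel, ← Amat_mulVec] at this
          constructor <;> intro i <;> have := abs_le.1 (this i) <;>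
            simp only [Pi.neg_apply] <;> linarith
        rw [Set.indicator_of_mem hx, hχ, Set.indicator_of_mem hp]
        refine mul_le_mul' ?_ (Set.indicator_le_self' (by simp) _)
        exact mul_le_of_le_one_left' (Set.indicator_le_self' (by simp) _)
    _ = ∫⁻ x, ∫⁻ p, (Set.Icc a₀ b₀).indicator w x * χ (proj j x + Amat J j *ᵥ p) := by
        rw [Measure.volume_eq_prod, lintegral_prod_symm']
        have := (continuous_proj j).measurable
        have := (continuous_mulVec (Amat J j)).measurable
        have := hwm.indicator (measurableSet_Icc (a := a₀) (b := b₀))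
        fun_prop
    _ = ENNReal.ofReal |(Amat J j).det|⁻¹ * ENNReal.ofReal (∏ h, 2 * (L * (t * d h))) *
          ∫⁻ x in Set.Icc a₀ b₀, w x := by
        have e1 : ∀ x, ∫⁻ p, (Set.Icc a₀ b₀).indicator w x * χ (proj j x + Amat J j *ᵥ p) =
            ENNReal.ofReal |(Amat J j).det|⁻¹ * ENNReal.ofReal (∏ h, 2 * (L * (t * d h))) *
            (Set.Icc a₀ b₀).indicator w x := fun x => by
          have := (continuous_mulVec (Amat J j)).measurable
          rw [lintegral_const_mul _ (by fun_prop),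
            lintegral_comp_mulVec_add (h.isUnit j).ne_zero hχm, hvol, mul_comm]
        simp only [e1]
        rw [lintegral_const_mul _ (hwm.indicator measurableSet_Icc),
          lintegral_indicator measurableSet_Icc]
    _ ≤ _ := by
        refine mul_le_mul' (mul_le_mul' (ENNReal.ofReal_le_ofReal (h.reg j).2.2) le_rfl) ?_
        have hX : 0 < 2 * L * ∏ h, max 1 (d h) := by
          have : 0 < ∏ h, max 1 (d h) := Finset.prod_pos fun i _ => by positivity
          positivity
        have hlen : ∀ a, b₀ a - a₀ a = 2 * r a := fun a => by
          simp only [a₀, b₀, Pi.sub_apply, Pi.add_apply]; ring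
        have key := lintegral_box_prod_le hm hα (inv_pos.2 hX) h.cont (a := a₀) (b := b₀)
          (fun a => by have := hr0 a; have := hlen a; linarith)
          (fun j' => inv_le_ecc hm (w := 2 * (cBox m Δ * t)) (by positivity) hX
            (fun i => by
              have := hlen (sel j' i)
              have := h.le_rad hΔ j ht hL0 (sel j' i)
              simp only [proj]; linarith)
            (fun i => by
              have := hlen (sel j' i)
              have := rad_le (d := d) hΔ j ht hL (sel j' i)
              simp only [proj]; linarith))
          (E := fun j => (Amat J j).mulVec '' B) (fun j' => by
            rintro _ ⟨e, he, rfl⟩ i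
            have h1 := abs_le.1 (h.abs_sub_le hΔ j' (hB e he) i)
            have h2 := h.le_rad hΔ j ht hL0 (sel j' i)
            have h3 := cBox_ge (m := m) hΔ
            have h4 : (2 * (m * Δ)) * t ≤ cBox m Δ * t := by gcongr; linarith
            simp only [a₀, b₀, proj, Pi.sub_apply, Pi.add_apply]
            constructor <;> linarith)
        refine key.trans (le_of_eq ?_)
        simp only [hlen]
        rw [Real.inv_rpow hX.le, Real.rpow_neg hX.le, inv_inv]

end

section
variable {m : ℕ} {Δ α : ℝ} {S : Finset (Fin m)} {J : Matrix (Idx m) (Fin m) ℝ}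
  {T : Set (ℤ × (Fin m → ℤ))} {Qt : ℤ × (Fin m → ℤ)} {d : Fin m → ℝ}
  {F : Corner m → (Fin m → ℝ) → ℝ}

lemma prod_dd_mul_rad_le (hd : ∀ h, 0 < d h) (hΔ : 1 ≤ Δ) (j : Corner m) {t L : ℝ} (ht : 0 < t)
    (hL : 1 ≤ L) (hα1 : α ≤ 1) :
    (∏ a, (dd d t a)⁻¹) * ((∏ h, 2 * (L * (t * d h))) * ((∏ a, 2 * rad Δ d j t L a) *
      ((2 * L * ∏ h, max 1 (d h)) ^ α) ^ 2)) ≤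
    ((16 * cBox m Δ ^ 2) ^ m * 4 * L ^ (2 * m + 2)) * (t ^ m * Pd α d) := by
  refine le_trans (le_of_eq ?_) (scale_coeff_le hd ht (cBox_pos (m := m) hΔ) hL hα1)
  rw [prod_idx_eq j, prod_idx_eq j]
  simp only [dd_sel, rad_sel, rad_sel_one_sub]
  rw [← mul_assoc, ← mul_assoc]
  congr 1
  simp only [← Finset.prod_mul_distrib]
  exact Finset.prod_congr rfl fun h _ => by ring

lemma tsum_ofReal_half_pow_le (K : ℝ) (hK : 0 ≤ K) :
    ∑' n : ℕ, ENNReal.ofReal (K * ((2:ℝ) ^ n)⁻¹) = ENNReal.ofReal (2 * K) := by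
  have h1 : HasSum (fun n : ℕ => K * ((2:ℝ) ^ n)⁻¹) (K * 2) := by
    have := hasSum_geometric_two.mul_left K
    simpa [one_div, inv_pow] using this
  rw [← ENNReal.ofReal_tsum_of_nonneg (fun n => by positivity) h1.summable, h1.tsum_eq, mul_comm]

lemma exists_single_scale_le (hm : 1 ≤ m) (hΔ : 1 ≤ Δ) (hα : 0 ≤ α) (hα1 : α ≤ 1)
    (S : Finset (Fin m)) :
    ∃ C : ℝ≥0, ∀ J T Qt d F, Adm Δ S J T Qt d F → ∀ (j : Corner m) (t : ℝ), 0 < t →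
      ∀ (q : Fin m → ℝ) (E B : Set (Fin m → ℝ)), MeasurableSet E →
      (∀ e ∈ E, ∀ k, |e k - q k| ≤ 2 * t) → (∀ e ∈ B, ∀ k, |e k - q k| ≤ 2 * t) →
      ∫⁻ z : (Fin m → ℝ) × (Idx m → ℝ),
        ({x | proj j x ∈ (Amat J j).mulVec '' E}.indicator 1 z.2 * ∏ j, ‖F j (proj j z.2)‖ₑ) *
          ‖ker J (dd d t) 0 0 z.1 z.2‖ₑ ≤
      C * (ENNReal.ofReal (Pd α d) * ENNReal.ofReal (t ^ m) *
        ∏ j, Mal α (F j) ((Amat J j).mulVec '' B)) := by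
  obtain ⟨c, hc0, hc⟩ := exists_prod_gd_le_tsum_indicator m (2 * m + 3)
  set K : ℝ := c * Δ * ((16 * cBox m Δ ^ 2) ^ m * 4) with hK
  have hK0 : 0 ≤ K := by positivity
  refine ⟨(2 * K).toNNReal, fun J T Qt d F h j t ht q E B hEm hE hB => ?_⟩
  have hd := h.pos
  have hdd := dd_pos hd ht
  have hD : 0 ≤ ∏ a, (dd d t a)⁻¹ := Finset.prod_nonneg fun a _ => (inv_pos.2 (hdd a)).le
  set M := ∏ j, Mal α (F j) ((Amat J j).mulVec '' B) with hM
  set w : (Fin m → ℝ) × (Idx m → ℝ) → ℝ≥0∞ := fun z =>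
    {x | proj j x ∈ (Amat J j).mulVec '' E}.indicator 1 z.2 * ∏ j, ‖F j (proj j z.2)‖ₑ with hw
  set X : ℕ → (Fin m → ℝ) × (Idx m → ℝ) → ℝ≥0∞ := fun n z =>
    {v : Idx m → ℝ | ∀ a, |v a| ≤ 2 ^ n}.indicator 1
          (fun a => (z.2 a + (J *ᵥ z.1) a) / dd d t a) with hX
  have hwm : Measurable w := by
    have h1 : MeasurableSet {x | proj j x ∈ (Amat J j).mulVec '' E} :=
      (continuous_proj j).measurable (measurableSet_mulVec_image (h.isUnit j) hEm)
    have h2 : Measurable fun x : Idx m → ℝ => ∏ j, ‖F j (proj j x)‖ₑ :=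
      Finset.measurable_fun_prod _ fun j _ =>
        ((h.cont j).measurable.comp (continuous_proj j).measurable).enorm
    exact ((measurable_one.indicator h1).comp measurable_snd).mul (h2.comp measurable_snd)
  have hXm : ∀ n, Measurable (X n) := fun n => by
    have h1 : MeasurableSet {v : Idx m → ℝ | ∀ a, |v a| ≤ 2 ^ n} := by
      simp only [Set.ofPred_forall]
      exact MeasurableSet.iInter fun a => measurableSet_le (by fun_prop) measurable_const
    refine (measurable_one.indicator h1).comp (measurable_pi_lambda _ fun a => ?_)
    have := (continuous_mulVec J).measurable
    fun_prop
  have hker : ∀ z : (Fin m → ℝ) × (Idx m → ℝ), ‖ker J (dd d t) 0 0 z.1 z.2‖ₑ ≤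
      ∑' n : ℕ, ENNReal.ofReal (∏ a, (dd d t a)⁻¹) *
        (ENNReal.ofReal (c * (((2:ℝ) ^ n) ^ (2 * m + 3))⁻¹) * X n z) := fun z => by
    rw [ker_zero_eq, enorm_mul, ENNReal.tsum_mul_left, Real.enorm_of_nonneg hD]
    refine mul_le_mul' le_rfl ?_
    rw [Real.enorm_of_nonneg (Finset.prod_nonneg fun a _ => by rw [gd_zero]; positivity)]
    exact hc _
  have hT := fun n : ℕ => h.lintegral_truncated_le hm hΔ hα j ht
    (one_le_pow₀ one_le_two : (1:ℝ) ≤ 2 ^ n) hE hB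
  change ∀ n : ℕ, ∫⁻ z, w z * X n z ≤ _ at hT
  rw [← hM] at hT
  change ∫⁻ z, w z * _ ≤ _
  clear_value w X M
  calc _ ≤ ∫⁻ z, ∑' n : ℕ, ENNReal.ofReal (∏ a, (dd d t a)⁻¹) *
        ENNReal.ofReal (c * (((2:ℝ) ^ n) ^ (2 * m + 3))⁻¹) * (w z * X n z) := by
        refine lintegral_mono fun z => (mul_le_mul' le_rfl (hker z)).trans (le_of_eq ?_)
        rw [← ENNReal.tsum_mul_left]
        exact tsum_congr fun n => by ring
    _ = ∑' n : ℕ, ENNReal.ofReal (∏ a, (dd d t a)⁻¹) *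
        ENNReal.ofReal (c * (((2:ℝ) ^ n) ^ (2 * m + 3))⁻¹) * ∫⁻ z, w z * X n z := by
        refine (lintegral_tsum fun n => ((hwm.mul (hXm n)).const_mul _).aemeasurable).trans ?_
        exact tsum_congr fun n => by
          exact lintegral_const_mul _ (hwm.mul (hXm n))
    _ ≤ ∑' n : ℕ, ENNReal.ofReal (K * ((2:ℝ) ^ n)⁻¹) *
          (ENNReal.ofReal (Pd α d) * ENNReal.ofReal (t ^ m) * M) := by
        refine ENNReal.tsum_le_tsum fun n => ?_
        have hL : (1:ℝ) ≤ 2 ^ n := one_le_pow₀ one_le_two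
        refine (mul_le_mul' le_rfl (hT n)).trans ?_
        have hP := prod_dd_mul_rad_le hd hΔ j ht hL hα1
        have hX0 : 0 ≤ ((2 * 2 ^ n * ∏ h, max 1 (d h)) ^ α) := by positivity
        have hρ0 : 0 ≤ ∏ h, 2 * (2 ^ n * (t * d h)) :=
          Finset.prod_nonneg fun i _ => by have := hd i; positivity
        rw [← ENNReal.ofReal_pow hX0]
        have hr0 : 0 ≤ ∏ a, 2 * rad Δ d j t (2 ^ n) a := Finset.prod_nonneg fun a _ => by
          have h1 := cBox_pos (m := m) hΔ
          have h2 := h.le_rad hΔ j ht (by linarith : (0:ℝ) ≤ 2 ^ n) a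
          have h3 : 0 ≤ cBox m Δ * t := by positivity
          linarith
        calc _ = ENNReal.ofReal ((c * Δ * (((2:ℝ) ^ n) ^ (2 * m + 3))⁻¹) *
              ((∏ a, (dd d t a)⁻¹) * ((∏ h, 2 * (2 ^ n * (t * d h))) *
              ((∏ a, 2 * rad Δ d j t (2 ^ n) a) *
              ((2 * 2 ^ n * ∏ h, max 1 (d h)) ^ α) ^ 2)))) * M := by
              rw [mul_right_comm c,
                ENNReal.ofReal_mul (by positivity : 0 ≤ c * (((2:ℝ) ^ n) ^ (2 * m + 3))⁻¹ * Δ),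
                ENNReal.ofReal_mul (by positivity : 0 ≤ c * (((2:ℝ) ^ n) ^ (2 * m + 3))⁻¹),
                ENNReal.ofReal_mul hD, ENNReal.ofReal_mul hρ0, ENNReal.ofReal_mul hr0]
              generalize ENNReal.ofReal (c * (((2:ℝ) ^ n) ^ (2 * m + 3))⁻¹) = y
              ring
          _ ≤ ENNReal.ofReal ((c * Δ * (((2:ℝ) ^ n) ^ (2 * m + 3))⁻¹) *
              (((16 * cBox m Δ ^ 2) ^ m * 4 * (2 ^ n) ^ (2 * m + 2)) * (t ^ m * Pd α d))) * M := by
              gcongr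
          _ = _ := by
              rw [← mul_assoc (ENNReal.ofReal (K * _)), ← ENNReal.ofReal_mul (Pd_nonneg hd),
                ← ENNReal.ofReal_mul (by positivity)]
              congr 2
              rw [hK]
              have : ((2:ℝ) ^ n) ^ (2 * m + 3) = (2 ^ n) ^ (2 * m + 2) * 2 ^ n := by ring
              rw [this]
              field_simp
    _ = _ := by
        rw [ENNReal.tsum_mul_right, tsum_ofReal_half_pow_le K hK0]
        rfl

end

section
variable {m : ℕ} {Δ α : ℝ} {S : Finset (Fin m)} {J : Matrix (Idx m) (Fin m) ℝ}
  {T : Set (ℤ × (Fin m → ℤ))} {Qt : ℤ × (Fin m → ℤ)} {d : Fin m → ℝ}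
  {F : Corner m → (Fin m → ℝ) → ℝ}

lemma mem_dC_floor (k : ℤ) (x : Fin m → ℝ) : x ∈ dC (k, fun i => ⌊x i / 2 ^ k⌋) := by
  intro i
  have h2 : (0:ℝ) < 2 ^ k := by positivity
  have h3 := Int.floor_le (x i / 2 ^ k)
  have h4 := Int.lt_floor_add_one (x i / 2 ^ k)
  rw [le_div_iff₀ h2] at h3
  rw [div_lt_iff₀ h2] at h4
  exact ⟨by linarith, by linarith⟩

lemma dC_subset_of_mem {Q Q' : ℤ × (Fin m → ℤ)} (hk : Q.1 ≤ Q'.1) {x : Fin m → ℝ} (hx : x ∈ dC Q)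
    (hx' : x ∈ dC Q') : dC Q ⊆ dC Q' := by
  obtain ⟨p, hp⟩ := Int.eq_ofNat_of_zero_le (sub_nonneg.2 hk)
  have h2 : (0:ℝ) < 2 ^ Q.1 := by positivity
  have hs : (2:ℝ) ^ Q'.1 = 2 ^ Q.1 * 2 ^ p := by
    rw [show Q'.1 = Q.1 + p by linarith, zpow_add₀ two_ne_zero, zpow_natCast]
  intro y hy i
  have a1 := hx i
  have a2 := hx' i
  have a3 := hy i
  rw [hs] at a2 ⊢
  have b1 : (Q'.2 i : ℝ) * 2 ^ p < Q.2 i + 1 := by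
    have := a2.1.trans_lt a1.2
    rw [mul_assoc, mul_lt_mul_iff_right₀ h2] at this
    linarith
  have b2 : (Q.2 i : ℝ) < (Q'.2 i + 1) * 2 ^ p := by
    have := a1.1.trans_lt a2.2
    rw [mul_assoc, mul_lt_mul_iff_right₀ h2] at this
    linarith
  have c1 : Q'.2 i * 2 ^ p ≤ Q.2 i := Int.lt_add_one_iff.1 (by exact_mod_cast b1)
  have c2 : Q.2 i + 1 ≤ (Q'.2 i + 1) * 2 ^ p := by
    have : Q.2 i < (Q'.2 i + 1) * 2 ^ p := by exact_mod_cast b2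
    linarith
  have d1 : (Q'.2 i : ℝ) * 2 ^ p ≤ Q.2 i := by exact_mod_cast c1
  have d2 : (Q.2 i : ℝ) + 1 ≤ (Q'.2 i + 1) * 2 ^ p := by exact_mod_cast c2
  constructor
  · calc (2:ℝ) ^ Q.1 * 2 ^ p * Q'.2 i = 2 ^ Q.1 * (Q'.2 i * 2 ^ p) := by ring
      _ ≤ 2 ^ Q.1 * Q.2 i := by gcongr
      _ ≤ _ := a3.1
  · calc y i < 2 ^ Q.1 * (Q.2 i + 1) := a3.2
      _ ≤ 2 ^ Q.1 * ((Q'.2 i + 1) * 2 ^ p) := by gcongr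
      _ = _ := by ring

lemma corner_mem_dC (Q : ℤ × (Fin m → ℤ)) : (fun i => (2:ℝ) ^ Q.1 * Q.2 i) ∈ dC Q := by
  intro i
  have : (0:ℝ) < 2 ^ Q.1 := by positivity
  exact ⟨le_rfl, by linarith⟩

lemma snd_eq_of_mem_dC {k : ℤ} {n n' : Fin m → ℤ} {x : Fin m → ℝ} (hx : x ∈ dC (k, n))
    (hx' : x ∈ dC (k, n')) : n = n' := by
  have h2 : (0:ℝ) < 2 ^ k := by positivity
  have key : ∀ {n : Fin m → ℤ}, x ∈ dC (k, n) → ∀ i, ⌊x i / 2 ^ k⌋ = n i := fun {n} h i => by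
    have := h i
    rw [Int.floor_eq_iff, le_div_iff₀ h2, div_lt_iff₀ h2]
    exact ⟨by linarith [this.1], by linarith [this.2]⟩
  funext i
  rw [← key hx i, key hx' i]

lemma volume_iUnion_dC (k : ℤ) (s : Set (Fin m → ℤ)) :
    volume (⋃ n : s, dC (k, (n : Fin m → ℤ))) = ∑' n : s, volume (dC (k, (n : Fin m → ℤ))) := by
  refine measure_iUnion (fun a b hab => ?_) fun n => measurableSet_dC _
  rw [Function.onFun, Set.disjoint_left]
  exact fun x hx hx' => hab (Subtype.ext (snd_eq_of_mem_dC hx hx'))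

lemma Tkset_eq_iUnion (T : Set (ℤ × (Fin m → ℤ))) (k : ℤ) :
    Tkset T k = ⋃ n : {n : Fin m → ℤ | (k, n) ∈ T}, dC (k, (n : Fin m → ℤ)) := by
  ext x
  simp only [Tkset, Set.mem_iUnion, Set.mem_ofPred_eq, Subtype.exists, exists_prop]
  constructor
  · rintro ⟨⟨k', n⟩, ⟨h1, rfl⟩, h3⟩
    exact ⟨n, h1, h3⟩
  · rintro ⟨n, h1, h2⟩
    exact ⟨(k, n), ⟨h1, rfl⟩, h2⟩

lemma Tkset_sdiff_eq_iUnion (T : Set (ℤ × (Fin m → ℤ))) (k : ℤ) :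
    Tkset T (k + 1) \ Tkset T k =
      ⋃ n : {n : Fin m → ℤ | (k, n) ∉ T ∧ ∃ Q ∈ T, Q.1 = k + 1 ∧ dC (k, n) ⊆ dC Q},
        dC (k, (n : Fin m → ℤ)) := by
  ext x
  simp only [Tkset, Set.mem_sdiff, Set.mem_iUnion, Set.mem_ofPred_eq, Subtype.exists, exists_prop, not_exists,
    not_and]
  constructor
  · rintro ⟨⟨Q, ⟨hQ, hk⟩, hx⟩, hn⟩
    refine ⟨fun i => ⌊x i / 2 ^ k⌋, ⟨fun h => hn _ ⟨h, rfl⟩ (mem_dC_floor k x), Q, hQ, hk,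
      dC_subset_of_mem (by simp [hk]) (mem_dC_floor k x) hx⟩, mem_dC_floor k x⟩
  · rintro ⟨n, ⟨h1, Q, hQ, hk, hs⟩, hx⟩
    refine ⟨⟨Q, ⟨hQ, hk⟩, hs hx⟩, ?_⟩
    rintro ⟨k', n'⟩ ⟨hT, rfl⟩ hx'
    rw [snd_eq_of_mem_dC hx hx'] at h1
    exact h1 hT

lemma ConvexTree.fst_le (hm : 1 ≤ m) (h : ConvexTree T Qt) {Q : ℤ × (Fin m → ℤ)} (hQ : Q ∈ T) :
    Q.1 ≤ Qt.1 := by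
  have h1 := measure_mono (μ := volume) (h.2.1 Q hQ)
  rw [volume_dC, volume_dC, ENNReal.ofReal_le_ofReal_iff (by positivity),
    pow_le_pow_iff_left₀ (by positivity) (by positivity) (by omega)] at h1
  exact (zpow_le_zpow_iff_right₀ one_lt_two).1 h1

lemma ConvexTree.Tkset_top (h : ConvexTree T Qt) : Tkset T Qt.1 = dC Qt := by
  refine Set.Subset.antisymm ?_ fun x hx => Set.mem_biUnion (x := Qt) ⟨h.1, rfl⟩ hx
  exact Set.iUnion₂_subset fun Q hQ => h.2.1 Q hQ.1

lemma ConvexTree.Tkset_of_lt (hm : 1 ≤ m) (h : ConvexTree T Qt) {k : ℤ} (hk : Qt.1 < k) :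
    Tkset T k = ∅ := by
  refine Set.subset_empty_iff.1 (Set.iUnion₂_subset fun Q hQ => ?_)
  have := h.fst_le hm hQ.1
  have := hQ.2
  omega

lemma ConvexTree.Tkset_subset (h : ConvexTree T Qt) {k : ℤ} (hk : k < Qt.1) :
    Tkset T k ⊆ Tkset T (k + 1) := by
  refine Set.iUnion₂_subset fun Q hQ => ?_
  obtain ⟨hQT, hQk⟩ := hQ
  set x : Fin m → ℝ := fun i => (2:ℝ) ^ Q.1 * Q.2 i
  have hx := corner_mem_dC Q
  have hP := mem_dC_floor (k + 1) x
  set P : ℤ × (Fin m → ℤ) := (k + 1, fun i => ⌊x i / 2 ^ (k + 1)⌋)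
  have h1 : dC Q ⊆ dC P := dC_subset_of_mem (by simp [P, hQk]) hx hP
  have h2 : dC P ⊆ dC Qt := dC_subset_of_mem (by simp only [P]; omega) hP (h.2.1 Q hQT hx)
  exact h1.trans (Set.subset_biUnion_of_mem (u := dC) (show P ∈ {q ∈ T | q.1 = k + 1} from
    ⟨h.2.2 Q hQT P h1 h2, rfl⟩))

end

section
variable {m : ℕ} {Δ α : ℝ} {S : Finset (Fin m)} {J : Matrix (Idx m) (Fin m) ℝ}
  {T : Set (ℤ × (Fin m → ℤ))} {Qt : ℤ × (Fin m → ℤ)} {d : Fin m → ℝ}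
  {F : Corner m → (Fin m → ℝ) → ℝ}

/-- The absolute form at scale `t` localized in the `j`-th corner to a set `E`. -/
def locForm (J : Matrix (Idx m) (Fin m) ℝ) (d : Fin m → ℝ) (F : Corner m → (Fin m → ℝ) → ℝ)
    (j : Corner m) (t : ℝ) (E : Set (Fin m → ℝ)) : ℝ≥0∞ :=
  ∫⁻ z : (Fin m → ℝ) × (Idx m → ℝ),
    ({x | proj j x ∈ (Amat J j).mulVec '' E}.indicator 1 z.2 * ∏ j, ‖F j (proj j z.2)‖ₑ) *
      ‖ker J (dd d t) 0 0 z.1 z.2‖ₑ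

lemma abs_sub_corner_le {Q : ℤ × (Fin m → ℤ)} {t : ℝ} (ht : (2:ℝ) ^ Q.1 ≤ 2 * t) {e : Fin m → ℝ}
    (he : e ∈ dC Q) (k : Fin m) : |e k - (2:ℝ) ^ Q.1 * Q.2 k| ≤ 2 * t := by
  have h0 := he k
  have h1 : (0:ℝ) < 2 ^ Q.1 := by positivity
  rw [abs_le]
  constructor <;> linarith [h0.1, h0.2]

lemma Adm.measurable_locForm_weight (h : Adm Δ S J T Qt d F) (j : Corner m) (t : ℝ)
    {E : Set (Fin m → ℝ)} (hE : MeasurableSet E) :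
    Measurable fun z : (Fin m → ℝ) × (Idx m → ℝ) =>
      ({x | proj j x ∈ (Amat J j).mulVec '' E}.indicator (1 : (Idx m → ℝ) → ℝ≥0∞) z.2 *
        ∏ j, ‖F j (proj j z.2)‖ₑ) * ‖ker J (dd d t) 0 0 z.1 z.2‖ₑ := by
  have h1 : MeasurableSet {x | proj j x ∈ (Amat J j).mulVec '' E} :=
    (continuous_proj j).measurable (measurableSet_mulVec_image (h.isUnit j) hE)
  have h2 : Measurable fun x : Idx m → ℝ => ∏ j, ‖F j (proj j x)‖ₑ :=
    Finset.measurable_fun_prod _ fun j _ =>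
      ((h.cont j).measurable.comp (continuous_proj j).measurable).enorm
  have h3 : Measurable fun z : (Fin m → ℝ) × (Idx m → ℝ) => ker J (dd d t) 0 0 z.1 z.2 :=
    (measurable_ker J 0 0).comp (measurable_const.prodMk measurable_id)
  exact (((measurable_one.indicator h1).comp measurable_snd).mul
    (h2.comp measurable_snd)).mul h3.enorm

lemma exists_locForm_iUnion_le (hm : 1 ≤ m) (hΔ : 1 ≤ Δ) (hα : 0 ≤ α) (hα1 : α ≤ 1)
    (S : Finset (Fin m)) :
    ∃ C : ℝ≥0, ∀ J T Qt d F, Adm Δ S J T Qt d F → ∀ (j : Corner m) (t : ℝ), 0 < t →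
      ∀ (k : ℤ) (s : Set (Fin m → ℤ)), t ≤ 2 ^ k →
      (∀ n ∈ s, ∃ Q ∈ T, (2:ℝ) ^ Q.1 ≤ 2 * t ∧ dC (k, n) ⊆ dC Q) →
      locForm J d F j t (⋃ n : s, dC (k, (n : Fin m → ℤ))) ≤
        C * (ENNReal.ofReal (Pd α d) * volume (⋃ n : s, dC (k, (n : Fin m → ℤ))) *
          ∏ j, MalTree α (F j) (Amat J j) T) := by
  obtain ⟨C, hC⟩ := exists_single_scale_le hm hΔ hα hα1 S
  refine ⟨C, fun J T Qt d F h j t ht k s htk hs => ?_⟩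
  have key : ∀ n : s, locForm J d F j t (dC (k, (n : Fin m → ℤ))) ≤
      C * (ENNReal.ofReal (Pd α d) * volume (dC (k, (n : Fin m → ℤ))) *
          ∏ j, MalTree α (F j) (Amat J j) T) := fun n => by
    obtain ⟨Q, hQ, hQt, hsub⟩ := hs n n.2
    refine (hC J T Qt d F h j t ht _ (dC (k, n)) (dC Q) (measurableSet_dC _)
      (fun e he => abs_sub_corner_le hQt (hsub he)) fun e he => abs_sub_corner_le hQt he).trans ?_
    rw [volume_dC]
    gcongr with j' _
    exact le_iSup₂_of_le Q hQ le_rfl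
  have hU : locForm J d F j t (⋃ n : s, dC (k, (n : Fin m → ℤ))) ≤
      ∑' n : s, locForm J d F j t (dC (k, (n : Fin m → ℤ))) := by
    unfold locForm
    rw [← lintegral_tsum fun n => (h.measurable_locForm_weight j t (measurableSet_dC _)).aemeasurable]
    refine lintegral_mono fun z => ?_
    dsimp only
    rw [ENNReal.tsum_mul_right, ENNReal.tsum_mul_right]
    refine mul_le_mul' (mul_le_mul' ?_ le_rfl) le_rfl
    by_cases hz : proj j z.2 ∈ (Amat J j).mulVec '' ⋃ n : s, dC (k, (n : Fin m → ℤ))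
    · obtain ⟨e, he, hez⟩ := hz
      obtain ⟨n, hn⟩ := Set.mem_iUnion.1 he
      refine le_trans ?_ (ENNReal.le_tsum n)
      rw [Set.indicator_of_mem (show z.2 ∈ {x | proj j x ∈ (Amat J j).mulVec '' dC (k, (n : Fin m → ℤ))}
        from ⟨e, hn, hez⟩)]
      exact Set.indicator_le_self' (by simp) _
    · rw [Set.indicator_of_notMem (by exact hz)]
      exact zero_le
  refine hU.trans ((ENNReal.tsum_le_tsum key).trans (le_of_eq ?_))
  rw [volume_iUnion_dC, ENNReal.tsum_mul_left, ENNReal.tsum_mul_right, ENNReal.tsum_mul_left]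

lemma enorm_V_le_lintegral_ker (W : (Idx m → ℝ) → ℝ) (σ : Idx m → ℝ) (β : Idx m → ℕ)
    (u : Idx m → ℝ) :
    ‖V J W σ β u‖ₑ ≤ ∫⁻ z : (Fin m → ℝ) × (Idx m → ℝ), ‖W z.2‖ₑ * ‖ker J σ β u z.1 z.2‖ₑ := by
  refine (enorm_integral_le_lintegral_enorm _).trans (le_of_eq ?_)
  simp only [enorm_mul]

lemma enorm_finsetProd {ι : Type*} (s : Finset ι) (f : ι → ℝ) :
    ‖∏ i ∈ s, f i‖ₑ = ∏ i ∈ s, ‖f i‖ₑ := by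
  simp only [enorm_eq_nnnorm, nnnorm_prod, ENNReal.ofNNReal_finsetProd]

lemma Wk_eq_zero_of_notMem {k : ℤ} {x : Idx m → ℝ} {j : Corner m}
    (hx : proj j x ∉ (Amat J j).mulVec '' Tkset T k) : Wk J T F k x = 0 :=
  Finset.prod_eq_zero (Finset.mem_univ j) (Set.indicator_of_notMem hx _)

lemma Wk_eq_of_mem {k : ℤ} {x : Idx m → ℝ}
    (hx : ∀ j, proj j x ∈ (Amat J j).mulVec '' Tkset T k) : Wk J T F k x = ∏ j, F j (proj j x) :=
  Finset.prod_congr rfl fun j _ => Set.indicator_of_mem (hx j) _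

lemma enorm_Wk_le (j : Corner m) (k : ℤ) (x : Idx m → ℝ) :
    ‖Wk J T F k x‖ₑ ≤ {x | proj j x ∈ (Amat J j).mulVec '' Tkset T k}.indicator 1 x *
      ∏ j, ‖F j (proj j x)‖ₑ := by
  by_cases hx : ∀ j, proj j x ∈ (Amat J j).mulVec '' Tkset T k
  · rw [Wk_eq_of_mem hx, Set.indicator_of_mem (by exact hx j), enorm_finsetProd]
    simp
  · push Not at hx
    obtain ⟨j', hj'⟩ := hx
    simp [Wk_eq_zero_of_notMem hj']

lemma enorm_Wk_sub_le {k : ℤ} (hk : Tkset T k ⊆ Tkset T (k + 1)) (x : Idx m → ℝ) :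
    ‖Wk J T F (k + 1) x - Wk J T F k x‖ₑ ≤
      ∑ j, {x | proj j x ∈ (Amat J j).mulVec '' (Tkset T (k + 1) \ Tkset T k)}.indicator 1 x *
        ∏ j, ‖F j (proj j x)‖ₑ := by
  by_cases h1 : ∀ j, proj j x ∈ (Amat J j).mulVec '' Tkset T k
  · rw [Wk_eq_of_mem h1, Wk_eq_of_mem fun j => Set.image_mono hk (h1 j)]
    simp
  push Not at h1
  obtain ⟨j, hj⟩ := h1
  rw [Wk_eq_zero_of_notMem hj, sub_zero]
  by_cases h2 : ∀ j, proj j x ∈ (Amat J j).mulVec '' Tkset T (k + 1)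
  swap
  · push Not at h2
    obtain ⟨j', hj'⟩ := h2
    simp [Wk_eq_zero_of_notMem hj']
  refine le_trans ?_ (Finset.single_le_sum (fun _ _ => zero_le) (Finset.mem_univ j))
  obtain ⟨e, he, hex⟩ := h2 j
  have hmem : x ∈ {x | proj j x ∈ (Amat J j).mulVec '' (Tkset T (k + 1) \ Tkset T k)} :=
    ⟨e, ⟨he, fun he' => hj ⟨e, he', hex⟩⟩, hex⟩
  rw [Wk_eq_of_mem h2, Set.indicator_of_mem hmem, enorm_finsetProd]
  simp

lemma enorm_V_Wk_le (j : Corner m) (k : ℤ) (t : ℝ) :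
    ‖V J (Wk J T F k) (dd d t) 0 0‖ₑ ≤ locForm J d F j t (Tkset T k) :=
  (enorm_V_le_lintegral_ker _ _ _ _).trans
    (lintegral_mono fun z => mul_le_mul' (enorm_Wk_le j k z.2) le_rfl)

lemma Adm.enorm_V_Wk_sub_le (h : Adm Δ S J T Qt d F) {k : ℤ} (hk : k < Qt.1) {t : ℝ} (ht : 0 < t) :
    ‖V J (Wk J T F (k + 1)) (dd d t) 0 0 - V J (Wk J T F k) (dd d t) 0 0‖ₑ ≤
      ∑ j, locForm J d F j t (Tkset T (k + 1) \ Tkset T k) := by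
  have hd : ∀ a, dd d t a ≠ 0 := fun a => (dd_pos h.pos ht a).ne'
  have hJ := (h.isUnit 0).ne_zero
  have e : V J (Wk J T F (k + 1)) (dd d t) 0 0 - V J (Wk J T F k) (dd d t) 0 0 =
      V J (fun x => Wk J T F (k + 1) x - Wk J T F k x) (dd d t) 0 0 := by
    unfold V
    rw [← integral_sub (integrable_V hJ (h.integrable_Wk _) hd 0 0)
      (integrable_V hJ (h.integrable_Wk _) hd 0 0)]
    simp only [sub_mul]
  rw [e]
  refine (enorm_V_le_lintegral_ker _ _ _ _).trans ?_
  unfold locForm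
  rw [← lintegral_finsetSum _ fun j _ => h.measurable_locForm_weight j t
    ((measurableSet_Tkset _ _).diff (measurableSet_Tkset _ _))]
  refine lintegral_mono fun z => ?_
  dsimp only
  rw [← Finset.sum_mul]
  exact mul_le_mul' (enorm_Wk_sub_le (h.tree.Tkset_subset hk) z.2) le_rfl

end

section
variable {m : ℕ} {Δ α : ℝ} {S : Finset (Fin m)} {J : Matrix (Idx m) (Fin m) ℝ}
  {T : Set (ℤ × (Fin m → ℤ))} {Qt : ℤ × (Fin m → ℤ)} {d : Fin m → ℝ}
  {F : Corner m → (Fin m → ℝ) → ℝ}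

lemma ConvexTree.sum_volume_le (h : ConvexTree T Qt) (n : ℕ) :
    volume (Tkset T (Qt.1 - n)) + ∑ i ∈ Finset.range n,
      volume (Tkset T (Qt.1 - (i + 1) + 1) \ Tkset T (Qt.1 - (i + 1))) ≤ volume (dC Qt) := by
  induction n with
  | zero => simp [h.Tkset_top]
  | succ n ih =>
    refine le_trans ?_ ih
    rw [Finset.sum_range_succ, add_comm (∑ i ∈ Finset.range n, _), ← add_assoc]
    gcongr
    have hsub := h.Tkset_subset (k := Qt.1 - (n + 1)) (by omega)
    rw [show Qt.1 - (n + 1) + 1 = Qt.1 - n by ring] at hsub ⊢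
    push_cast
    have hv := measure_sdiff_add_inter (μ := volume) (Tkset T (Qt.1 - n))
      (measurableSet_Tkset T (Qt.1 - (n + 1)))
    rw [Set.inter_eq_self_of_subset_right hsub] at hv
    rw [add_comm, hv]

/-- The sum of all boundary terms of the telescoping over the scales of a tree. -/
lemma exists_boundary_le (hm : 1 ≤ m) (hΔ : 1 ≤ Δ) (hα : 0 ≤ α) (hα1 : α ≤ 1)
    (S : Finset (Fin m)) :
    ∃ C : ℝ≥0, ∀ J T Qt d F, Adm Δ S J T Qt d F → ∀ n : ℕ,
      ‖V J (Wk J T F Qt.1) (dd d (2 ^ Qt.1)) 0 0‖ₑ +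
      ∑ i ∈ Finset.range n, ‖V J (Wk J T F (Qt.1 - (i + 1) + 1)) (dd d (2 ^ (Qt.1 - (i + 1)))) 0 0 -
        V J (Wk J T F (Qt.1 - (i + 1))) (dd d (2 ^ (Qt.1 - (i + 1)))) 0 0‖ₑ +
      ‖V J (Wk J T F (Qt.1 - n)) (dd d (2 ^ (Qt.1 - n - 1))) 0 0‖ₑ ≤ C * rhs α J T Qt d F := by
  obtain ⟨C, hC⟩ := exists_locForm_iUnion_le hm hΔ hα hα1 S
  refine ⟨C * (1 + Fintype.card (Corner m)), fun J T Qt d F h n => ?_⟩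
  have htop : ‖V J (Wk J T F Qt.1) (dd d (2 ^ Qt.1)) 0 0‖ₑ ≤ C * rhs α J T Qt d F := by
    refine (enorm_V_Wk_le (fun _ => 0) _ _).trans ?_
    have := hC J T Qt d F h (fun _ => 0) (2 ^ Qt.1) (by positivity) Qt.1 {n | (Qt.1, n) ∈ T} le_rfl
      fun n hn => ⟨_, hn, le_mul_of_one_le_left (zpow_pos two_pos _).le one_le_two, subset_rfl⟩
    rw [← Tkset_eq_iUnion] at this
    refine this.trans ?_
    rw [h.tree.Tkset_top, rhs]
  set P := ∏ j, MalTree α (F j) (Amat J j) T with hP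
  have hlow : ∀ k : ℤ, ‖V J (Wk J T F k) (dd d (2 ^ (k - 1))) 0 0‖ₑ ≤
      C * (ENNReal.ofReal (Pd α d) * volume (Tkset T k) * P) := by
    intro k
    refine (enorm_V_Wk_le (fun _ => 0) _ _).trans ?_
    have := hC J T Qt d F h (fun _ => 0) (2 ^ (k - 1)) (by positivity) k {n | (k, n) ∈ T}
      (zpow_le_zpow_right₀ one_le_two (by omega))
      fun n hn => ⟨_, hn, by rw [zpow_sub_one₀ two_ne_zero]; linarith, subset_rfl⟩
    rwa [← Tkset_eq_iUnion] at this
  have hdiff : ∀ k < Qt.1, ‖V J (Wk J T F (k + 1)) (dd d (2 ^ k)) 0 0 -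
        V J (Wk J T F k) (dd d (2 ^ k)) 0 0‖ₑ ≤ Fintype.card (Corner m) *
      (C * (ENNReal.ofReal (Pd α d) * volume (Tkset T (k + 1) \ Tkset T k) * P)) := by
    intro k hk
    refine (h.enorm_V_Wk_sub_le hk (by positivity)).trans ?_
    rw [← nsmul_eq_mul, ← Finset.card_univ]
    refine Finset.sum_le_card_nsmul _ _ _ fun j _ => ?_
    have := hC J T Qt d F h j (2 ^ k) (by positivity) k
      {n | (k,n)∉T ∧ ∃ Q∈T, Q.1=k+1 ∧ dC (k,n) ⊆ dC Q} le_rfl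
      fun n hn => by
        obtain ⟨Q, hQ, h1, h2⟩ := hn.2
        exact ⟨Q, hQ, by rw [h1, zpow_add_one₀ two_ne_zero]; linarith, h2⟩
    rwa [← Tkset_sdiff_eq_iUnion] at this
  have hvol := h.tree.sum_volume_le n
  have hlow' : ‖V J (Wk J T F (Qt.1 - n)) (dd d (2 ^ (Qt.1 - n - 1))) 0 0‖ₑ ≤
      Fintype.card (Corner m) *
      (C * (ENNReal.ofReal (Pd α d) * volume (Tkset T (Qt.1 - n)) * P)) := by
    refine (hlow _).trans (le_mul_of_one_le_left (by simp) ?_)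
    exact_mod_cast Fintype.card_pos
  rw [add_assoc]
  refine (add_le_add htop (add_le_add (Finset.sum_le_sum fun i _ => hdiff _ (by omega))
    hlow')).trans ?_
  push_cast
  rw [mul_add, add_mul, mul_one]
  refine add_le_add le_rfl ?_
  rw [← Finset.mul_sum, ← Finset.mul_sum, ← Finset.sum_mul, ← Finset.mul_sum, ← mul_add, ← mul_add,
    ← add_mul, ← mul_add, rhs, mul_comm (C : ℝ≥0∞) (Fintype.card _),
    mul_assoc (Fintype.card (Corner m) : ℝ≥0∞)]
  refine mul_le_mul' le_rfl (mul_le_mul' le_rfl (mul_le_mul' (mul_le_mul' le_rfl ?_) le_rfl))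
  rwa [add_comm]

end

section
variable {m : ℕ} {Δ α : ℝ} {S : Finset (Fin m)} {J : Matrix (Idx m) (Fin m) ℝ}
  {T : Set (ℤ × (Fin m → ℤ))} {Qt : ℤ × (Fin m → ℤ)} {d : Fin m → ℝ}
  {F : Corner m → (Fin m → ℝ) → ℝ}

/-- The second order derivatives outside of `S` to which the symmetric directions reduce. -/
def outer (S : Finset (Fin m)) : Finset (Idx m → ℕ) :=
  ((Sᶜ ×ˢ Sᶜ).image fun p => Pi.single (Sum.inr p.1) 1 + Pi.single (Sum.inr p.2) 1) ∪
    Sᶜ.image fun h => Pi.single (Sum.inl h) 2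

lemma single_two (a : Idx m) : (Pi.single a 2 : Idx m → ℕ) = Pi.single a 1 + Pi.single a 1 := by
  rw [← Pi.single_add]

lemma eq_zero_of_mem_outer {b : Idx m → ℕ} (hb : b ∈ outer S) (a : Idx m) (ha : ix a ∈ S) :
    b a = 0 := by
  have hne : ∀ h : Fin m, h ∉ S → a ≠ Sum.inl h ∧ a ≠ Sum.inr h := by
    rintro h hh
    constructor <;> rintro rfl <;> exact hh ha
  simp only [outer, Finset.mem_union, Finset.mem_image, Finset.mem_product, Finset.mem_compl,
    Prod.exists] at hb
  rcases hb with ⟨h, h', ⟨h1, h2⟩, rfl⟩ | ⟨h, h1, rfl⟩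
  · simp [Pi.single_eq_of_ne (hne h h1).2, Pi.single_eq_of_ne (hne h' h2).2]
  · simp [Pi.single_eq_of_ne (hne h h1).1]

lemma sum_of_mem_outer {b : Idx m → ℕ} (hb : b ∈ outer S) : ∑ a, b a = 2 := by
  simp only [outer, Finset.mem_union, Finset.mem_image, Finset.mem_product, Finset.mem_compl,
    Prod.exists] at hb
  rcases hb with ⟨h, h', ⟨h1, h2⟩, rfl⟩ | ⟨h, h1, rfl⟩
  · simp only [Pi.add_apply, Finset.sum_add_distrib, Finset.sum_pi_single', Finset.mem_univ,
      if_true]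
  · simp only [Finset.sum_pi_single', Finset.mem_univ, if_true]

/-- A constant for the reduction of the symmetric directions. -/
def cOuter (m : ℕ) (Δ : ℝ) : ℝ := m * ((m * (m * (Δ * cInv m Δ))) ^ 2 + 2)

lemma Adm.abs_laplace_add_le (h : Adm Δ S J T Qt d F) (hΔ : 1 ≤ Δ) {W : (Idx m → ℝ) → ℝ}
    (hW : Integrable W) {t : ℝ} (ht : 0 < t) :
    |∑ a, V J W (dd d t) (Pi.single a 2) 0 +
      2 * ∑ i ∈ S, V J W (dd d t) (Pi.single (Sum.inl i) 1 + Pi.single (Sum.inr i) 1) 0| ≤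
    cOuter m Δ * ∑ b ∈ outer S, |V J W (dd d t) b 0| := by
  set v : (Idx m → ℕ) → ℝ := fun b => V J W (dd d t) b 0 with hv
  set B : ℝ := m * (Δ * cInv m Δ) with hB
  have hB0 : 0 ≤ B := by rw [hB]; unfold cInv; positivity
  set R := ∑ b ∈ outer S, |v b| with hR
  have hR0 : 0 ≤ R := Finset.sum_nonneg fun _ _ => abs_nonneg _
  have hmem : ∀ b ∈ outer S, |v b| ≤ R := fun b hb =>
    Finset.single_le_sum (f := fun b => |v b|) (fun _ _ => abs_nonneg _) hb
  have hrr : ∀ i ∈ Sᶜ, ∀ i' ∈ Sᶜ, |v (Pi.single (Sum.inr i) 1 + Pi.single (Sum.inr i') 1)| ≤ R :=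
    fun i hi i' hi' => hmem _ (Finset.mem_union_left _ (Finset.mem_image.2
      ⟨(i, i'), Finset.mem_product.2 ⟨hi, hi'⟩, rfl⟩))
  set g : Fin m → ℝ := fun i => v (Pi.single (Sum.inl i) 2) + v (Pi.single (Sum.inr i) 2) +
    if i ∈ S then 2 * v (Pi.single (Sum.inl i) 1 + Pi.single (Sum.inr i) 1) else 0 with hg
  have hsum : ∑ a, v (Pi.single a 2) +
      2 * ∑ i ∈ S, v (Pi.single (Sum.inl i) 1 + Pi.single (Sum.inr i) 1) = ∑ i, g i := by
    rw [hg, Finset.sum_add_distrib, Finset.sum_add_distrib, Fintype.sum_sum_type,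
      Finset.sum_ite_mem, Finset.univ_inter, Finset.mul_sum]
  change |∑ a, v (Pi.single a 2) +
      2 * ∑ i ∈ S, v (Pi.single (Sum.inl i) 1 + Pi.single (Sum.inr i) 1)| ≤ _
  rw [hsum]
  have hgle : ∀ i, |g i| ≤ ((m * B) ^ 2 + 2) * R := by
    intro i
    have hcard : ((Sᶜ.card : ℕ) : ℝ) ≤ m := by
      exact_mod_cast (Finset.card_le_univ _).trans (by simp)
    by_cases hi : i ∈ S
    · obtain ⟨b, hb, hbv⟩ := V_ibp_corner hΔ h.reg h.row h.pos h.le h.eq (fun _ => 0) i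
      simp only [sel_zero, if_pos hi, sub_zero, sel_one] at hbv
      have h1 := hbv hW ht (Pi.single (Sum.inl i) 1) 0
      have h2 := hbv hW ht (Pi.single (Sum.inr i) 1) 0
      rw [← single_two] at h1 h2
      have e : g i = ∑ h ∈ Sᶜ, b h * ∑ h' ∈ Sᶜ, b h' *
          v (Pi.single (Sum.inr h) 1 + Pi.single (Sum.inr h') 1) := by
        have h3 : ∀ h' : Fin m, _ := fun h' => hbv hW ht (Pi.single (Sum.inr h') 1) 0
        rw [hg]
        simp only [if_pos hi, hv]
        rw [add_comm (Pi.single (Sum.inr i) 1) (Pi.single (Sum.inl i) 1)] at h2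
        rw [two_mul, add_add_add_comm, h1,
          add_comm (V J W (dd d t) (Pi.single (Sum.inr i) 2) 0), h2, ← Finset.sum_add_distrib]
        refine Finset.sum_congr rfl fun h' _ => ?_
        rw [← h3 h', ← mul_add, add_comm (Pi.single (Sum.inl i) 1),
          add_comm (Pi.single (Sum.inr i) 1)]
      rw [e]
      have hin : ∀ h ∈ Sᶜ, |∑ h' ∈ Sᶜ, b h' *
          v (Pi.single (Sum.inr h) 1 + Pi.single (Sum.inr h') 1)| ≤ m * (B * R) := by
        intro h hh
        refine (Finset.abs_sum_le_sum_abs _ _).trans ((Finset.sum_le_card_nsmul _ _ (B * R)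
          fun h' hh' => ?_).trans ?_)
        · rw [abs_mul]
          exact mul_le_mul (hb _) (hrr h hh h' hh') (abs_nonneg _) hB0
        · rw [nsmul_eq_mul]; gcongr
      refine (Finset.abs_sum_le_sum_abs _ _).trans ((Finset.sum_le_card_nsmul _ _
        (B * (m * (B * R))) fun h hh => ?_).trans ?_)
      · rw [abs_mul]
        exact mul_le_mul (hb _) (hin h hh) (abs_nonneg _) hB0
      · rw [nsmul_eq_mul]
        refine (mul_le_mul_of_nonneg_right hcard (by positivity)).trans ?_
        nlinarith
    · have hi' : i ∈ Sᶜ := Finset.mem_compl.2 hi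
      have h1 := hrr i hi' i hi'
      rw [← single_two] at h1
      have h2 := hmem (Pi.single (Sum.inl i) 2) (Finset.mem_union_right _
        (Finset.mem_image_of_mem _ hi'))
      rw [hg]
      simp only [if_neg hi, add_zero]
      refine (abs_add_le _ _).trans ?_
      nlinarith [sq_nonneg (m * B)]
  refine (Finset.abs_sum_le_sum_abs _ _).trans ((Finset.sum_le_card_nsmul _ _ _
    fun i _ => hgle i).trans (le_of_eq ?_))
  rw [nsmul_eq_mul, cOuter, Finset.card_univ, Fintype.card_fin]
  ring

lemma sc_univ_dd (d : Fin m → ℝ) (s : ℝ) : sc Finset.univ s (dd d 1) = dd d s := by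
  ext a; simp [sc, dd]

lemma Adm.integrableOn_V (h : Adm Δ S J T Qt d F) (k : ℤ) (β : Idx m → ℕ) :
    IntegrableOn (fun t => V J (Wk J T F k) (dd d t) β 0 * t⁻¹)
      (Set.Ioc ((2:ℝ)^(k-1)) ((2:ℝ)^k)) := by
  have hc := continuousOn_V_scale (h.isUnit fun _ => 0).ne_zero (h.integrable_Wk k) Finset.univ
    (dd_pos h.pos one_pos) β
  simp only [sc_univ_dd] at hc
  refine IntegrableOn.mono_set ?_ Set.Ioc_subset_Icc_self
  refine ContinuousOn.integrableOn_Icc ?_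
  have hsub : Set.Icc ((2:ℝ)^(k-1)) ((2:ℝ)^k) ⊆ Set.Ioi 0 := fun t ht =>
    (zpow_pos two_pos _).trans_le ht.1
  exact (hc.mono hsub).mul (continuousOn_inv₀.mono fun t ht => (hsub ht).ne')

lemma Adm.integrableOn_abs_V (h : Adm Δ S J T Qt d F) (k : ℤ) (β : Idx m → ℕ) :
    IntegrableOn (fun t => |V J (Wk J T F k) (dd d t) β 0| * t⁻¹)
      (Set.Ioc ((2:ℝ)^(k-1)) ((2:ℝ)^k)) := by
  refine IntegrableOn.congr_fun (f := fun t => |V J (Wk J T F k) (dd d t) β 0 * t⁻¹|)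
    (Integrable.abs (h.integrableOn_V k β)) (fun t ht => ?_) measurableSet_Ioc
  simp only [abs_mul, abs_of_pos (inv_pos.2 (pos_of_mem_Ioc ht))]

lemma Adm.ofReal_integral_abs_V (h : Adm Δ S J T Qt d F) (k : ℤ) (β : Idx m → ℕ) :
    ENNReal.ofReal (∫ t in Set.Ioc ((2:ℝ)^(k-1)) ((2:ℝ)^k),
      |V J (Wk J T F k) (dd d t) β 0| * t⁻¹) =
    ∫⁻ t in Set.Ioc ((2:ℝ)^(k-1)) ((2:ℝ)^k),
      ‖V J (Wk J T F k) (dd d t) β 0‖ₑ * ENNReal.ofReal t⁻¹ := by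
  rw [ofReal_integral_eq_lintegral_ofReal (h.integrableOn_abs_V k β)]
  · refine setLIntegral_congr_fun measurableSet_Ioc fun t ht => ?_
    simp only [ENNReal.ofReal_mul (abs_nonneg _), Real.enorm_eq_ofReal_abs]
  · refine (ae_restrict_iff' measurableSet_Ioc).2 (ae_of_all _ fun t ht => ?_)
    exact mul_nonneg (abs_nonneg _) (inv_pos.2 (pos_of_mem_Ioc ht)).le

lemma Adm.integral_laplace (h : Adm Δ S J T Qt d F) (k : ℤ) :
    ∫ t in Set.Ioc ((2:ℝ)^(k-1)) ((2:ℝ)^k),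
      (∑ a, V J (Wk J T F k) (dd d t) (Pi.single a 2) 0) * t⁻¹ =
    2 * Real.pi * (V J (Wk J T F k) (dd d (2 ^ k)) 0 0 -
      V J (Wk J T F k) (dd d (2 ^ (k - 1))) 0 0) := by
  have hle : (2:ℝ)^(k-1) ≤ (2:ℝ)^k := zpow_le_zpow_right₀ one_le_two (by omega)
  have e := V_scale_sub (h.isUnit fun _ => 0).ne_zero (h.integrable_Wk k) Finset.univ
    (dd_pos h.pos one_pos) 0 (zpow_pos two_pos (k - 1)) hle
  simp only [sc_univ_dd, Pi.zero_apply, Finset.sum_const_zero, pow_zero, _root_.inv_one, one_mul,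
    zero_add] at e
  rw [e, intervalIntegral.integral_of_le hle, ← integral_const_mul]
  refine integral_congr_ae (ae_of_all _ fun t => ?_)
  simp only
  field_simp

lemma Adm.two_mul_integral_abs_V_le (h : Adm Δ S J T Qt d F) (hΔ : 1 ≤ Δ) {i : Fin m} (hi : i ∈ S)
    (k : ℤ) :
    2 * ∫ t in Set.Ioc ((2:ℝ)^(k-1)) ((2:ℝ)^k), |V J (Wk J T F k) (dd d t)
      (Pi.single (Sum.inl i) 1 + Pi.single (Sum.inr i) 1) 0| * t⁻¹ ≤
    cOuter m Δ * (∑ b ∈ outer S, ∫ t in Set.Ioc ((2:ℝ)^(k-1)) ((2:ℝ)^k),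
      |V J (Wk J T F k) (dd d t) b 0| * t⁻¹) -
    2 * Real.pi * (V J (Wk J T F k) (dd d (2 ^ k)) 0 0 -
      V J (Wk J T F k) (dd d (2 ^ (k - 1))) 0 0) := by
  have hL : IntegrableOn (fun t => (∑ a, V J (Wk J T F k) (dd d t) (Pi.single a 2) 0) * t⁻¹)
      (Set.Ioc ((2:ℝ)^(k-1)) ((2:ℝ)^k)) := by
    simp only [Finset.sum_mul]
    exact integrable_finsetSum _ fun a _ => h.integrableOn_V k _
  have hR : IntegrableOn (fun t => ∑ b ∈ outer S, |V J (Wk J T F k) (dd d t) b 0| * t⁻¹)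
      (Set.Ioc ((2:ℝ)^(k-1)) ((2:ℝ)^k)) :=
    integrable_finsetSum _ fun a _ => h.integrableOn_abs_V k _
  rw [← integral_finsetSum _ fun b _ => h.integrableOn_abs_V k b, ← h.integral_laplace,
    ← integral_const_mul, ← integral_const_mul, ← integral_sub (hR.const_mul _) hL]
  refine setIntegral_mono_on ((h.integrableOn_abs_V k _).const_mul _)
    ((hR.const_mul _).sub hL) measurableSet_Ioc fun t ht => ?_
  have ht0 := pos_of_mem_Ioc ht
  have key := (abs_le.1 (h.abs_laplace_add_le hΔ (h.integrable_Wk k) ht0)).2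
  have hle : |V J (Wk J T F k) (dd d t)
      (Pi.single (Sum.inl i) 1 + Pi.single (Sum.inr i) 1) 0| ≤ ∑ i ∈ S, V J (Wk J T F k) (dd d t)
      (Pi.single (Sum.inl i) 1 + Pi.single (Sum.inr i) 1) 0 := by
    rw [abs_of_nonneg (h.V_nonneg hi k ht0)]
    exact Finset.single_le_sum (f := fun i => V J (Wk J T F k) (dd d t)
      (Pi.single (Sum.inl i) 1 + Pi.single (Sum.inr i) 1) 0) (fun i hi => h.V_nonneg hi k ht0) hi
  rw [← Finset.sum_mul, ← mul_assoc, ← mul_assoc, ← sub_mul]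
  exact mul_le_mul_of_nonneg_right (by linarith) (inv_pos.2 ht0).le

end

section
variable {m : ℕ} {Δ α : ℝ} {S : Finset (Fin m)} {J : Matrix (Idx m) (Fin m) ℝ}
  {T : Set (ℤ × (Fin m → ℤ))} {Qt : ℤ × (Fin m → ℤ)} {d : Fin m → ℝ}
  {F : Corner m → (Fin m → ℝ) → ℝ}

lemma sum_range_scales_eq (p : ℤ → ℤ → ℝ) (K : ℤ) (n : ℕ) :
    ∑ i ∈ Finset.range (n + 1), (p (K - i) (K - i) - p (K - i) (K - i - 1)) =
      p K K - ∑ i ∈ Finset.range n, (p (K - (i + 1) + 1) (K - (i + 1)) -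
        p (K - (i + 1)) (K - (i + 1))) - p (K - n) (K - n - 1) := by
  induction n with
  | zero => simp
  | succ n ih =>
    rw [Finset.sum_range_succ, ih, Finset.sum_range_succ _ n]
    push_cast
    rw [show K - ((n : ℤ) + 1) + 1 = K - n by ring, show K - (n : ℤ) - 1 = K - (n + 1) by ring]
    ring

lemma V_zero_left (J : Matrix (Idx m) (Fin m) ℝ) (σ : Idx m → ℝ) (β : Idx m → ℕ) (u : Idx m → ℝ) :
    V J 0 σ β u = 0 := by
  simp [V]

lemma Adm.Wk_of_lt (h : Adm Δ S J T Qt d F) (hm : 1 ≤ m) {k : ℤ} (hk : Qt.1 < k) :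
    Wk J T F k = 0 := by
  ext x
  simp [Wk, h.tree.Tkset_of_lt hm hk]

lemma Adm.N_eq_tsum_nat (h : Adm Δ S J T Qt d F) (hm : 1 ≤ m) (β : Idx m → ℕ) (u : Idx m → ℝ) :
    N J T F d β u = ∑' n : ℕ, ∫⁻ t in Set.Ioc ((2:ℝ)^(Qt.1 - n -1)) ((2:ℝ)^(Qt.1 - n)),
      ‖V J (Wk J T F (Qt.1 - n)) (dd d t) β u‖ₑ * ENNReal.ofReal t⁻¹ := by
  have hinj : Function.Injective fun n : ℕ => Qt.1 - n := fun a b hab => by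
    have : Qt.1 - (a : ℤ) = Qt.1 - b := hab
    omega
  refine (hinj.tsum_eq ?_).symm
  intro k hk
  by_contra hr
  refine hk ?_
  have hlt : Qt.1 < k := by
    by_contra hle
    exact hr ⟨(Qt.1 - k).toNat, by simp only; omega⟩
  simp [h.Wk_of_lt hm hlt, V_zero_left]

/-- The estimate in a symmetric direction, by positivity and telescoping over the scales. -/
lemma Bdd.of_mem (hm : 1 ≤ m) (hΔ : 1 ≤ Δ) (hα : 0 ≤ α) (hα1 : α ≤ 1) {i : Fin m} (hi : i ∈ S)
    (hS : ∀ b ∈ outer S, Bdd Δ α S b) :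
    Bdd Δ α S (Pi.single (Sum.inl i) 1 + Pi.single (Sum.inr i) 1) := by
  choose! C hC using hS
  obtain ⟨C₀, hC₀⟩ := exists_boundary_le hm hΔ hα hα1 S
  refine ⟨(cOuter m Δ).toNNReal * ∑ b ∈ outer S, C b + (2 * Real.pi).toNNReal * C₀,
    fun J T Qt d F h => ?_⟩
  rw [h.N_eq_tsum_nat hm]
  refine ENNReal.tsum_le_of_sum_range_le fun n => ?_
  refine (Finset.sum_le_sum_of_subset (Finset.range_mono n.le_succ)).trans ?_
  have hI : ∀ (k : ℤ) (b : Idx m → ℕ), 0 ≤ ∫ t in Set.Ioc ((2:ℝ)^(k-1)) ((2:ℝ)^k),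
      |V J (Wk J T F k) (dd d t) b 0| * t⁻¹ := fun k b =>
    setIntegral_nonneg measurableSet_Ioc fun t ht =>
      mul_nonneg (abs_nonneg _) (inv_pos.2 (pos_of_mem_Ioc ht)).le
  have hcO : 0 ≤ cOuter m Δ := by unfold cOuter; positivity
  set I : ℤ → (Idx m → ℕ) → ℝ := fun k b => ∫ t in Set.Ioc ((2:ℝ)^(k-1)) ((2:ℝ)^k),
      |V J (Wk J T F k) (dd d t) b 0| * t⁻¹ with hIdef
  set β : Idx m → ℕ := Pi.single (Sum.inl i) 1 + Pi.single (Sum.inr i) 1 with hβ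
  set p : ℤ → ℤ → ℝ := fun k l => V J (Wk J T F k) (dd d (2 ^ l)) 0 0 with hp
  have hsum : ∑ r ∈ Finset.range (n + 1), I (Qt.1 - r) β ≤
      cOuter m Δ * (∑ b ∈ outer S, ∑ r ∈ Finset.range (n + 1), I (Qt.1 - r) b) +
      2 * Real.pi * |∑ r ∈ Finset.range (n + 1),
        (p (Qt.1 - r) (Qt.1 - r) - p (Qt.1 - r) (Qt.1 - r - 1))| := by
    have h1 : ∀ k, I k β ≤ cOuter m Δ * (∑ b ∈ outer S, I k b) -
        2 * Real.pi * (p k k - p k (k - 1)) := fun k =>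
      (by linarith [hI k β] : I k β ≤ 2 * I k β).trans (h.two_mul_integral_abs_V_le hΔ hi k)
    refine (Finset.sum_le_sum fun (r : ℕ) _ => h1 (Qt.1 - r)).trans ?_
    rw [Finset.sum_sub_distrib, ← Finset.mul_sum, ← Finset.mul_sum, Finset.sum_comm]
    have := mul_le_mul_of_nonneg_left (neg_abs_le (∑ r ∈ Finset.range (n + 1),
        (p (Qt.1 - r) (Qt.1 - r) - p (Qt.1 - r) (Qt.1 - r - 1)))) Real.two_pi_pos.le
    linarith
  have hbd : ENNReal.ofReal |∑ r ∈ Finset.range (n + 1),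
        (p (Qt.1 - r) (Qt.1 - r) - p (Qt.1 - r) (Qt.1 - r - 1))| ≤ C₀ * rhs α J T Qt d F := by
    rw [← Real.enorm_eq_ofReal_abs, sum_range_scales_eq]
    refine le_trans ?_ (hC₀ J T Qt d F h n)
    refine enorm_sub_le.trans (add_le_add (enorm_sub_le.trans (add_le_add le_rfl ?_)) le_rfl)
    exact enorm_sum_le _ _
  have hN : ∀ b ∈ outer S, ENNReal.ofReal (∑ r ∈ Finset.range (n + 1), I (Qt.1 - r) b) ≤
      C b * rhs α J T Qt d F := by
    intro b hb
    refine le_trans ?_ (hC b hb J T Qt d F h)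
    rw [h.N_eq_tsum_nat hm, ENNReal.ofReal_sum_of_nonneg fun r _ => hI _ b]
    refine le_trans (le_of_eq ?_) (ENNReal.sum_le_tsum (Finset.range (n + 1)))
    exact Finset.sum_congr rfl fun r _ => h.ofReal_integral_abs_V _ b
  calc _ = ENNReal.ofReal (∑ r ∈ Finset.range (n + 1), I (Qt.1 - r) β) := by
        rw [ENNReal.ofReal_sum_of_nonneg fun r _ => hI _ β]
        exact Finset.sum_congr rfl fun r _ => (h.ofReal_integral_abs_V _ β).symm
    _ ≤ ENNReal.ofReal (cOuter m Δ) * ENNReal.ofReal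
          (∑ b ∈ outer S, ∑ r ∈ Finset.range (n + 1), I (Qt.1 - r) b) +
        ENNReal.ofReal (2 * Real.pi) * ENNReal.ofReal |∑ r ∈ Finset.range (n + 1),
          (p (Qt.1 - r) (Qt.1 - r) - p (Qt.1 - r) (Qt.1 - r - 1))| := by
        rw [← ENNReal.ofReal_mul hcO, ← ENNReal.ofReal_mul Real.two_pi_pos.le]
        exact (ENNReal.ofReal_le_ofReal hsum).trans ENNReal.ofReal_add_le
    _ ≤ _ := by
        push_cast
        rw [add_mul, mul_assoc, mul_assoc, Finset.sum_mul, ENNReal.ofReal_sum_of_nonneg fun b _ =>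
          Finset.sum_nonneg fun r _ => hI _ b]
        exact add_le_add (mul_le_mul' le_rfl (Finset.sum_le_sum hN)) (mul_le_mul' le_rfl hbd)

lemma Bdd.mixed_of_insert (hm : 1 ≤ m) (hΔ : 1 ≤ Δ) (hα : 0 ≤ α) (hαm : α * m < 1) {i : Fin m}
    (hi : i ∉ S)
    (hB : Bdd Δ α (insert i S) (Pi.single (Sum.inl i) 1 + Pi.single (Sum.inr i) 1))
    (β : Idx m → ℕ) (h0 : β (Sum.inl i) ≠ 0) (h1 : β (Sum.inr i) ≠ 0) : Bdd Δ α S β := by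
  obtain ⟨C, hC⟩ := Bdd.exists_N_le hm hi hΔ hα hαm hB β h0 h1
  refine ⟨C, fun J T Qt d F h => ?_⟩
  simpa using hC J T Qt d F h 0 0 le_rfl (by simp)

/-- The forms with derivatives in both copies of a symmetric direction are bounded. -/
theorem Bdd.mixed (hm : 1 ≤ m) (hΔ : 1 ≤ Δ) (hα : 0 ≤ α) (hα1 : α ≤ 1) (hαm : α * m < 1)
    (S : Finset (Fin m)) {i : Fin m} (hi : i ∈ S) :
    Bdd Δ α S (Pi.single (Sum.inl i) 1 + Pi.single (Sum.inr i) 1) := by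
  induction hn : Sᶜ.card using Nat.strong_induction_on generalizing S i with
  | _ n ih =>
  refine Bdd.of_mem hm hΔ hα hα1 hi fun b hb => ?_
  refine Bdd.of_two_le hΔ hα hαm (fun i' hi' β h0 h1 => ?_) b (eq_zero_of_mem_outer hb)
    (sum_of_mem_outer hb).ge
  refine Bdd.mixed_of_insert hm hΔ hα hαm hi' ?_ β h0 h1
  refine ih _ ?_ _ (Finset.mem_insert_self _ _) rfl
  rw [← hn]
  exact Finset.card_lt_card (Finset.compl_ssubset_compl.2 (Finset.ssubset_insert hi'))

end

section
variable {m : ℕ} {Δ α : ℝ} {S : Finset (Fin m)} {J : Matrix (Idx m) (Fin m) ℝ}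
  {T : Set (ℤ × (Fin m → ℤ))} {Qt : ℤ × (Fin m → ℤ)} {d : Fin m → ℝ}
  {F : Corner m → (Fin m → ℝ) → ℝ}

lemma fderiv_prod_gd (γ : Idx m → ℕ) (b : Idx m) (x : Idx m → ℝ) :
    fderiv ℝ (fun y : Idx m → ℝ => ∏ a, gd (γ a) (y a)) x (Pi.single b 1) =
      ∏ a, gd ((γ + Pi.single b 1 : Idx m → ℕ) a) (x a) := by
  have hg : ∀ a ∈ Finset.univ, HasFDerivAt (fun y : Idx m → ℝ => gd (γ a) (y a))
      (gd (γ a + 1) (x a) • ContinuousLinearMap.proj (R := ℝ) (φ := fun _ : Idx m => ℝ) a) x :=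
    fun a _ => (hasDerivAt_gd (γ a) (x a)).comp_hasFDerivAt x
      (ContinuousLinearMap.proj (R := ℝ) (φ := fun _ : Idx m => ℝ) a).hasFDerivAt
  rw [(HasFDerivAt.finsetProd hg).fderiv]
  simp only [_root_.sum_apply, _root_.smul_apply,
    ContinuousLinearMap.proj_apply, smul_eq_mul]
  rw [Finset.sum_eq_single b (fun a _ hab => by rw [Pi.single_eq_of_ne hab]; simp) (by simp),
    ← Finset.mul_prod_erase _ _ (Finset.mem_univ b), mul_comm]
  congr 1
  · simp
  · refine Finset.prod_congr rfl fun a ha => ?_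
    simp [Pi.single_eq_of_ne (Finset.ne_of_mem_erase ha)]

lemma ddg_eq_prod (i : Fin m) (x : Idx m → ℝ) :
    ddg i x = ∏ a, gd ((Pi.single (Sum.inl i) 1 + Pi.single (Sum.inr i) 1 : Idx m → ℕ) a) (x a) := by
  have h0 : (gss : (Idx m → ℝ) → ℝ) = fun y => ∏ a, gd ((0 : Idx m → ℕ) a) (y a) := by
    ext y
    simp only [Pi.zero_apply, gd_zero, gss, ← Real.exp_sum, Finset.mul_sum]
  unfold ddg
  rw [h0]
  simp only [fderiv_prod_gd, zero_add]

lemma dilM_ddg_eq_ker (J : Matrix (Idx m) (Fin m) ℝ) (hd : ∀ h, 0 < d h) {t : ℝ} (ht : 0 < t)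
    (i : Fin m) (u x : Idx m → ℝ) (p : Fin m → ℝ) :
    dilM (t • Matrix.diagonal (Sum.elim d d)) (ddg i)
      (x + J.mulVec p + (t • Matrix.diagonal (Sum.elim d d)).mulVec u) =
    ker J (dd d t) (Pi.single (Sum.inl i) 1 + Pi.single (Sum.inr i) 1) u p x := by
  have hD : t • Matrix.diagonal (Sum.elim d d) = Matrix.diagonal (dd d t) := by
    ext a b
    by_cases hab : a = b
    · subst hab; simp [dd]
    · simp [hab]
  have hne : ∀ a, dd d t a ≠ 0 := fun a => (dd_pos hd ht a).ne'
  have hdet : IsUnit (Matrix.diagonal (dd d t)).det := by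
    rw [Matrix.det_diagonal]
    exact (Finset.prod_ne_zero_iff.2 fun a _ => hne a).isUnit
  have hy : x + J.mulVec p + (Matrix.diagonal (dd d t)).mulVec u = (Matrix.diagonal (dd d t)).mulVec
      fun a => (x a + (J *ᵥ p) a) / dd d t a + u a := by
    ext a
    have := hne a
    simp only [Pi.add_apply, Matrix.mulVec_diagonal]
    field_simp
  rw [hD, dilM, hy, Matrix.mulVec_mulVec, Matrix.nonsing_inv_mul _ hdet, Matrix.one_mulVec,
    ddg_eq_prod, Matrix.det_diagonal, ← Finset.prod_inv_distrib, ← Finset.prod_mul_distrib]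
  rfl

lemma ph_uniform_decay_shift (b : ℕ) (u : ℝ) {c₁ c₂ : ℝ} (h1 : 0 < c₁) (h2 : 0 ≤ c₂) :
    ∃ C : ℝ, 0 ≤ C ∧ ∀ σ, c₁ ≤ σ → σ ≤ c₂ → ∀ y, |ph σ b u y| ≤ C * ((1 + |y|) ^ 2)⁻¹ := by
  obtain ⟨C, hC, h⟩ := ph_uniform_decay b h1 h2
  refine ⟨C * (1 + c₂ * |u|) ^ 2, by positivity, fun σ hσ1 hσ2 y => ?_⟩
  have hσ : 0 < σ := h1.trans_le hσ1
  have e : ph σ b u y = ph σ b 0 (y + σ * u) := by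
    simp only [ph, add_zero]
    congr 2
    field_simp
  rw [e]
  refine (h σ hσ1 hσ2 _).trans ?_
  rw [mul_assoc, ← div_eq_mul_inv ((1 + c₂ * |u|) ^ 2)]
  refine mul_le_mul_of_nonneg_left ?_ hC
  rw [inv_eq_one_div, div_le_div_iff₀ (by positivity) (by positivity), one_mul, ← mul_pow]
  refine pow_le_pow_left₀ (by positivity) ?_ 2
  have hy : |y| ≤ |y + σ * u| + c₂ * |u| := by
    have h3 : |y| ≤ |y + σ * u| + |σ * u| := by
      simpa using abs_sub (y + σ * u) (σ * u)
    rw [abs_mul, abs_of_pos hσ] at h3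
    nlinarith [abs_nonneg u]
  nlinarith [abs_nonneg (y + σ * u), mul_nonneg h2 (abs_nonneg u),
    mul_nonneg (mul_nonneg h2 (abs_nonneg u)) (abs_nonneg (y + σ * u))]

lemma exists_ker_decay_shift (J : Matrix (Idx m) (Fin m) ℝ) (hd : ∀ h, 0 < d h) (β : Idx m → ℕ)
    (u : Idx m → ℝ) {s₁ s₂ : ℝ} (h1 : 0 < s₁) (h2 : 0 ≤ s₂) :
    ∃ C : ℝ, 0 ≤ C ∧ ∀ t, s₁ ≤ t → t ≤ s₂ → ∀ p x,
      |ker J (dd d t) β u p x| ≤ C * ∏ a, ((1 + |x a + (J *ᵥ p) a|) ^ 2)⁻¹ := by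
  choose C hC0 hC using fun a => ph_uniform_decay_shift (β a) (u a)
    (dd_pos hd h1 a) (mul_nonneg h2 (dd_pos hd one_pos a).le)
  refine ⟨∏ a, C a, Finset.prod_nonneg fun a _ => hC0 a, fun t ht1 ht2 p x => ?_⟩
  have hda : ∀ a, (0:ℝ) ≤ Sum.elim d d a := fun a => by
    simpa [dd] using (dd_pos hd one_pos a).le
  rw [ker, Finset.abs_prod, ← Finset.prod_mul_distrib]
  refine Finset.prod_le_prod (fun _ _ => abs_nonneg _) fun a _ => hC a _ ?_ ?_ _
  · exact mul_le_mul_of_nonneg_right ht1 (hda a)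
  · simpa [dd] using mul_le_mul_of_nonneg_right ht2 (hda a)

end

section
variable {m : ℕ} {Δ α : ℝ} {S : Finset (Fin m)} {J : Matrix (Idx m) (Fin m) ℝ}
  {T : Set (ℤ × (Fin m → ℤ))} {Qt : ℤ × (Fin m → ℤ)} {d : Fin m → ℝ}
  {F : Corner m → (Fin m → ℝ) → ℝ}

lemma measurable_integral_ker (J : Matrix (Idx m) (Fin m) ℝ) (d : Fin m → ℝ) (β : Idx m → ℕ)
    (u : Idx m → ℝ) : Measurable fun q : (Idx m → ℝ) × ℝ => ∫ p, ker J (dd d q.2) β u p q.1 := by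
  have h : Measurable fun q : ((Idx m → ℝ) × ℝ) × (Fin m → ℝ) =>
      ker J (dd d q.1.2) β u q.2 q.1.1 :=
    (measurable_ker J β u).comp (((measurable_dd d).comp (measurable_snd.comp measurable_fst)).prodMk
      (measurable_snd.prodMk (measurable_fst.comp measurable_fst)))
  exact (h.stronglyMeasurable.integral_prod_right (ν := volume)).measurable

lemma Adm.integrable_weight_mul_integral_ker (h : Adm Δ S J T Qt d F) (k : ℤ) (β : Idx m → ℕ)
    (u : Idx m → ℝ) :
    Integrable (fun q : (Idx m → ℝ) × ℝ => Wk J T F k q.1 * ∫ p, ker J (dd d q.2) β u p q.1)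
      (volume.prod (volume.restrict (Set.Ioc ((2:ℝ)^(k-1)) ((2:ℝ)^k)))) := by
  have hmeas : Measurable fun q : (Idx m → ℝ) × ℝ =>
      Wk J T F k q.1 * ∫ p, ker J (dd d q.2) β u p q.1 :=
    ((h.measurable_Wk k).comp measurable_fst).mul (measurable_integral_ker J d β u)
  refine ⟨hmeas.aestronglyMeasurable, ?_⟩
  obtain ⟨C, hC0, hC⟩ := exists_ker_decay_shift J h.pos β u (zpow_pos two_pos (k - 1))
    (zpow_pos two_pos k).le
  have hdec := integrable_weight_decay (h.isUnit fun _ => 0).ne_zero (h.integrable_Wk k)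
  set D : (Fin m → ℝ) → (Idx m → ℝ) → ℝ := fun p x => ∏ a, ((1 + |x a + (J *ᵥ p) a|) ^ 2)⁻¹ with hD
  have hfin := hdec.2
  unfold HasFiniteIntegral at hfin ⊢
  rw [Measure.volume_eq_prod, lintegral_prod_symm _ hdec.1.enorm] at hfin
  rw [lintegral_prod_symm _ hmeas.enorm.aemeasurable]
  have hbd : ∀ t ∈ Set.Ioc ((2:ℝ)^(k-1)) ((2:ℝ)^k),
      ∫⁻ x, ‖Wk J T F k x * ∫ p, ker J (dd d t) β u p x‖ₑ ≤
        ENNReal.ofReal C * ∫⁻ x, ∫⁻ p, ‖Wk J T F k x * D p x‖ₑ := by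
    intro t ht
    rw [← lintegral_const_mul' _ _ ENNReal.ofReal_ne_top]
    refine lintegral_mono fun x => ?_
    rw [← lintegral_const_mul' _ _ ENNReal.ofReal_ne_top, ← integral_const_mul]
    refine (enorm_integral_le_lintegral_enorm _).trans (lintegral_mono fun p => ?_)
    rw [enorm_mul, enorm_mul, mul_left_comm]
    refine mul_le_mul' le_rfl ?_
    rw [Real.enorm_eq_ofReal_abs, Real.enorm_eq_ofReal_abs, ← ENNReal.ofReal_mul hC0]
    refine ENNReal.ofReal_le_ofReal ((hC t ht.1.le ht.2 p x).trans ?_)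
    exact mul_le_mul_of_nonneg_left (le_abs_self _) hC0
  refine (setLIntegral_mono' measurableSet_Ioc hbd).trans_lt ?_
  rw [setLIntegral_const]
  exact ENNReal.mul_lt_top (ENNReal.mul_lt_top ENNReal.ofReal_lt_top hfin) (by simp)

lemma Adm.integral_weight_mul_integral_ker (h : Adm Δ S J T Qt d F) (k : ℤ) (β : Idx m → ℕ)
    (u : Idx m → ℝ) {t : ℝ} (ht : 0 < t) :
    ∫ x, Wk J T F k x * ∫ p, ker J (dd d t) β u p x = V J (Wk J T F k) (dd d t) β u := by
  have hi := integrable_V (h.isUnit fun _ => 0).ne_zero (h.integrable_Wk k)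
    (fun a => (dd_pos h.pos ht a).ne') β u
  rw [V, Measure.volume_eq_prod, integral_prod_symm _ hi]
  simp only [integral_const_mul]

/-- Interchanging the integrals in one scale of the form. -/
lemma Adm.enorm_scale_le (h : Adm Δ S J T Qt d F) (k : ℤ) (β : Idx m → ℕ) (u : Idx m → ℝ)
    {c : ℝ → ℂ} (hc : Measurable c)
    (hc1 : ∀ᵐ t ∂(volume.restrict (Set.Ioi (0:ℝ))), ‖c t‖ ≤ 1) {κ : ℝ} (hκ : 0 ≤ κ) :
    ‖∫ x : Idx m → ℝ, Complex.ofReal (Wk J T F k x) *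
      ∫ t in Set.Ioc ((2:ℝ)^(k-1)) ((2:ℝ)^k), c t * Complex.ofReal (κ *
        ∫ p, ker J (dd d t) β u p x) * (t : ℂ)⁻¹‖ₑ ≤
    ENNReal.ofReal κ * ∫⁻ t in Set.Ioc ((2:ℝ)^(k-1)) ((2:ℝ)^k),
      ‖V J (Wk J T F k) (dd d t) β u‖ₑ * ENNReal.ofReal t⁻¹ := by
  have hc2 : ∀ᵐ t ∂(volume.restrict (Set.Ioc ((2:ℝ)^(k-1)) ((2:ℝ)^k))), ‖c t‖ ≤ 1 :=
    ae_restrict_of_ae_restrict_of_subset (fun t ht => pos_of_mem_Ioc ht) hc1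
  have hmem : ∀ᵐ t ∂(volume.restrict (Set.Ioc ((2:ℝ)^(k-1)) ((2:ℝ)^k))),
      t ∈ Set.Ioc ((2:ℝ)^(k-1)) ((2:ℝ)^k) := ae_restrict_mem measurableSet_Ioc
  have hInt : Integrable (fun q : (Idx m → ℝ) × ℝ => (c q.2 * κ * (q.2 : ℂ)⁻¹) *
      Complex.ofReal (Wk J T F k q.1 * ∫ p, ker J (dd d q.2) β u p q.1))
      (volume.prod (volume.restrict (Set.Ioc ((2:ℝ)^(k-1)) ((2:ℝ)^k)))) := by
    refine (h.integrable_weight_mul_integral_ker k β u).ofReal.bdd_mul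
      (c := κ * ((2:ℝ)^(k-1))⁻¹) (by fun_prop) ?_
    filter_upwards [Measure.quasiMeasurePreserving_snd.ae hc2,
      Measure.quasiMeasurePreserving_snd.ae hmem] with q hq1 hq2
    have hq0 := pos_of_mem_Ioc hq2
    rw [norm_mul, norm_mul, norm_inv, Complex.norm_real, Complex.norm_real, Real.norm_of_nonneg hκ,
      Real.norm_of_nonneg hq0.le]
    have : (0:ℝ) < 2 ^ (k - 1) := by positivity
    refine mul_le_mul (mul_le_of_le_one_left hκ hq1) (inv_anti₀ this hq2.1.le) (by positivity) hκ
  have e : ∫ x : Idx m → ℝ, Complex.ofReal (Wk J T F k x) *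
      ∫ t in Set.Ioc ((2:ℝ)^(k-1)) ((2:ℝ)^k), c t * Complex.ofReal (κ *
        ∫ p, ker J (dd d t) β u p x) * (t : ℂ)⁻¹ =
      ∫ t in Set.Ioc ((2:ℝ)^(k-1)) ((2:ℝ)^k), (c t * κ * (t : ℂ)⁻¹) *
        Complex.ofReal (V J (Wk J T F k) (dd d t) β u) := by
    calc _ = ∫ x : Idx m → ℝ, ∫ t in Set.Ioc ((2:ℝ)^(k-1)) ((2:ℝ)^k), (c t * κ * (t : ℂ)⁻¹) *
          Complex.ofReal (Wk J T F k x * ∫ p, ker J (dd d t) β u p x) := by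
          refine integral_congr_ae (ae_of_all _ fun x => ?_)
          simp only
          rw [← integral_const_mul]
          refine integral_congr_ae (ae_of_all _ fun t => ?_)
          simp only [Complex.ofReal_mul]
          ring
      _ = ∫ t in Set.Ioc ((2:ℝ)^(k-1)) ((2:ℝ)^k), ∫ x : Idx m → ℝ, (c t * κ * (t : ℂ)⁻¹) *
          Complex.ofReal (Wk J T F k x * ∫ p, ker J (dd d t) β u p x) :=
          integral_integral_swap hInt
      _ = _ := by
          refine setIntegral_congr_fun measurableSet_Ioc fun t ht => ?_
          rw [integral_const_mul, integral_complex_ofReal,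
            h.integral_weight_mul_integral_ker k β u (pos_of_mem_Ioc ht)]
  rw [e, ← lintegral_const_mul' _ _ ENNReal.ofReal_ne_top]
  refine (enorm_integral_le_lintegral_enorm _).trans (lintegral_mono_ae ?_)
  filter_upwards [hc2, hmem] with t ht1 ht2
  have ht0 := pos_of_mem_Ioc ht2
  rw [← ofReal_norm, ← ofReal_norm, ← ENNReal.ofReal_mul (norm_nonneg _), ← ENNReal.ofReal_mul hκ]
  refine ENNReal.ofReal_le_ofReal ?_
  rw [norm_mul, norm_mul, norm_mul, norm_inv, Complex.norm_real, Complex.norm_real,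
    Complex.norm_real, Real.norm_of_nonneg hκ, Real.norm_of_nonneg ht0.le, mul_assoc, mul_assoc,
    mul_comm t⁻¹]
  exact mul_le_of_le_one_left (by positivity) ht1

lemma Adm.enorm_LambdaK_le (h : Adm Δ S J T Qt d F) (i : Fin m) (u : Idx m → ℝ)
    {c : ℝ → ℂ} (hc : Measurable c)
    (hc1 : ∀ᵐ t ∂(volume.restrict (Set.Ioi (0:ℝ))), ‖c t‖ ≤ 1) {κ : ℝ} (hκ : 0 ≤ κ) :
    ‖LambdaK J T (fun t x => c t * Complex.ofReal (κ *
      ∫ p : Fin m → ℝ, dilM (t • Matrix.diagonal (Sum.elim d d)) (ddg i)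
        (x + J.mulVec p + (t • Matrix.diagonal (Sum.elim d d)).mulVec u))) F‖ₑ ≤
    ENNReal.ofReal κ *
      N J T F d (Pi.single (Sum.inl i) 1 + Pi.single (Sum.inr i) 1) u := by
  unfold LambdaK N
  rw [← ENNReal.tsum_mul_left]
  refine enorm_tsum_le_tsum_enorm.trans (ENNReal.tsum_le_tsum fun k => ?_)
  refine le_trans (le_of_eq ?_) (h.enorm_scale_le k
    (Pi.single (Sum.inl i) 1 + Pi.single (Sum.inr i) 1) u hc hc1 hκ)
  congr 1
  refine integral_congr_ae (ae_of_all _ fun x => ?_)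
  simp only
  congr 1
  refine setIntegral_congr_fun measurableSet_Ioc fun t ht => ?_
  simp only [dilM_ddg_eq_ker J h.pos (pos_of_mem_Ioc ht)]

lemma abs_le_en (u : Idx m → ℝ) (a : Idx m) : |u a| ≤ en u := by
  unfold en
  refine Real.abs_le_sqrt ?_
  exact Finset.single_le_sum (f := fun a => u a ^ 2) (fun _ _ => sq_nonneg _) (Finset.mem_univ a)

lemma card_rest (i : Fin m) : Fintype.card (Rest i) + 2 = 2 * m := by
  have h1 : Fintype.card (Rest i) = Fintype.card (Idx m) - Fintype.card {a : Idx m // ix a = i} :=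
    Fintype.card_subtype_compl _
  have h2 : Fintype.card {a : Idx m // ix a = i} = 2 := by
    rw [Fintype.card_subtype,
      show (Finset.univ.filter fun a : Idx m => ix a = i) = {Sum.inl i, Sum.inr i} by
        ext a
        rw [Finset.mem_filter]
        rcases a with a | a <;> simp [ix]]
    simp
  have := i.pos
  rw [h1, h2, Fintype.card_sum, Fintype.card_fin]
  omega

end

/-- Induction proposition, bound for the first kernel
`K(t,x) = c(t)(1+|u|^{4m})⁻¹ ∫ (∂⁰_i∂¹_i g)_{tD}(x + Jp + tDu) dp`, for indices `i > l`. -/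
theorem statement15 (m l : ℕ) (hm : 2 ≤ m) (hl : l < m)
    (Δ α : ℝ) (hΔ : 1 < Δ) (hα0 : 0 < α) (hα : α < 1 / m) :
    ∃ C : ℝ≥0, ∀ J : Matrix (Idx m) (Fin m) ℝ,
      (∀ j : Corner m, IsReg Δ (Amat J j)) →
      (∀ h : Fin m, (h:ℕ) < l → ∀ k, J (Sum.inl h) k = J (Sum.inr h) k) →
      ∀ (T : Set (ℤ × (Fin m → ℤ))) (Qt : ℤ × (Fin m → ℤ)), ConvexTree T Qt →
      ∀ d : Fin m → ℝ, (∀ h, 0 < d h) →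
      (∀ h i : Fin m, (h:ℕ) < l → l ≤ (i:ℕ) → d h ≤ d i) →
      (∀ i i' : Fin m, l ≤ (i:ℕ) → l ≤ (i':ℕ) → d i = d i') →
      ∀ F : Corner m → (Fin m → ℝ) → ℝ,
        (∀ j, ContDiff ℝ (⊤ : ℕ∞) (F j) ∧ HasCompactSupport (F j)) →
        (∀ j : Corner m, ∀ i : Fin m, (i:ℕ) < l → F j = F (istar i j)) →
      ∀ i : Fin m, l ≤ (i:ℕ) →
      ∀ c : ℝ → ℂ, Measurable c →
        (∀ᵐ t ∂(volume.restrict (Set.Ioi (0:ℝ))), ‖c t‖ ≤ 1) →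
      ∀ u : Idx m → ℝ,
        ENNReal.ofReal ‖LambdaK J T
            (fun t x => c t * Complex.ofReal ((1 + en u ^ (4*m))⁻¹ *
              ∫ p : Fin m → ℝ, dilM (t • Matrix.diagonal (Sum.elim d d)) (ddg i)
                (x + J.mulVec p + (t • Matrix.diagonal (Sum.elim d d)).mulVec u))) F‖ ≤
          C * ENNReal.ofReal (∏ h : Fin m, max (d h ^ (2*α)) (d h ^ (-2 : ℝ))) *
            volume (dC Qt) * ∏ j : Corner m, MalTree α (F j) (Amat J j) T := by
  have hm1 : 1 ≤ m := by omega
  have hm0 : (0:ℝ) < m := by exact_mod_cast hm1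
  have hαm : α * m < 1 := by rwa [lt_div_iff₀ hm0] at hα
  have hα1 : α ≤ 1 := by
    have : (1:ℝ) ≤ m := by exact_mod_cast hm1
    nlinarith
  set S : Finset (Fin m) := Finset.univ.filter fun h => (h : ℕ) < l with hS
  have hmem : ∀ h : Fin m, h ∈ S ↔ (h : ℕ) < l := fun h => by
    rw [hS, Finset.mem_filter]; simp
  have hnmem : ∀ h : Fin m, h ∉ S ↔ l ≤ (h : ℕ) := fun h => by rw [hmem, not_lt]
  have hex : ∀ i : Fin m, ∃ C : ℝ≥0, i ∉ S → ∀ J T Qt d F, Adm Δ S J T Qt d F →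
      ∀ u : Idx m → ℝ, N J T F d (Pi.single (Sum.inl i) 1 + Pi.single (Sum.inr i) 1) u ≤
        C * ENNReal.ofReal ((1 + en u) ^ (4 * m)) * rhs α J T Qt d F := by
    intro i
    by_cases hi : i ∈ S
    · exact ⟨0, fun h => (h hi).elim⟩
    obtain ⟨C, hC⟩ := Bdd.exists_N_le hm1 hi hΔ.le hα0.le hαm
      (Bdd.mixed hm1 hΔ.le hα0.le hα1 hαm (insert i S) (Finset.mem_insert_self i S))
      (Pi.single (Sum.inl i) 1 + Pi.single (Sum.inr i) 1) (by simp) (by simp)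
    refine ⟨C, fun _ J T Qt d F h u => ?_⟩
    have := hC J T Qt d F h u (en u) (Real.sqrt_nonneg _) (abs_le_en u)
    rwa [card_rest, show 2 * (2 * m) = 4 * m by ring] at this
  choose C hC using hex
  refine ⟨2 ^ (4 * m) * ∑ i, C i, fun J hreg hrow T Qt hT d hd hle heq F hF hsymm i hi c hc hc1 u => ?_⟩
  have h : Adm Δ S J T Qt d F :=
    { reg := hreg
      row := fun h hh => hrow h ((hmem h).1 hh)
      tree := hT
      pos := hd
      le := fun h hh i hi => hle h i ((hmem h).1 hh) ((hnmem i).1 hi)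
      eq := fun i hi i' hi' => heq i i' ((hnmem i).1 hi) ((hnmem i').1 hi')
      cont := fun j => (hF j).1.continuous
      supp := fun j => (hF j).2
      symm := fun j i hi => hsymm j i ((hmem i).1 hi) }
  have hu : 0 ≤ en u := Real.sqrt_nonneg _
  have hκ : 0 ≤ (1 + en u ^ (4 * m))⁻¹ := by positivity
  have hpow : (1 + en u ^ (4 * m))⁻¹ * (1 + en u) ^ (4 * m) ≤ 2 ^ (4 * m) := by
    rw [inv_mul_le_iff₀ (by positivity)]
    have h1 : (1 + en u) ^ (4 * m) ≤ (2 * max 1 (en u)) ^ (4 * m) :=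
      pow_le_pow_left₀ (by positivity)
        (by linarith [le_max_left 1 (en u), le_max_right 1 (en u)]) _
    have h2 : max 1 (en u) ^ (4 * m) ≤ 1 + en u ^ (4 * m) := by
      rcases max_cases 1 (en u) with ⟨h3, -⟩ | ⟨h3, -⟩ <;> rw [h3]
      · rw [one_pow]; linarith [pow_nonneg hu (4 * m)]
      · linarith
    rw [mul_pow] at h1
    nlinarith [pow_pos (two_pos (α := ℝ)) (4 * m)]
  rw [ofReal_norm]
  refine (h.enorm_LambdaK_le i u hc hc1 hκ).trans ?_
  refine (mul_le_mul' le_rfl (hC i ((hnmem i).2 hi) J T Qt d F h u)).trans ?_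
  have hCi : (C i : ℝ≥0∞) ≤ ∑ i, (C i : ℝ≥0∞) :=
    Finset.single_le_sum (f := fun i => (C i : ℝ≥0∞)) (fun _ _ => zero_le) (Finset.mem_univ i)
  calc _ = ENNReal.ofReal ((1 + en u ^ (4 * m))⁻¹ * (1 + en u) ^ (4 * m)) * C i *
        rhs α J T Qt d F := by
        rw [ENNReal.ofReal_mul hκ]; ring
    _ ≤ ENNReal.ofReal (2 ^ (4 * m)) * (∑ i, (C i : ℝ≥0∞)) * rhs α J T Qt d F := by
        gcongr
    _ = _ := by
        rw [rhs, Pd, ENNReal.ofReal_pow zero_le_two, ENNReal.ofReal_ofNat]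
        push_cast
        ring

end SBL
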